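/- arXiv:1504.06683 — 2 statements merged into one kernel-verified Lean document; each statement's English description precedes it below -/
import Mathlib

section
/- Let $(\Omega,\mathcal F,P)$ be a complete probability space with a filtration $(\mathcal F_t)_{t=0}^T$ of complete sub-$\sigma$-algebras of $\mathcal F$. Given integers $n_t$, let $n=n_0+\dots+n_T$, let $\mathcal N=\{(x_t)_{t=0}^T : x_t\in L^0(\Omega,\mathcal F_t,P;\mathbb R^{n_t})\}$, and let $\mathcal N^\infty\subset\mathcal N$ be the subspace of essentially bounded strategies. The expectation of an extended-real-valued measurable function is defined as $+\infty$ unless its positive part is integrable. Let $f:\mathbb R^n\times\mathbb R^m\times\Omega\to[-\infty,+\infty]$ be $\mathcal B(\mathbb R^n\times\mathbb R^m)\otimes\mathcal F$-measurable, with $f(\cdot,\cdot,\omega)$ proper, lower semicontinuous and convex for every $\omega$, and let $Ef(x,u)=\int f(x(\omega),u(\omega),\omega)\,dP(\omega)$. Let $\mathcal U,\mathcal Y\subset L^0(\Omega,\mathcal F,P;\mathbb R^m)$ be linear subspaces that are decomposable ($1_Au+1_{\Omega\setminus A}u'$ belongs to the space whenever $A\in\mathcal F$, $u$ belongs to the space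 and $u'\in L^\infty$), such that $u\cdot y$ is integrable for all $u\in\mathcal U$, $y\in\mathcal Y$ and the bilinear form $\langle u,y\rangle=E(u\cdot y)$ places $\mathcal U$ and $\mathcal Y$ in separating duality. Define $$\tilde\varphi(u)=\inf_{x\in\mathcal N^\infty}Ef(x,u),\qquad \tilde\varphi^*(y)=\sup_{u\in\mathcal U}\{\langle u,y\rangle-\tilde\varphi(u)\},$$ $$f^*(v,y,\omega)=\sup_{x\in\mathbb R^n,\,u\in\mathbb R^m}\{x\cdot v+u\cdot y-f(x,u,\omega)\},\qquad \underline l(x,y,\omega)=\sup_{v\in\mathbb R^n}\{x\cdot v-f^*(v,y,\omega)\},$$ $E\underline l(x,y)=\int\underline l(x(\omega),y(\omega),\omega)\,dP(\omega)$, $\operatorname{dom}_1Ef=\{x\in\mathcal N: Ef(x,u)<+\infty\text{ for some }u\in\mathcal U\}$ and $\operatorname{dom}_1f(\omega)=\{x\in\mathbb R^n: f(x,u,\omega)<+\infty\text{ for some }u\in\mathbb R^m\}$; $\operatorname{cl}$ and $\operatorname{ri}$ denote closure and relative interior in $\mathbb R^n$. Suppose that there is at least one $x\in\mathcal N^\infty$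 with $x(\omega)\in\operatorname{cl}\operatorname{dom}_1f(\omega)$ almost surely, and that for every such $x$ there exists $\bar x\in\mathcal N^\infty$ with $\bar x(\omega)\in\operatorname{ri}\operatorname{dom}_1f(\omega)$ almost surely and $(1-\lambda)x+\lambda\bar x\in\operatorname{dom}_1Ef$ for every $\lambda\in(0,1]$. Then for every $y\in\mathcal Y$, $$\tilde\varphi^*(y)=-\inf_{x\in\mathcal N^\infty}E\underline l(x,y).$$ -/
open MeasureTheory
open scoped ENNReal

namespace StochDual

noncomputable section

/-- Expectation of an extended-real-valued function: it equals `+∞` unless the positive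
part is integrable, in which case it is the usual (possibly `-∞`) integral.
`EReal.toENNReal` is the positive part. -/
def expect {Ω : Type*} [MeasurableSpace Ω] (P : Measure Ω) (φ : Ω → EReal) : EReal :=
  open Classical in
  if ∫⁻ ω, (φ ω).toENNReal ∂P = ⊤ then ⊤
  else ((∫⁻ ω, (φ ω).toENNReal ∂P : ℝ≥0∞) : EReal)
    - ((∫⁻ ω, (-(φ ω)).toENNReal ∂P : ℝ≥0∞) : EReal)

/-- `ℝ^n` viewed as `ℝ^{n_0} × ⋯ × ℝ^{n_T}`. -/
abbrev Vec {T : ℕ} (nt : Fin (T + 1) → ℕ) : Type := (t : Fin (T + 1)) → Fin (nt t) → ℝ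

/-- `x·v = Σ_t x_t·v_t`. -/
def dotN {T : ℕ} {nt : Fin (T + 1) → ℕ} (x v : Vec nt) : ℝ := ∑ t, ∑ i, x t i * v t i

/-- The scalar product on `ℝ^m`. -/
def dotM {m : ℕ} (u y : Fin m → ℝ) : ℝ := ∑ j, u j * y j

section

variable {Ω : Type*} [mΩ : MeasurableSpace Ω] {T : ℕ} {nt : Fin (T + 1) → ℕ} {m : ℕ}

/-- `f` is a convex normal integrand: jointly measurable, and `f(·,·,ω)` is proper,
lower semicontinuous and convex for every `ω`. -/
structure IsConvexNormalIntegrand (f : Vec nt → (Fin m → ℝ) → Ω → EReal) : Prop where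
  measurable : Measurable (fun p : (Vec nt × (Fin m → ℝ)) × Ω => f p.1.1 p.1.2 p.2)
  ne_bot : ∀ ω x u, f x u ω ≠ ⊥
  exists_ne_top : ∀ ω, ∃ x u, f x u ω ≠ ⊤
  lsc : ∀ ω, LowerSemicontinuous (fun p : Vec nt × (Fin m → ℝ) => f p.1 p.2 ω)
  convex : ∀ (ω : Ω) (a b : ℝ) (x₁ x₂ : Vec nt) (u₁ u₂ : Fin m → ℝ),
    0 < a → 0 < b → a + b = 1 →
    f (a • x₁ + b • x₂) (a • u₁ + b • u₂) ω ≤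
      (a : EReal) * f x₁ u₁ ω + (b : EReal) * f x₂ u₂ ω

/-- The space `𝓝` of adapted strategies. -/
def strategies (nt : Fin (T + 1) → ℕ) (ℱ : Filtration (Fin (T + 1)) mΩ) :
    Set (Ω → Vec nt) :=
  {x | ∀ t, Measurable[ℱ t] (fun ω => x ω t)}

/-- The space `𝓝^∞` of essentially bounded adapted strategies. -/
def bddStrategies (nt : Fin (T + 1) → ℕ) (ℱ : Filtration (Fin (T + 1)) mΩ)
    (P : Measure Ω) : Set (Ω → Vec nt) :=
  {x | x ∈ strategies nt ℱ ∧ ∃ M : ℝ, ∀ᵐ ω ∂P, ‖x ω‖ ≤ M}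

/-- `Ef(x,u)`. -/
def intF (P : Measure Ω) (f : Vec nt → (Fin m → ℝ) → Ω → EReal)
    (x : Ω → Vec nt) (u : Ω → Fin m → ℝ) : EReal :=
  expect P (fun ω => f (x ω) (u ω) ω)

/-- The bilinear form `⟨u,y⟩ = E(u·y)`. -/
def pairing (P : Measure Ω) (u y : Ω → Fin m → ℝ) : ℝ := ∫ ω, dotM (u ω) (y ω) ∂P

/-- The auxiliary value function `φ̃(u) = inf_{x∈𝓝^∞} Ef(x,u)`. -/
def valueBdd (P : Measure Ω) (f : Vec nt → (Fin m → ℝ) → Ω → EReal)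
    (ℱ : Filtration (Fin (T + 1)) mΩ) (u : Ω → Fin m → ℝ) : EReal :=
  ⨅ x ∈ bddStrategies nt ℱ P, intF P f x u

/-- The conjugate `g*(y) = sup_{u∈𝓤} {⟨u,y⟩ − g(u)}` of a function `g` on `𝓤`. -/
def conjugate (P : Measure Ω) (𝓤 : Submodule ℝ (Ω → Fin m → ℝ))
    (g : (Ω → Fin m → ℝ) → EReal) (y : Ω → Fin m → ℝ) : EReal :=
  ⨆ u ∈ 𝓤, (((pairing P u y : ℝ) : EReal) - g u)

/-- The pointwise conjugate `f*(v,y,ω) = sup_{x,u} {x·v + u·y − f(x,u,ω)}`. -/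
def fconj (f : Vec nt → (Fin m → ℝ) → Ω → EReal) (v : Vec nt) (y : Fin m → ℝ)
    (ω : Ω) : EReal :=
  ⨆ x : Vec nt, ⨆ u : Fin m → ℝ, (((dotN x v + dotM u y : ℝ) : EReal) - f x u ω)

/-- `l̲(x,y,ω) = sup_v {x·v − f*(v,y,ω)}`. -/
def lagrLow (f : Vec nt → (Fin m → ℝ) → Ω → EReal) (x : Vec nt) (y : Fin m → ℝ)
    (ω : Ω) : EReal :=
  ⨆ v : Vec nt, (((dotN x v : ℝ) : EReal) - fconj f v y ω)

/-- `El̲(x,y)`. -/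
def intLagrLow (P : Measure Ω) (f : Vec nt → (Fin m → ℝ) → Ω → EReal)
    (x : Ω → Vec nt) (y : Ω → Fin m → ℝ) : EReal :=
  expect P (fun ω => lagrLow f (x ω) (y ω) ω)

/-- `dom₁f(ω) = {x ∈ ℝ^n : f(x,u,ω) < +∞ for some u ∈ ℝ^m}`. -/
def dom₁ (f : Vec nt → (Fin m → ℝ) → Ω → EReal) (ω : Ω) : Set (Vec nt) :=
  {x | ∃ u : Fin m → ℝ, f x u ω < ⊤}

/-- `dom₁Ef = {x ∈ 𝓝 : Ef(x,u) < +∞ for some u ∈ 𝓤}`. -/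
def domInt₁ (P : Measure Ω) (f : Vec nt → (Fin m → ℝ) → Ω → EReal)
    (ℱ : Filtration (Fin (T + 1)) mΩ) (𝓤 : Submodule ℝ (Ω → Fin m → ℝ)) :
    Set (Ω → Vec nt) :=
  {x | x ∈ strategies nt ℱ ∧ ∃ u ∈ 𝓤, intF P f x u < ⊤}

/-- `𝓤` consists of measurable functions and is decomposable:
`1_A u + 1_{Ω∖A} u' ∈ 𝓤` for all measurable `A`, `u ∈ 𝓤` and `u' ∈ L^∞`.
(Elements of `L⁰` are represented by measurable functions; decomposability makes `𝓤`
closed under modification on null sets.) -/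
structure IsDecomposable (P : Measure Ω) (𝓤 : Submodule ℝ (Ω → Fin m → ℝ)) : Prop where
  measurable : ∀ u ∈ 𝓤, Measurable u
  glue : ∀ A : Set Ω, MeasurableSet A → ∀ u ∈ 𝓤, ∀ u' : Ω → Fin m → ℝ,
    Measurable u' → (∃ M : ℝ, ∀ᵐ ω ∂P, ‖u' ω‖ ≤ M) →
    A.indicator u + Aᶜ.indicator u' ∈ 𝓤

/-- `u·y` is integrable for all `u ∈ 𝓤`, `y ∈ 𝓨`, and the bilinear form `E(u·y)` separates
the points (almost sure equivalence classes) of both spaces. -/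
structure InSeparatingDuality (P : Measure Ω) (𝓤 𝓨 : Submodule ℝ (Ω → Fin m → ℝ)) :
    Prop where
  integrable : ∀ u ∈ 𝓤, ∀ y ∈ 𝓨, Integrable (fun ω => dotM (u ω) (y ω)) P
  separates_left : ∀ u ∈ 𝓤, (∀ y ∈ 𝓨, pairing P u y = 0) → u =ᵐ[P] 0
  separates_right : ∀ y ∈ 𝓨, (∀ u ∈ 𝓤, pairing P u y = 0) → y =ᵐ[P] 0

end

end

end StochDual

open StochDual

namespace StochDual

open Set Filter Topology

section Analytic

theorem isCompact_box (n : ℕ → ℕ) : IsCompact {σ : ℕ → ℕ | ∀ i, σ i ≤ n i} := by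
  have : {σ : ℕ → ℕ | ∀ i, σ i ≤ n i} = Set.pi univ (fun i => Set.Iic (n i)) := by
    ext σ
    simp only [mem_ofPred_eq, Set.mem_pi, mem_univ, true_imp_iff, mem_Iic]
  rw [this]
  exact isCompact_univ_pi fun i => (Set.finite_Iic _).isCompact

/-- In the Baire space, a neighbourhood of a box `{σ | σ ≤ n}` contains one of the cylinders
that prescribe finitely many of the box constraints. -/
theorem exists_cylinder_subset_of_box_subset {n : ℕ → ℕ} {U : Set (ℕ → ℕ)} (hU : IsOpen U)
    (hn : {σ : ℕ → ℕ | ∀ i, σ i ≤ n i} ⊆ U) :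
    ∃ k, {σ : ℕ → ℕ | ∀ i < k, σ i ≤ n i} ⊆ U := by
  by_contra! hcon
  simp only [not_subset] at hcon
  choose σ hσ hσU using hcon
  obtain ⟨τ, hτ, φ, hφ, hlim⟩ := (isCompact_box n).tendsto_subseq
    (x := fun k i => min (σ k i) (n i)) (fun k i => min_le_right _ _)
  have hlim' : Tendsto (fun k => σ (φ k)) atTop (𝓝 τ) := by
    rw [tendsto_pi_nhds] at hlim ⊢
    intro i
    refine (hlim i).congr' ?_
    filter_upwards [eventually_gt_atTop i] with k hk
    exact min_eq_left (hσ (φ k) i (hk.trans_le (hφ.id_le k)))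
  obtain ⟨k, hk⟩ := (hlim'.eventually (hU.mem_nhds (hn hτ))).exists
  exact hσU _ hk

/-- Inner approximation of continuous images of cylinders of the Baire space by images of
compact boxes. -/
theorem exists_box_measure_image {X : Type*} [TopologicalSpace X] [MeasurableSpace X]
    (μ : Measure X) [μ.OuterRegular] {a : (ℕ → ℕ) → X} (ha : Continuous a)
    {c : ℝ≥0∞} (hc : c < μ (range a)) :
    ∃ n : ℕ → ℕ, c ≤ μ (a '' {σ | ∀ i, σ i ≤ n i}) := by
  have step : ∀ (k : ℕ) (n : ℕ → ℕ), c < μ (a '' {σ | ∀ i < k, σ i ≤ n i}) →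
      ∃ j, c < μ (a '' {σ | ∀ i < k + 1, σ i ≤ Function.update n k j i}) := by
    intro k n h
    have hU : a '' {σ | ∀ i < k, σ i ≤ n i}
        = ⋃ j, a '' {σ | ∀ i < k + 1, σ i ≤ Function.update n k j i} := by
      rw [← image_iUnion]
      congr 1
      ext σ
      simp only [mem_ofPred_eq, mem_iUnion]
      constructor
      · intro hσ
        refine ⟨σ k, fun i hi => ?_⟩
        rcases eq_or_ne i k with rfl | hik
        · simp
        · rw [Function.update_of_ne hik]; exact hσ i (by omega)
      · rintro ⟨j, hj⟩ i hi
        have := hj i (by omega)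
        rwa [Function.update_of_ne (by omega)] at this
    have hmono : Monotone fun j => a '' {σ | ∀ i < k + 1, σ i ≤ Function.update n k j i} := by
      intro j j' hjj
      apply image_mono
      intro σ hσ i hi
      refine (hσ i hi).trans ?_
      rcases eq_or_ne i k with rfl | hik
      · simpa using hjj
      · simp [Function.update_of_ne hik]
    rw [hU, hmono.measure_iUnion] at h
    exact lt_iSup_iff.1 h
  choose! j hj using step
  let N : ℕ → ℕ → ℕ := fun k => Nat.rec (fun _ => 0) (fun k n => Function.update n k (j k n)) k
  have hN : ∀ k, c < μ (a '' {σ | ∀ i < k, σ i ≤ N k i}) := by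
    intro k
    induction k with
    | zero => simpa [image_univ] using hc
    | succ k ih => exact hj k _ ih
  have hstab : ∀ i k, i < k → N k i = N (i + 1) i := by
    intro i k hk
    induction k with
    | zero => omega
    | succ k ih =>
      rcases eq_or_ne i k with rfl | hik
      · rfl
      · rw [← ih (by omega)]
        exact Function.update_of_ne hik _ _
  refine ⟨fun i => N (i + 1) i, ?_⟩
  rw [Set.measure_eq_iInf_isOpen (a '' {σ | ∀ i, σ i ≤ N (i + 1) i}) μ]
  refine le_iInf₂ fun U hUs => le_iInf fun hU => ?_
  obtain ⟨k, hk⟩ := exists_cylinder_subset_of_box_subset (hU.preimage ha) (image_subset_iff.1 hUs)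
  refine (hN k).le.trans (measure_mono (image_subset_iff.2 (Subset.trans ?_ hk)))
  intro σ hσ i hi
  exact (hσ i hi).trans_eq (hstab i k hi)

/-- Analytic sets are universally measurable. -/
theorem nullMeasurableSet_range {X : Type*} [TopologicalSpace X] [T2Space X] [MeasurableSpace X]
    [OpensMeasurableSpace X] (μ : Measure X) [IsFiniteMeasure μ] [μ.OuterRegular]
    {a : (ℕ → ℕ) → X} (ha : Continuous a) : NullMeasurableSet (range a) μ := by
  have h : ∀ c < μ (range a), ∃ K ⊆ range a, MeasurableSet K ∧ c ≤ μ K := by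
    intro c hc
    obtain ⟨n, hn⟩ := exists_box_measure_image μ ha hc
    refine ⟨_, image_subset_range _ _, ?_, hn⟩
    exact ((isCompact_box n).image ha).measurableSet
  rcases eq_or_ne (μ (range a)) 0 with h0 | h0
  · exact NullMeasurableSet.of_null h0
  obtain ⟨c, -, hcl, hct⟩ := exists_seq_strictMono_tendsto' (pos_iff_ne_zero.2 h0)
  choose K hK hKm hKc using fun k => h (c k) (hcl k).2
  have hsub : (⋃ k, K k) ⊆ range a := iUnion_subset hK
  have hle : μ (range a) ≤ μ (⋃ k, K k) :=
    le_of_tendsto' hct fun k => (hKc k).trans (measure_mono (subset_iUnion _ _))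
  have hae : (⋃ k, K k) =ᵐ[μ] range a :=
    ae_eq_of_subset_of_measure_ge hsub hle (MeasurableSet.iUnion hKm).nullMeasurableSet
      (measure_ne_top _ _)
  exact (MeasurableSet.iUnion hKm).nullMeasurableSet.congr hae

end Analytic

section Reduction

variable {Ω : Type*} [mΩ : MeasurableSpace Ω]

/-- A product-measurable set is the preimage of a measurable set under a map that factors the
first variable through the Cantor space. -/
theorem exists_measurable_factor {Y : Type*} [MeasurableSpace Y] {S : Set (Ω × Y)}
    (hS : MeasurableSet S) :
    ∃ (g : Ω → ℕ → Bool) (S' : Set ((ℕ → Bool) × Y)), Measurable g ∧ MeasurableSet S' ∧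
      S = {p | (g p.1, p.2) ∈ S'} := by
  classical
  induction S, hS using MeasurableSpace.induction_on_inter generateFrom_prod.symm isPiSystem_prod
  with
  | empty => exact ⟨fun _ _ => false, ∅, measurable_const, MeasurableSet.empty, by simp⟩
  | basic t ht =>
    obtain ⟨A, hA, B, hB, rfl⟩ := ht
    refine ⟨fun ω _ => decide (ω ∈ A), {q | q.1 0 = true ∧ q.2 ∈ B}, ?_, ?_, ?_⟩
    · refine measurable_pi_lambda _ fun _ => ?_
      exact measurable_to_bool (by simpa [preimage, mem_ofPred_eq] using hA)
    · have h1 : Measurable fun q : (ℕ → Bool) × Y => q.1 0 :=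
        (measurable_pi_apply 0).comp measurable_fst
      exact (h1 (measurableSet_singleton true)).inter (measurable_snd hB)
    · ext ⟨ω, y⟩; simp
  | compl t ht ih =>
    obtain ⟨g, S', hg, hS', rfl⟩ := ih
    exact ⟨g, S'ᶜ, hg, hS'.compl, rfl⟩
  | iUnion s hd hm ih =>
    choose g S' hg hS' hs using ih
    refine ⟨fun ω n => g n.unpair.1 ω n.unpair.2,
      ⋃ i, {q | ((fun j => q.1 (Nat.pair i j)), q.2) ∈ S' i}, ?_, ?_, ?_⟩
    · exact measurable_pi_lambda _ fun n => (measurable_pi_apply _).comp (hg _)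
    · refine MeasurableSet.iUnion fun i => ?_
      have : Measurable fun q : (ℕ → Bool) × Y => ((fun j => q.1 (Nat.pair i j)), q.2) :=
        (measurable_pi_lambda _ fun j => (measurable_pi_apply _).comp measurable_fst).prodMk
          measurable_snd
      exact this (hS' i)
    · ext ⟨ω, y⟩
      simp only [mem_iUnion, mem_ofPred_eq, Nat.unpair_pair]
      refine exists_congr fun i => ?_
      rw [hs i]
      rfl

/-- The leftmost branch of a measurably varying family of closed subsets of the Baire space is
a measurable selection. -/
theorem exists_measurable_branch (F : Ω → Set (ℕ → ℕ)) (hcl : ∀ ω, IsClosed (F ω))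
    (hmeas : ∀ (k : ℕ) (s : ℕ → ℕ), MeasurableSet {ω | ∃ σ ∈ F ω, ∀ i < k, σ i = s i}) :
    ∃ σ : Ω → ℕ → ℕ, Measurable σ ∧ ∀ ω, (F ω).Nonempty → σ ω ∈ F ω := by
  classical
  let good : ℕ → (ℕ → ℕ) → Ω → Prop := fun k s ω => ∃ σ ∈ F ω, ∀ i < k, σ i = s i
  let nxt : ℕ → (ℕ → ℕ) → Ω → ℕ := fun k s ω => sInf {j | good (k + 1) (Function.update s k j) ω}
  let N : ℕ → Ω → ℕ → ℕ := fun k ω =>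
    Nat.rec (fun _ => 0) (fun k s => Function.update s k (nxt k s ω)) k
  have hstab : ∀ ω i k, i < k → N k ω i = N (i + 1) ω i := by
    intro ω i k hk
    induction k with
    | zero => omega
    | succ k ih =>
      rcases eq_or_ne i k with rfl | hik
      · rfl
      · rw [← ih (by omega)]
        exact Function.update_of_ne hik _ _
  have hnxt : ∀ k s, Measurable (nxt k s) := by
    intro k s
    refine measurable_of_Iic fun j => ?_
    have : nxt k s ⁻¹' Iic j = (⋃ i ∈ Iic j, {ω | good (k + 1) (Function.update s k i) ω})
        ∪ ⋂ i, {ω | good (k + 1) (Function.update s k i) ω}ᶜ := by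
      ext ω
      simp only [mem_preimage, mem_Iic, mem_union, mem_iUnion, mem_iInter, mem_compl_iff,
        mem_ofPred_eq, exists_prop]
      constructor
      · intro h
        by_cases hne : {i | good (k + 1) (Function.update s k i) ω}.Nonempty
        · exact Or.inl ⟨_, h, Nat.sInf_mem hne⟩
        · right
          intro i hi
          exact hne ⟨i, hi⟩
      · rintro (⟨i, hij, hi⟩ | h)
        · exact (Nat.sInf_le hi).trans hij
        · have : {i | good (k + 1) (Function.update s k i) ω} = ∅ :=
            eq_empty_iff_forall_notMem.2 h
          simp [nxt, this]
    rw [this]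
    exact (MeasurableSet.biUnion (Set.to_countable _) fun i _ => hmeas _ _).union
      (MeasurableSet.iInter fun i => (hmeas _ _).compl)
  have hNm : ∀ k, Measurable (N k) ∧ (range (N k)).Countable := by
    intro k
    induction k with
    | zero =>
      exact ⟨measurable_const, (countable_singleton (fun _ => 0)).mono (by rintro _ ⟨ω, rfl⟩; rfl)⟩
    | succ k ih =>
      constructor
      · have hset : ∀ B : Set (ℕ → ℕ), N (k + 1) ⁻¹' B = ⋃ s ∈ range (N k),
            (N k ⁻¹' {s}) ∩ {ω | Function.update s k (nxt k s ω) ∈ B} := by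
          intro B
          ext ω
          simp only [mem_preimage, mem_iUnion, mem_inter_iff, mem_singleton_iff, mem_ofPred_eq,
            exists_prop]
          constructor
          · intro h; exact ⟨_, ⟨ω, rfl⟩, rfl, h⟩
          · rintro ⟨s, -, rfl, h⟩; exact h
        intro B hB
        rw [hset B]
        refine MeasurableSet.biUnion ih.2 fun s _ => (ih.1 (measurableSet_singleton s)).inter ?_
        exact ((measurable_update s).comp (hnxt k s)) hB
      · refine (ih.2.image2 (countable_univ (α := ℕ)) (fun s j => Function.update s k j)).mono ?_
        rintro _ ⟨ω, rfl⟩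
        exact ⟨N k ω, ⟨ω, rfl⟩, _, mem_univ _, rfl⟩
  refine ⟨fun ω i => N (i + 1) ω i,
    measurable_pi_lambda _ fun i => (measurable_pi_apply i).comp (hNm (i + 1)).1, ?_⟩
  intro ω hne
  have hgood : ∀ k, good k (N k ω) ω := by
    intro k
    induction k with
    | zero => obtain ⟨σ, hσ⟩ := hne; exact ⟨σ, hσ, by simp⟩
    | succ k ih =>
      obtain ⟨σ, hσ, hσs⟩ := ih
      have : {j | good (k + 1) (Function.update (N k ω) k j) ω}.Nonempty := by
        refine ⟨σ k, σ, hσ, fun i hi => ?_⟩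
        rcases eq_or_ne i k with rfl | hik
        · simp
        · rw [Function.update_of_ne hik]; exact hσs i (by omega)
      exact Nat.sInf_mem this
  choose τ hτ hτN using hgood
  refine (hcl ω).mem_of_tendsto (f := τ) (b := atTop) ?_ (Eventually.of_forall hτ)
  rw [tendsto_pi_nhds]
  intro i
  refine tendsto_const_nhds.congr' ?_
  filter_upwards [eventually_gt_atTop i] with k hk
  rw [hτN k i hk, hstab ω i k hk]

/-- **Measurable selection**: a product-measurable set over a complete probability space has a
measurable section defined on its projection, which is measurable. -/
theorem exists_measurable_selection (P : Measure Ω) [IsFiniteMeasure P] [P.IsComplete]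
    {Y : Type*} [MeasurableSpace Y] [StandardBorelSpace Y] [Nonempty Y] {S : Set (Ω × Y)}
    (hS : MeasurableSet S) :
    MeasurableSet {ω | ∃ y, (ω, y) ∈ S} ∧
      ∃ s : Ω → Y, Measurable s ∧ ∀ ω, (∃ y, (ω, y) ∈ S) → (ω, s ω) ∈ S := by
  obtain ⟨g, S', hg, hS', rfl⟩ := exists_measurable_factor hS
  have _ : TopologicalSpace.IsCompletelyMetrizableSpace (ℕ → Bool) := inferInstance
  have _ : PolishSpace (ℕ → Bool) := inferInstance
  let _ := upgradeStandardBorel Y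
  have han : AnalyticSet S' := hS'.analyticSet
  rw [AnalyticSet] at han
  rcases han with rfl | ⟨ab, hab, hrange⟩
  · refine ⟨by simp, fun _ => Classical.arbitrary Y, measurable_const, by simp⟩
  have ha : Continuous fun σ => (ab σ).1 := continuous_fst.comp hab
  have hb : Continuous fun σ => (ab σ).2 := continuous_snd.comp hab
  have hmeas : ∀ (k : ℕ) (s : ℕ → ℕ),
      MeasurableSet {ω | ∃ σ ∈ {σ | (ab σ).1 = g ω}, ∀ i < k, σ i = s i} := by
    intro k s
    let r : (ℕ → ℕ) → (ℕ → ℕ) := fun σ i => if i < k then s i else σ i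
    have hr : Continuous r := by
      refine continuous_pi fun i => ?_
      by_cases hi : i < k
      · simpa [r, hi] using continuous_const
      · simpa [r, hi] using continuous_apply i
    have heq : {ω | ∃ σ ∈ {σ | (ab σ).1 = g ω}, ∀ i < k, σ i = s i}
        = g ⁻¹' range (fun σ => (ab (r σ)).1) := by
      ext ω
      simp only [mem_ofPred_eq, mem_preimage, mem_range]
      constructor
      · rintro ⟨σ, h, hσ⟩
        have : r σ = σ := by
          funext i
          by_cases hi : i < k <;> simp [r, hi, hσ]
        exact ⟨σ, by rw [this, h]⟩
      · rintro ⟨σ, h⟩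
        exact ⟨r σ, h, fun i hi => by simp [r, hi]⟩
    rw [heq]
    have hnull : NullMeasurableSet (range fun σ => (ab (r σ)).1) (P.map g) :=
      nullMeasurableSet_range _ (ha.comp hr)
    exact (hnull.preimage (hg.quasiMeasurePreserving P)).measurable_of_complete
  have hex : ∀ ω, (∃ y, (g ω, y) ∈ S') ↔ {σ | (ab σ).1 = g ω}.Nonempty := by
    intro ω
    rw [← hrange]
    constructor
    · rintro ⟨y, σ, hσ⟩; exact ⟨σ, by simp [hσ]⟩
    · rintro ⟨σ, hσ⟩
      rw [mem_ofPred_eq] at hσ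
      exact ⟨(ab σ).2, σ, by rw [← hσ]⟩
  obtain ⟨σ, hσm, hσ⟩ := exists_measurable_branch (fun ω => {σ | (ab σ).1 = g ω})
    (fun ω => isClosed_eq ha continuous_const) hmeas
  constructor
  · have := hmeas 0 0
    simp only [not_lt_zero, false_imp_iff, implies_true, and_true] at this
    convert this using 2
    ext ω
    exact hex ω
  · refine ⟨fun ω => (ab (σ ω)).2, hb.measurable.comp hσm, fun ω h => ?_⟩
    have h1 : (ab (σ ω)).1 = g ω := hσ ω ((hex ω).1 h)
    show (g ω, (ab (σ ω)).2) ∈ S'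
    rw [← hrange, ← h1]
    exact ⟨σ ω, rfl⟩

end Reduction

section RelativeInterior

variable {E : Type*} [NormedAddCommGroup E] [NormedSpace ℝ E]

/-- `x` lies in the relative interior of `s`, expressed with balls of the affine span. -/
def IsRelInterior (s : Set E) (x : E) : Prop :=
  x ∈ affineSpan ℝ s ∧ ∃ ε > 0, ∀ z ∈ affineSpan ℝ s, dist z x < ε → z ∈ s

theorem isRelInterior_of_mem_intrinsicInterior {s : Set E} {x : E}
    (hx : x ∈ intrinsicInterior ℝ s) : IsRelInterior s x := by
  obtain ⟨x, hintegr, rfl⟩ := mem_intrinsicInterior.1 hx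
  refine ⟨x.2, ?_⟩
  obtain ⟨ε, hε, h⟩ := Metric.mem_nhds_iff.1 (mem_interior_iff_mem_nhds.1 hintegr)
  exact ⟨ε, hε, fun z hz hd => h (show (⟨z, hz⟩ : affineSpan ℝ s) ∈ Metric.ball x ε from hd)⟩

theorem IsRelInterior.mem {s : Set E} {x : E} (h : IsRelInterior s x) : x ∈ s := by
  obtain ⟨hx, ε, hε, h⟩ := h
  exact h x hx (by simpa using hε)

/-- The half-open segment from a relative interior point to a point of the closure stays in the
relative interior. -/
theorem IsRelInterior.combo_closure [FiniteDimensional ℝ E] {s : Set E} (hs : Convex ℝ s)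
    {x z : E} (hz : IsRelInterior s z) (hx : x ∈ closure s) {lam : ℝ} (h0 : 0 < lam)
    (h1 : lam ≤ 1) : IsRelInterior s ((1 - lam) • x + lam • z) := by
  obtain ⟨hzs, ε, hε, hball⟩ := hz
  have hxs : x ∈ affineSpan ℝ s :=
    closure_minimal (subset_affineSpan ℝ s) (AffineSubspace.closed_of_finiteDimensional _) hx
  have hcomb : ∀ (c : ℝ) (p q : E), p ∈ affineSpan ℝ s → q ∈ affineSpan ℝ s →
      (1 - c) • p + c • q ∈ affineSpan ℝ s := by
    intro c p q hp hq
    have := AffineMap.lineMap_mem c hp hq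
    rwa [AffineMap.lineMap_apply_module] at this
  refine ⟨hcomb lam x z hxs hzs, lam * (ε / 2), by positivity, fun w hw hd => ?_⟩
  obtain ⟨x', hx', hxx'⟩ := Metric.mem_closure_iff.1 hx (lam * (ε / 2)) (by positivity)
  set q : E := (1 - lam⁻¹) • x' + lam⁻¹ • w with hq
  have hqs : q ∈ s := by
    refine hball q (hcomb _ _ _ (subset_affineSpan ℝ s hx') hw) ?_
    have hqz : q - z = lam⁻¹ • ((w - ((1 - lam) • x + lam • z)) + (1 - lam) • (x - x')) := by
      rw [hq]
      match_scalars <;> field_simp <;> ring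
    rw [dist_eq_norm, hqz, norm_smul, norm_inv, Real.norm_of_nonneg h0.le]
    rw [dist_eq_norm] at hd hxx'
    have h2 : ‖(1 - lam) • (x - x')‖ ≤ ‖x - x'‖ := by
      rw [norm_smul, Real.norm_of_nonneg (by linarith)]
      exact mul_le_of_le_one_left (norm_nonneg _) (by linarith)
    have h3 := norm_add_le (w - ((1 - lam) • x + lam • z)) ((1 - lam) • (x - x'))
    rw [inv_mul_lt_iff₀ h0]
    linarith
  have hw' : w = (1 - lam) • x' + lam • q := by
    rw [hq]
    match_scalars
    · field_simp
    · field_simp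
      ring
  rw [hw']
  exact hs hx' hqs (by linarith) h0.le (by ring)

/-- A convex extended-real-valued function has a subgradient at each relative interior point of
its domain where it is finite. -/
theorem exists_subgradient {l : E → EReal}
    (hl : ∀ (a b : ℝ) (x₁ x₂ : E) (c₁ c₂ : ℝ), 0 < a → 0 < b → a + b = 1 →
      l x₁ < c₁ → l x₂ < c₂ → l (a • x₁ + b • x₂) < (a * c₁ + b * c₂ : ℝ))
    {x₀ : E} {r : ℝ} (hx₀ : IsRelInterior {x | l x < ⊤} x₀) (hr : l x₀ = r) :
    ∃ g : E →ₗ[ℝ] ℝ, ∀ x, ((r + g (x - x₀) : ℝ) : EReal) ≤ l x := by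
  obtain ⟨hx₀s, ε, hε, hball⟩ := hx₀
  set A := affineSpan ℝ {x | l x < ⊤}
  obtain ⟨p, hp⟩ := LinearMap.exists_leftInverse_of_injective A.direction.subtype
    (Submodule.ker_subtype _)
  let π : E →ₗ[ℝ] E := A.direction.subtype ∘ₗ p
  have hπmem : ∀ d, π d ∈ A.direction := fun d => (p d).2
  have hπid : ∀ d ∈ A.direction, π d = d := by
    intro d hd
    have := LinearMap.congr_fun hp ⟨d, hd⟩
    exact congrArg Subtype.val this
  let s : PointedCone ℝ (E × ℝ) :=
    { carrier := {q | ∀ δ > 0, ∃ t > 0, l (x₀ + t • π q.1) < (r + t * (q.2 + δ) : ℝ)}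
      zero_mem' := by
        intro δ hδ
        refine ⟨1, one_pos, ?_⟩
        simp only [Prod.fst_zero, map_zero, smul_zero, add_zero, hr, Prod.snd_zero]
        exact EReal.coe_lt_coe_iff.2 (by linarith)
      add_mem' := by
        rintro ⟨d₁, α₁⟩ ⟨d₂, α₂⟩ h₁ h₂ δ hδ
        obtain ⟨t₁, ht₁, h₁⟩ := h₁ (δ / 2) (by positivity)
        obtain ⟨t₂, ht₂, h₂⟩ := h₂ (δ / 2) (by positivity)
        refine ⟨t₁ * t₂ / (t₁ + t₂), by positivity, ?_⟩
        have := hl (t₂ / (t₁ + t₂)) (t₁ / (t₁ + t₂)) _ _ _ _ (by positivity) (by positivity)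
          (by field_simp; ring) h₁ h₂
        convert this using 2
        · simp only [Prod.mk_add_mk, map_add]
          match_scalars <;> field_simp
          ring
        · simp only [Prod.mk_add_mk]
          field_simp
          ring
      smul_mem' := by
        rintro ⟨c, hc⟩ ⟨d, α⟩ h δ hδ
        rcases hc.eq_or_lt with rfl | hc
        · refine ⟨1, one_pos, ?_⟩
          simp only [Nonneg.mk_smul, zero_smul, Prod.fst_zero, map_zero, smul_zero, add_zero, hr,
            Prod.snd_zero]
          exact EReal.coe_lt_coe_iff.2 (by linarith)
        · obtain ⟨t, ht, h⟩ := h (δ / c) (by positivity)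
          refine ⟨t / c, by positivity, ?_⟩
          convert h using 2
          · simp only [Nonneg.mk_smul, Prod.smul_mk, map_smul, smul_smul]
            rw [div_mul_cancel₀ _ hc.ne']
          · simp only [Nonneg.mk_smul, Prod.smul_mk, smul_eq_mul]
            field_simp }
  have hmem : ∀ q : E × ℝ, q ∈ s ↔
      ∀ δ > 0, ∃ t > 0, l (x₀ + t • π q.1) < (r + t * (q.2 + δ) : ℝ) := fun q => Iff.rfl
  obtain ⟨G, hG1, hG2⟩ := riesz_extension s
    ((LinearMap.snd ℝ E ℝ).toPMap (LinearMap.range (LinearMap.inr ℝ E ℝ))) (by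
      rintro ⟨_, α, rfl⟩ h
      rw [hmem] at h
      change 0 ≤ α
      refine le_of_forall_pos_le_add fun δ hδ => ?_
      obtain ⟨t, ht, h⟩ := h δ hδ
      simp only [LinearMap.coe_inr, map_zero, smul_zero, add_zero, hr] at h
      have h := EReal.coe_lt_coe_iff.1 h
      have : 0 < t * (α + δ) := by linarith
      exact (pos_of_mul_pos_right this ht.le).le) (by
      rintro ⟨d, α⟩
      have htend : Tendsto (fun t : ℝ => x₀ + t • π d) (𝓝[>] 0) (𝓝 x₀) := by
        have : Tendsto (fun t : ℝ => x₀ + t • π d) (𝓝 0) (𝓝 (x₀ + (0 : ℝ) • π d)) :=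
          (Continuous.tendsto (by fun_prop) _)
        simp only [zero_smul, add_zero] at this
        exact this.mono_left nhdsWithin_le_nhds
      obtain ⟨t, ht, ht0⟩ := ((htend.eventually (Metric.ball_mem_nhds x₀ hε)).and
        self_mem_nhdsWithin).exists
      have ht0 : 0 < t := ht0
      have hd : x₀ + t • π d ∈ A := by
        have := AffineSubspace.vadd_mem_of_mem_direction
          (A.direction.smul_mem t (hπmem d)) hx₀s
        rwa [vadd_eq_add, add_comm] at this
      have hlt : l (x₀ + t • π d) < ⊤ := hball _ hd ht
      obtain ⟨K, hK, -⟩ := EReal.lt_iff_exists_real_btwn.1 hlt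
      refine ⟨⟨LinearMap.inr ℝ E ℝ ((K - r) / t - α), LinearMap.mem_range_self _ _⟩, ?_⟩
      rw [hmem]
      intro δ hδ
      refine ⟨t, ht0, ?_⟩
      simp only [LinearMap.coe_inr, Prod.mk_add_mk, zero_add]
      refine hK.trans (EReal.coe_lt_coe_iff.2 ?_)
      have : r + t * ((K - r) / t - α + α + δ) = K + t * δ := by field_simp; ring
      rw [this]
      have := mul_pos ht0 hδ
      linarith)
  refine ⟨-(G ∘ₗ LinearMap.inl ℝ E ℝ), fun x => ?_⟩
  rw [← EReal.le_of_forall_lt_iff_le]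
  intro c hc
  have hxA : x ∈ A := subset_affineSpan ℝ _ (show l x < ⊤ from hc.trans (EReal.coe_lt_top c))
  have hxd : π (x - x₀) = x - x₀ := hπid _ (AffineSubspace.vsub_mem_direction hxA hx₀s)
  have hs : (x - x₀, c - r) ∈ s := by
    rw [hmem]
    intro δ hδ
    refine ⟨1, one_pos, ?_⟩
    simp only [hxd, one_smul, add_sub_cancel]
    exact hc.trans (EReal.coe_lt_coe_iff.2 (by linarith))
  have h1 := hG2 _ hs
  have h2 : G (x - x₀, c - r) = G (x - x₀, 0) + (c - r) := by
    have hsnd : G (0, c - r) = c - r :=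
      hG1 ⟨LinearMap.inr ℝ E ℝ (c - r), LinearMap.mem_range_self _ _⟩
    rw [← hsnd, ← map_add, hsnd, Prod.mk_add_mk, add_zero, zero_add]
  rw [h2] at h1
  refine EReal.coe_le_coe_iff.2 ?_
  simp only [LinearMap.neg_apply, LinearMap.comp_apply, LinearMap.inl_apply]
  linarith

end RelativeInterior

section Dot

variable {T : ℕ} {nt : Fin (T + 1) → ℕ} {m : ℕ}

/-- The scalar product on `ℝ^n` as a linear map of its first argument. -/
def dotNLin (v : Vec nt) : Vec nt →ₗ[ℝ] ℝ where
  toFun x := dotN x v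
  map_add' x y := by simp [dotN, add_mul, Finset.sum_add_distrib]
  map_smul' c x := by simp [dotN, Finset.mul_sum, mul_assoc]

theorem dotN_combo (a b : ℝ) (x z v : Vec nt) :
    dotN (a • x + b • z) v = a * dotN x v + b * dotN z v :=
  ((dotNLin v).map_add (a • x) (b • z)).trans
    (congrArg₂ (· + ·) ((dotNLin v).map_smul a x) ((dotNLin v).map_smul b z))

theorem dotN_sub (x z v : Vec nt) : dotN (x - z) v = dotN x v - dotN z v :=
  (dotNLin v).map_sub x z

theorem dotN_combo_right (c : ℝ) (x v w : Vec nt) :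
    dotN x (v + c • w) = dotN x v + c * dotN x w := by
  simp only [dotN, Pi.add_apply, Pi.smul_apply, smul_eq_mul, mul_add, Finset.sum_add_distrib,
    Finset.mul_sum]
  congr 1
  exact Finset.sum_congr rfl fun t _ => Finset.sum_congr rfl fun i _ => by ring

theorem dotM_combo (a b : ℝ) (u w y : Fin m → ℝ) :
    dotM (a • u + b • w) y = a * dotM u y + b * dotM w y := by
  simp only [dotM, Pi.add_apply, Pi.smul_apply, smul_eq_mul, add_mul, Finset.sum_add_distrib,
    Finset.mul_sum, mul_assoc]

theorem exists_eq_dotN (g : Vec nt →ₗ[ℝ] ℝ) : ∃ v : Vec nt, ∀ x, g x = dotN x v := by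
  refine ⟨fun t i => g (Pi.single t (Pi.single i 1)), fun x => ?_⟩
  have hg : g = dotNLin (fun t i => g (Pi.single t (Pi.single i 1))) := by
    refine LinearMap.pi_ext' fun t => LinearMap.pi_ext' fun i => LinearMap.ext_ring ?_
    simp only [LinearMap.comp_apply, LinearMap.coe_single, dotNLin, LinearMap.coe_mk,
      AddHom.coe_mk, dotN]
    rw [Finset.sum_eq_single t, Finset.sum_eq_single i]
    · simp
    · intro j _ hj; simp [Pi.single_eq_of_ne hj]
    · simp
    · intro s _ hs; simp [Pi.single_eq_of_ne hs]
    · simp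
  exact LinearMap.congr_fun hg x

end Dot

section Lagrangian

variable {Ω : Type*} {T : ℕ} {nt : Fin (T + 1) → ℕ} {m : ℕ}
  {f : Vec nt → (Fin m → ℝ) → Ω → EReal}

/-- The Lagrangian `l(x,y,ω) = inf_u {f(x,u,ω) − u·y}`. -/
noncomputable def lagr (f : Vec nt → (Fin m → ℝ) → Ω → EReal) (x : Vec nt) (y : Fin m → ℝ)
    (ω : Ω) : EReal :=
  ⨅ u : Fin m → ℝ, (f x u ω - (dotM u y : ℝ))

theorem sub_coe_lt_coe_iff {a : EReal} {b c : ℝ} :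
    a - (b : EReal) < c ↔ a < ((c + b : ℝ) : EReal) := by
  rw [EReal.sub_lt_iff (Or.inl (EReal.coe_ne_bot _)) (Or.inl (EReal.coe_ne_top _)),
    EReal.coe_add]

theorem coe_le_sub_coe_iff {a : EReal} {b c : ℝ} :
    (c : EReal) ≤ a - b ↔ ((c + b : ℝ) : EReal) ≤ a := by
  rw [← not_lt, sub_coe_lt_coe_iff, not_lt]

theorem coe_sub_le_coe_iff {a : EReal} {b c : ℝ} :
    (b : EReal) - a ≤ c ↔ ((b - c : ℝ) : EReal) ≤ a := by
  induction a with
  | bot => simp [-EReal.coe_sub]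
  | top => simp
  | coe a =>
    rw [← EReal.coe_sub, EReal.coe_le_coe_iff, EReal.coe_le_coe_iff]
    constructor <;> intro h <;> linarith

theorem lagr_lt_coe_iff {x : Vec nt} {y : Fin m → ℝ} {ω : Ω} {c : ℝ} :
    lagr f x y ω < c ↔ ∃ u, f x u ω < ((c + dotM u y : ℝ) : EReal) := by
  simp only [lagr, iInf_lt_iff, sub_coe_lt_coe_iff]

theorem lagr_le_of_le {x : Vec nt} {u y : Fin m → ℝ} {ω : Ω} {c : ℝ}
    (h : f x u ω ≤ ((c + dotM u y : ℝ) : EReal)) : lagr f x y ω ≤ c := by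
  refine (iInf_le _ u).trans ?_
  rw [EReal.sub_le_iff_le_add (Or.inl (EReal.coe_ne_bot _)) (Or.inl (EReal.coe_ne_top _)),
    ← EReal.coe_add]
  exact h

theorem dom₁_eq (f : Vec nt → (Fin m → ℝ) → Ω → EReal) (y : Fin m → ℝ) (ω : Ω) :
    dom₁ f ω = {x | lagr f x y ω < ⊤} := by
  ext x
  constructor
  · rintro ⟨u, hu⟩
    obtain ⟨K, hK, -⟩ := EReal.lt_iff_exists_real_btwn.1 hu
    have : lagr f x y ω < ((K - dotM u y : ℝ) : EReal) :=
      lagr_lt_coe_iff.2 ⟨u, by simpa using hK⟩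
    exact this.trans (EReal.coe_lt_top _)
  · intro h
    obtain ⟨K, hK, -⟩ := EReal.lt_iff_exists_real_btwn.1 h
    obtain ⟨u, hu⟩ := lagr_lt_coe_iff.1 hK
    exact ⟨u, hu.trans (EReal.coe_lt_top _)⟩

/-- `f*(·,y,ω)` is the conjugate of `l(·,y,ω)`. -/
theorem fconj_le_coe_iff {v : Vec nt} {y : Fin m → ℝ} {ω : Ω} {a : ℝ} :
    fconj f v y ω ≤ a ↔ ∀ z, ((dotN z v - a : ℝ) : EReal) ≤ lagr f z y ω := by
  simp only [fconj, lagr, iSup_le_iff, le_iInf_iff, coe_sub_le_coe_iff, coe_le_sub_coe_iff]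
  refine forall_congr' fun z => forall_congr' fun u => ?_
  rw [show dotN z v - a + dotM u y = dotN z v + dotM u y - a by ring]

variable [mΩ : MeasurableSpace Ω]

theorem lagr_convex (hf : IsConvexNormalIntegrand f) (y : Fin m → ℝ) (ω : Ω) (a b : ℝ)
    (x₁ x₂ : Vec nt) (c₁ c₂ : ℝ) (ha : 0 < a) (hb : 0 < b) (hab : a + b = 1)
    (h₁ : lagr f x₁ y ω < c₁) (h₂ : lagr f x₂ y ω < c₂) :
    lagr f (a • x₁ + b • x₂) y ω < (a * c₁ + b * c₂ : ℝ) := by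
  obtain ⟨u₁, h₁⟩ := lagr_lt_coe_iff.1 h₁
  obtain ⟨u₂, h₂⟩ := lagr_lt_coe_iff.1 h₂
  refine lagr_lt_coe_iff.2 ⟨a • u₁ + b • u₂, (hf.convex ω a b x₁ x₂ u₁ u₂ ha hb hab).trans_lt ?_⟩
  have e₁ := EReal.coe_toReal (h₁.trans (EReal.coe_lt_top _)).ne (hf.ne_bot ω x₁ u₁)
  have e₂ := EReal.coe_toReal (h₂.trans (EReal.coe_lt_top _)).ne (hf.ne_bot ω x₂ u₂)
  rw [← e₁, EReal.coe_lt_coe_iff] at h₁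
  rw [← e₂, EReal.coe_lt_coe_iff] at h₂
  rw [← e₁, ← e₂, ← EReal.coe_mul, ← EReal.coe_mul, ← EReal.coe_add, EReal.coe_lt_coe_iff,
    dotM_combo]
  have := mul_lt_mul_of_pos_left h₁ ha
  have := mul_lt_mul_of_pos_left h₂ hb
  linarith

theorem convex_dom₁ (hf : IsConvexNormalIntegrand f) (ω : Ω) : Convex ℝ (dom₁ f ω) := by
  rw [dom₁_eq f 0 ω, convex_iff_forall_pos]
  intro x hx z hz a b ha hb hab
  obtain ⟨c, hc, -⟩ := EReal.lt_iff_exists_real_btwn.1 hx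
  obtain ⟨d, hd, -⟩ := EReal.lt_iff_exists_real_btwn.1 hz
  exact (lagr_convex hf 0 ω a b x z c d ha hb hab hc hd).trans (EReal.coe_lt_top _)

theorem fconj_ne_bot (hf : IsConvexNormalIntegrand f) (v : Vec nt) (y : Fin m → ℝ) (ω : Ω) :
    fconj f v y ω ≠ ⊥ := by
  obtain ⟨x, u, hxu⟩ := hf.exists_ne_top ω
  have h : ((dotN x v + dotM u y : ℝ) : EReal) - f x u ω ≤ fconj f v y ω :=
    le_iSup₂ (f := fun x u => ((dotN x v + dotM u y : ℝ) : EReal) - f x u ω) x u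
  rw [← EReal.coe_toReal hxu (hf.ne_bot ω x u), ← EReal.coe_sub] at h
  exact ((EReal.bot_lt_coe _).trans_le h).ne'

/-- `l̲(·,y,ω)` is the supremum of the affine minorants of `l(·,y,ω)`. -/
theorem lagrLow_le_iff (hf : IsConvexNormalIntegrand f) {x : Vec nt} {y : Fin m → ℝ} {ω : Ω}
    {c : EReal} : lagrLow f x y ω ≤ c ↔ ∀ (v : Vec nt) (a : ℝ), fconj f v y ω ≤ a →
      ((dotN x v - a : ℝ) : EReal) ≤ c := by
  simp only [lagrLow, iSup_le_iff]
  refine forall_congr' fun v => ?_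
  constructor
  · intro h a ha
    refine le_trans ?_ h
    rw [EReal.coe_sub]
    exact EReal.sub_le_sub le_rfl ha
  · intro h
    rcases eq_or_ne (fconj f v y ω) ⊤ with ht | ht
    · simp [ht]
    · have e := EReal.coe_toReal ht (fconj_ne_bot hf v y ω)
      rw [← e, ← EReal.coe_sub]
      exact h _ e.ge

theorem le_lagrLow (hf : IsConvexNormalIntegrand f) (x : Vec nt) {v : Vec nt} {y : Fin m → ℝ}
    {ω : Ω} {a : ℝ} (h : fconj f v y ω ≤ a) :
    ((dotN x v - a : ℝ) : EReal) ≤ lagrLow f x y ω :=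
  (lagrLow_le_iff hf).1 le_rfl v a h

theorem lagrLow_le_lagr (hf : IsConvexNormalIntegrand f) (x : Vec nt) (y : Fin m → ℝ) (ω : Ω) :
    lagrLow f x y ω ≤ lagr f x y ω :=
  (lagrLow_le_iff hf).2 fun _ _ h => fconj_le_coe_iff.1 h x

theorem lagrLow_combo_le (hf : IsConvexNormalIntegrand f) {x z : Vec nt} {y : Fin m → ℝ} {ω : Ω}
    {a b c d : ℝ} (ha : 0 ≤ a) (hb : 0 ≤ b) (hab : a + b = 1) (hx : lagrLow f x y ω ≤ c)
    (hz : lagrLow f z y ω ≤ d) : lagrLow f (a • x + b • z) y ω ≤ (a * c + b * d : ℝ) := by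
  refine (lagrLow_le_iff hf).2 fun v r hr => EReal.coe_le_coe_iff.2 ?_
  have h₁ := EReal.coe_le_coe_iff.1 ((lagrLow_le_iff hf).1 hx v r hr)
  have h₂ := EReal.coe_le_coe_iff.1 ((lagrLow_le_iff hf).1 hz v r hr)
  rw [dotN_combo]
  have h₁ := mul_le_mul_of_nonneg_left h₁ ha
  have h₂ := mul_le_mul_of_nonneg_left h₂ hb
  have : r = a * r + b * r := by rw [← add_mul, hab, one_mul]
  linarith

/-- A finite value of `l(·,y,ω)` at a relative interior point of its domain is attained by an
affine minorant. -/
theorem exists_fconj_le_of_isRelInterior (hf : IsConvexNormalIntegrand f) {x : Vec nt}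
    {y : Fin m → ℝ} {ω : Ω} (hx : IsRelInterior (dom₁ f ω) x) (hbot : lagr f x y ω ≠ ⊥) :
    ∃ (v : Vec nt) (a : ℝ), fconj f v y ω ≤ a ∧ lagr f x y ω = (dotN x v - a : ℝ) := by
  rw [dom₁_eq f y ω] at hx
  have e := EReal.coe_toReal (LT.lt.ne hx.mem) hbot
  obtain ⟨g, hg⟩ := exists_subgradient (l := fun x => lagr f x y ω)
    (lagr_convex hf y ω) hx e.symm
  obtain ⟨v, hv⟩ := exists_eq_dotN g
  refine ⟨v, dotN x v - (lagr f x y ω).toReal, fconj_le_coe_iff.2 fun z => ?_, ?_⟩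
  · convert hg z using 2
    rw [hv, dotN_sub]
    ring
  · rw [sub_sub_cancel, e]

theorem lagrLow_eq_lagr_of_isRelInterior (hf : IsConvexNormalIntegrand f) {x : Vec nt}
    (y : Fin m → ℝ) {ω : Ω} (hx : IsRelInterior (dom₁ f ω) x) :
    lagrLow f x y ω = lagr f x y ω := by
  refine le_antisymm (lagrLow_le_lagr hf x y ω) ?_
  rcases eq_or_ne (lagr f x y ω) ⊥ with h | h
  · simp [h]
  · obtain ⟨v, a, hva, he⟩ := exists_fconj_le_of_isRelInterior hf hx h
    rw [he]
    exact le_lagrLow hf x hva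

theorem lagrLow_eq_top_of_notMem_closure (hf : IsConvexNormalIntegrand f) {x : Vec nt}
    {y : Fin m → ℝ} {ω : Ω} {v : Vec nt} {a : ℝ} (hva : fconj f v y ω ≤ a)
    (hx : x ∉ closure (dom₁ f ω)) : lagrLow f x y ω = ⊤ := by
  obtain ⟨φ, s, hs, hsx⟩ := geometric_hahn_banach_closed_point (convex_dom₁ hf ω).closure
    isClosed_closure hx
  obtain ⟨w, hw⟩ := exists_eq_dotN φ.toLinearMap
  have hw : ∀ z, φ z = dotN z w := hw
  rw [EReal.eq_top_iff_forall_lt]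
  intro K
  obtain ⟨n, hn⟩ := exists_nat_gt ((K - (dotN x v - a)) / (φ x - s))
  rw [div_lt_iff₀ (by linarith)] at hn
  have hmin : fconj f (v + (n : ℝ) • w) y ω ≤ ((a + n * s : ℝ) : EReal) := by
    refine fconj_le_coe_iff.2 fun z => ?_
    by_cases hz : lagr f z y ω < ⊤
    · refine le_trans (EReal.coe_le_coe_iff.2 ?_) (fconj_le_coe_iff.1 hva z)
      have hz' : z ∈ dom₁ f ω := by rw [dom₁_eq f y ω]; exact hz
      have h1 := hs z (subset_closure hz')
      rw [dotN_combo_right, ← hw]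
      have := mul_le_mul_of_nonneg_left h1.le (Nat.cast_nonneg (α := ℝ) n)
      linarith
    · rw [not_lt_top_iff.1 hz]; exact le_top
  refine lt_of_lt_of_le (EReal.coe_lt_coe_iff.2 ?_) (le_lagrLow hf x hmin)
  rw [dotN_combo_right, ← hw]
  linarith

/-- Along segments ending at a point of its domain, `l̲(·,y,ω)` is continuous at the other end. -/
theorem lagrLow_eq_liminf (hf : IsConvexNormalIntegrand f) (x : Vec nt) {z : Vec nt}
    {y : Fin m → ℝ} {ω : Ω} (hz : lagrLow f z y ω < ⊤) {lam : ℕ → ℝ} (h0 : ∀ k, 0 ≤ lam k)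
    (h1 : ∀ k, lam k ≤ 1) (hlam : Tendsto lam atTop (𝓝 0)) :
    lagrLow f x y ω = liminf (fun k => lagrLow f ((1 - lam k) • x + lam k • z) y ω) atTop := by
  apply le_antisymm
  · refine (lagrLow_le_iff hf).2 fun v a hva => ?_
    have ht : Tendsto (fun k => ((dotN ((1 - lam k) • x + lam k • z) v - a : ℝ) : EReal)) atTop
        (𝓝 ((dotN x v - a : ℝ) : EReal)) := by
      refine (continuous_coe_real_ereal.tendsto _).comp (Tendsto.sub_const ?_ a)
      simp only [dotN_combo]
      have := ((hlam.const_sub 1).mul_const (dotN x v)).add (hlam.mul_const (dotN z v))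
      simpa using this
    rw [← ht.liminf_eq]
    exact liminf_le_liminf (Eventually.of_forall fun k => le_lagrLow hf _ hva)
  · rw [← EReal.le_of_forall_lt_iff_le]
    intro c hc
    obtain ⟨d, hd, -⟩ := EReal.lt_iff_exists_real_btwn.1 hz
    have ht : Tendsto (fun k => (((1 - lam k) * c + lam k * d : ℝ) : EReal)) atTop
        (𝓝 (c : EReal)) := by
      refine (continuous_coe_real_ereal.tendsto _).comp ?_
      have := ((hlam.const_sub 1).mul_const c).add (hlam.mul_const d)
      simpa using this
    rw [← ht.liminf_eq]
    refine liminf_le_liminf (Eventually.of_forall fun k => ?_)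
    exact lagrLow_combo_le hf (by linarith [h1 k]) (h0 k) (by ring) hc.le hd.le

end Lagrangian

section Expectation

variable {Ω : Type*} [mΩ : MeasurableSpace Ω] {P : Measure Ω}

theorem expect_mono_ae {φ ψ : Ω → EReal} (h : φ ≤ᵐ[P] ψ) : expect P φ ≤ expect P ψ := by
  have hpos : ∫⁻ ω, (φ ω).toENNReal ∂P ≤ ∫⁻ ω, (ψ ω).toENNReal ∂P :=
    lintegral_mono_ae (h.mono fun ω hω => EReal.toENNReal_le_toENNReal hω)
  have hneg : ∫⁻ ω, (-(ψ ω)).toENNReal ∂P ≤ ∫⁻ ω, (-(φ ω)).toENNReal ∂P :=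
    lintegral_mono_ae (h.mono fun ω hω => EReal.toENNReal_le_toENNReal (EReal.neg_le_neg_iff.2 hω))
  unfold expect
  split_ifs with h₁ h₂
  · exact le_rfl
  · exact absurd (top_le_iff.1 (h₁ ▸ hpos)) h₂
  · exact le_top
  · exact EReal.sub_le_sub (EReal.coe_ennreal_le_coe_ennreal_iff.2 hpos)
      (EReal.coe_ennreal_le_coe_ennreal_iff.2 hneg)

theorem expect_coe {h : Ω → ℝ} (hh : Integrable h P) :
    expect P (fun ω => (h ω : EReal)) = (∫ ω, h ω ∂P : ℝ) := by
  have h₁ : ∫⁻ ω, ENNReal.ofReal (h ω) ∂P ≠ ⊤ := hh.lintegral_lt_top.ne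
  have h₂ : ∫⁻ ω, ENNReal.ofReal (-h ω) ∂P ≠ ⊤ := hh.neg.lintegral_lt_top.ne
  have e : ∀ r : ℝ, (r : EReal).toENNReal = ENNReal.ofReal r :=
    fun r => EReal.toENNReal_of_ne_top (EReal.coe_ne_top r)
  simp only [expect, ← EReal.coe_neg, e, h₁, if_false]
  rw [integral_eq_lintegral_pos_part_sub_lintegral_neg_part hh, EReal.coe_sub,
    EReal.coe_ennreal_toReal h₁, EReal.coe_ennreal_toReal h₂]

theorem expect_le_integral {φ : Ω → EReal} {h : Ω → ℝ} (hh : Integrable h P)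
    (hle : ∀ᵐ ω ∂P, φ ω ≤ h ω) : expect P φ ≤ (∫ ω, h ω ∂P : ℝ) :=
  (expect_mono_ae hle).trans_eq (expect_coe hh)

/-- A measurable function with expectation below `c` has an integrable real majorant with
integral below `c`. -/
theorem exists_integrable_majorant [IsFiniteMeasure P] {φ : Ω → EReal} (hφ : AEMeasurable φ P)
    {c : ℝ} (hc : expect P φ < c) :
    ∃ h : Ω → ℝ, Integrable h P ∧ (∀ᵐ ω ∂P, φ ω ≤ h ω) ∧ ∫ ω, h ω ∂P < c := by
  unfold expect at hc
  split_ifs at hc with htop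
  · exact absurd hc (by simp)
  have hpm : AEMeasurable (fun ω => (φ ω).toENNReal) P := hφ.ereal_toENNReal
  have hnm : AEMeasurable (fun ω => (-(φ ω)).toENNReal) P :=
    (continuous_neg.measurable.comp_aemeasurable hφ).ereal_toENNReal
  have hpi : Integrable (fun ω => ((φ ω).toENNReal).toReal) P :=
    integrable_toReal_of_lintegral_ne_top hpm htop
  have hbd : ∀ k : ℕ, ∫⁻ ω, min (-(φ ω)).toENNReal (k : ℝ≥0∞) ∂P ≠ ⊤ := by
    intro k
    refine ne_top_of_le_ne_top ?_ (lintegral_mono fun ω => min_le_right _ _)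
    rw [lintegral_const]
    exact ENNReal.mul_ne_top (ENNReal.natCast_ne_top k) (measure_ne_top _ _)
  have hmm : ∀ k : ℕ, AEMeasurable (fun ω => min (-(φ ω)).toENNReal (k : ℝ≥0∞)) P :=
    fun k => hnm.min aemeasurable_const
  have hsup : ∫⁻ ω, (-(φ ω)).toENNReal ∂P
      = ⨆ k : ℕ, ∫⁻ ω, min (-(φ ω)).toENNReal (k : ℝ≥0∞) ∂P := by
    rw [← lintegral_iSup' hmm (Eventually.of_forall fun ω i j hij =>
      min_le_min_left _ (by exact_mod_cast hij))]
    refine lintegral_congr fun ω => ?_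
    rw [← inf_iSup_eq, ENNReal.iSup_natCast, inf_top_eq]
  obtain ⟨k, hk⟩ : ∃ k : ℕ, ((∫⁻ ω, (φ ω).toENNReal ∂P).toReal
      - (∫⁻ ω, min (-(φ ω)).toENNReal (k : ℝ≥0∞) ∂P).toReal) < c := by
    by_contra! hcon
    have hN : ∫⁻ ω, (-(φ ω)).toENNReal ∂P
        ≤ ENNReal.ofReal ((∫⁻ ω, (φ ω).toENNReal ∂P).toReal - c) := by
      rw [hsup]
      refine iSup_le fun k => ?_
      rw [← ENNReal.ofReal_toReal (hbd k)]
      exact ENNReal.ofReal_le_ofReal (by linarith [hcon k])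
    have hNt := ne_top_of_le_ne_top ENNReal.ofReal_ne_top hN
    rw [← EReal.coe_ennreal_toReal htop, ← EReal.coe_ennreal_toReal hNt,
      ← EReal.coe_sub, EReal.coe_lt_coe_iff] at hc
    have h0 := hcon 0
    simp only [Nat.cast_zero, min_zero, lintegral_zero, ENNReal.toReal_zero, sub_zero] at h0
    have := ENNReal.toReal_mono ENNReal.ofReal_ne_top hN
    rw [ENNReal.toReal_ofReal (by linarith)] at this
    linarith
  refine ⟨fun ω => ((φ ω).toENNReal).toReal - (min (-(φ ω)).toENNReal (k : ℝ≥0∞)).toReal,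
    hpi.sub (integrable_toReal_of_lintegral_ne_top (hmm k) (hbd k)), ?_, ?_⟩
  · filter_upwards [ae_lt_top' hpm htop] with ω hω
    have hlt : φ ω ≠ ⊤ := by rintro h; simp [h] at hω
    induction hφω : φ ω with
    | top => exact absurd hφω hlt
    | bot => exact bot_le
    | coe r =>
      have e : ∀ r : ℝ, (r : EReal).toENNReal = ENNReal.ofReal r :=
        fun r => EReal.toENNReal_of_ne_top (EReal.coe_ne_top r)
      rw [← EReal.coe_neg, e, e, EReal.coe_le_coe_iff]
      have h1 : (min (ENNReal.ofReal (-r)) (k : ℝ≥0∞)).toReal ≤ (ENNReal.ofReal (-r)).toReal :=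
        ENNReal.toReal_mono ENNReal.ofReal_ne_top (min_le_left _ _)
      rw [ENNReal.toReal_ofReal'] at h1 ⊢
      rcases le_total 0 r with hr | hr
      · rw [max_eq_right (by linarith : -r ≤ 0)] at h1
        rw [max_eq_left hr]; linarith
      · rw [max_eq_left (by linarith : 0 ≤ -r)] at h1
        rw [max_eq_right hr]; linarith
  · rw [integral_sub hpi (integrable_toReal_of_lintegral_ne_top (hmm k) (hbd k)),
      integral_toReal hpm (ae_lt_top' hpm htop),
      integral_toReal (hmm k) (ae_lt_top' (hmm k) (hbd k))]
    exact hk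

end Expectation

section Measurability

variable {Ω : Type*} [mΩ : MeasurableSpace Ω] {T : ℕ} {nt : Fin (T + 1) → ℕ} {m : ℕ}
  {f : Vec nt → (Fin m → ℝ) → Ω → EReal}

theorem measurable_dotM {α : Type*} [MeasurableSpace α] {u y : α → Fin m → ℝ} (hu : Measurable u)
    (hy : Measurable y) : Measurable fun a => dotM (u a) (y a) := by
  unfold dotM
  exact Finset.measurable_sum _ fun j _ =>
    ((measurable_pi_apply j).comp hu).mul ((measurable_pi_apply j).comp hy)

theorem IsConvexNormalIntegrand.measurable_comp (hf : IsConvexNormalIntegrand f) {α : Type*}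
    [MeasurableSpace α] {x : α → Vec nt} {u : α → Fin m → ℝ} {w : α → Ω} (hx : Measurable x)
    (hu : Measurable u) (hw : Measurable w) : Measurable fun a => f (x a) (u a) (w a) :=
  hf.measurable.comp ((hx.prodMk hu).prodMk hw)

/-- The graph of the strict sublevel sets of `f(x(ω),·,ω) − ⟨·,y(ω)⟩` is measurable. -/
theorem measurableSet_sublevel (hf : IsConvexNormalIntegrand f) {x : Ω → Vec nt}
    (hx : Measurable x) {y : Ω → Fin m → ℝ} (hy : Measurable y) {h : Ω → ℝ} (hh : Measurable h) :
    MeasurableSet {p : Ω × (Fin m → ℝ) |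
      f (x p.1) p.2 p.1 < ((h p.1 + dotM p.2 (y p.1) : ℝ) : EReal)} := by
  refine measurableSet_lt (hf.measurable_comp (hx.comp measurable_fst) measurable_snd
    measurable_fst) (measurable_coe_real_ereal.comp ?_)
  exact (hh.comp measurable_fst).add (measurable_dotM measurable_snd (hy.comp measurable_fst))

theorem measurable_lagr (P : Measure Ω) [IsFiniteMeasure P] [P.IsComplete]
    (hf : IsConvexNormalIntegrand f) {x : Ω → Vec nt} (hx : Measurable x) {y : Ω → Fin m → ℝ}
    (hy : Measurable y) : Measurable fun ω => lagr f (x ω) (y ω) ω := by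
  have hcoe : ∀ c : ℝ, MeasurableSet {ω | lagr f (x ω) (y ω) ω < c} := by
    intro c
    simp only [lagr_lt_coe_iff]
    exact (exists_measurable_selection P
      (measurableSet_sublevel hf hx hy (measurable_const (a := c)))).1
  refine measurable_of_Iio fun c => ?_
  have : (fun ω => lagr f (x ω) (y ω) ω) ⁻¹' Iio c
      = ⋃ q : ℚ, {ω | lagr f (x ω) (y ω) ω < ((q : ℝ) : EReal) ∧ ((q : ℝ) : EReal) < c} := by
    ext ω
    simp only [mem_preimage, mem_Iio, mem_iUnion, mem_ofPred_eq]
    exact EReal.lt_iff_exists_rat_btwn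
  rw [this]
  exact MeasurableSet.iUnion fun q => (hcoe q).inter (MeasurableSet.const _)

theorem measurableSet_mem_closure_dom₁ (P : Measure Ω) [IsFiniteMeasure P] [P.IsComplete]
    (hf : IsConvexNormalIntegrand f) {x : Ω → Vec nt} (hx : Measurable x) :
    MeasurableSet {ω | x ω ∈ closure (dom₁ f ω)} := by
  have : {ω | x ω ∈ closure (dom₁ f ω)} = ⋂ k : ℕ, {ω | ∃ q : Vec nt × (Fin m → ℝ),
      (ω, q) ∈ {p : Ω × (Vec nt × (Fin m → ℝ)) |
        dist (x p.1) p.2.1 < 1 / ((k : ℝ) + 1) ∧ f p.2.1 p.2.2 p.1 < ⊤}} := by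
    ext ω
    simp only [mem_ofPred_eq, mem_iInter, Metric.mem_closure_iff]
    constructor
    · intro h k
      obtain ⟨z, ⟨u, hu⟩, hz⟩ := h (1 / ((k : ℝ) + 1)) (by positivity)
      exact ⟨(z, u), hz, hu⟩
    · intro h ε hε
      obtain ⟨k, hk⟩ := exists_nat_one_div_lt hε
      obtain ⟨q, hq, hqf⟩ := h k
      exact ⟨q.1, ⟨q.2, hqf⟩, hq.trans hk⟩
  rw [this]
  refine MeasurableSet.iInter fun k => (exists_measurable_selection P ?_).1
  have hdist : Measurable fun p : Ω × (Vec nt × (Fin m → ℝ)) => dist (x p.1) p.2.1 :=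
    (hx.comp measurable_fst).dist (measurable_fst.comp measurable_snd)
  have hfm : Measurable fun p : Ω × (Vec nt × (Fin m → ℝ)) => f p.2.1 p.2.2 p.1 :=
    hf.measurable_comp (measurable_fst.comp measurable_snd) (measurable_snd.comp measurable_snd)
      measurable_fst
  exact (measurableSet_lt hdist measurable_const).inter (measurableSet_lt hfm measurable_const)

/-- Measurability of `l̲(x(ω),y(ω),ω)`, given a relative interior selection of the domains along
which the Lagrangian is finite. -/
theorem aemeasurable_lagrLow (P : Measure Ω) [IsFiniteMeasure P] [P.IsComplete]
    (hf : IsConvexNormalIntegrand f) {x z : Ω → Vec nt} (hx : Measurable x) (hz : Measurable z)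
    {y : Ω → Fin m → ℝ} (hy : Measurable y) (hri : ∀ᵐ ω ∂P, IsRelInterior (dom₁ f ω) (z ω))
    (hbot : ∀ᵐ ω ∂P, lagr f (z ω) (y ω) ω ≠ ⊥) :
    AEMeasurable (fun ω => lagrLow f (x ω) (y ω) ω) P := by
  classical
  have hlim : Measurable fun ω => liminf (fun k : ℕ =>
      lagr f ((1 - 1 / ((k : ℝ) + 1)) • x ω + (1 / ((k : ℝ) + 1)) • z ω) (y ω) ω) atTop := by
    have hk : ∀ a b : ℝ, Measurable fun ω => a • x ω + b • z ω :=
      fun a b => (hx.const_smul a).add (hz.const_smul b)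
    exact Measurable.liminf fun k => measurable_lagr P hf (hk _ _) hy
  obtain ⟨D, hDm, hDiff⟩ : ∃ D : Set Ω, MeasurableSet D ∧
      ∀ ω, ω ∈ D ↔ x ω ∈ closure (dom₁ f ω) :=
    ⟨_, measurableSet_mem_closure_dom₁ P hf hx, fun _ => Iff.rfl⟩
  refine ⟨D.piecewise _ (fun _ => ⊤), Measurable.piecewise hDm hlim measurable_const, ?_⟩
  filter_upwards [hri, hbot] with ω hω hb
  by_cases hD : x ω ∈ closure (dom₁ f ω)
  · rw [piecewise_eq_of_mem _ _ _ ((hDiff ω).2 hD)]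
    have hzt : lagrLow f (z ω) (y ω) ω < ⊤ := by
      have := hω.mem
      rw [dom₁_eq f (y ω) ω] at this
      exact (lagrLow_le_lagr hf _ _ _).trans_lt this
    have h1 : ∀ k : ℕ, 1 / ((k : ℝ) + 1) ≤ 1 := by
      intro k
      rw [div_le_one (by positivity)]
      linarith [Nat.cast_nonneg (α := ℝ) k]
    rw [lagrLow_eq_liminf hf (x ω) hzt (fun k => by positivity) h1
      tendsto_one_div_add_atTop_nhds_zero_nat]
    congr 1
    funext k
    exact lagrLow_eq_lagr_of_isRelInterior hf _
      (hω.combo_closure (convex_dom₁ hf ω) hD (by positivity) (h1 k))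
  · rw [piecewise_eq_of_notMem _ _ _ (mt (hDiff ω).1 hD)]
    obtain ⟨v, a, hva, -⟩ := exists_fconj_le_of_isRelInterior hf hω hb
    exact lagrLow_eq_top_of_notMem_closure hf hva hD

end Measurability

section Interchange

variable {Ω : Type*} [mΩ : MeasurableSpace Ω] {P : Measure Ω} {T : ℕ} {nt : Fin (T + 1) → ℕ}
  {m : ℕ} {f : Vec nt → (Fin m → ℝ) → Ω → EReal}

theorem exists_majorant_of_intF_lt [IsFiniteMeasure P] (hf : IsConvexNormalIntegrand f)
    {x : Ω → Vec nt} (hx : Measurable x) {u y : Ω → Fin m → ℝ} (hu : Measurable u)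
    (huy : Integrable (fun ω => dotM (u ω) (y ω)) P) {c : ℝ} (hc : intF P f x u < c) :
    ∃ g : Ω → ℝ, Integrable g P ∧
      (∀ᵐ ω ∂P, f (x ω) (u ω) ω ≤ ((g ω + dotM (u ω) (y ω) : ℝ) : EReal)) ∧
      ∫ ω, g ω ∂P < c - pairing P u y := by
  obtain ⟨h, hh, hle, hlt⟩ := exists_integrable_majorant
    (hf.measurable_comp hx hu measurable_id).aemeasurable hc
  refine ⟨fun ω => h ω - dotM (u ω) (y ω), hh.sub huy, ?_, ?_⟩
  · simpa using hle
  · rw [integral_sub hh huy, pairing]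
    linarith

/-- **Interchange of minimization and integration** over a decomposable space. -/
theorem exists_intF_le_of_lagr_le [IsFiniteMeasure P] [P.IsComplete]
    (hf : IsConvexNormalIntegrand f) {𝓤 : Submodule ℝ (Ω → Fin m → ℝ)}
    (h𝓤 : IsDecomposable P 𝓤) {x : Ω → Vec nt} (hx : Measurable x) {y : Ω → Fin m → ℝ}
    (hy : Measurable y) (hintegr : ∀ u ∈ 𝓤, Integrable (fun ω => dotM (u ω) (y ω)) P)
    {u₁ : Ω → Fin m → ℝ} (hu₁ : u₁ ∈ 𝓤) (hfin : intF P f x u₁ < ⊤) {h : Ω → ℝ}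
    (hh : Integrable h P) (hle : ∀ᵐ ω ∂P, lagr f (x ω) (y ω) ω ≤ h ω) {c : ℝ}
    (hc : ∫ ω, h ω ∂P < c) :
    ∃ u ∈ 𝓤, intF P f x u ≤ ((c + pairing P u y : ℝ) : EReal) := by
  classical
  obtain ⟨K, hK, -⟩ := EReal.lt_iff_exists_real_btwn.1 hfin
  obtain ⟨g, hg, hgle, -⟩ := exists_majorant_of_intF_lt hf hx (h𝓤.measurable u₁ hu₁)
    (hintegr u₁ hu₁) hK
  obtain ⟨ε, hε, hεc⟩ : ∃ ε > 0, ∫ ω, (h ω + ε) ∂P < c := by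
    have ht : Tendsto (fun ε : ℝ => ∫ ω, (h ω + ε) ∂P) (𝓝[>] 0) (𝓝 (∫ ω, h ω ∂P)) := by
      simp only [integral_add hh (integrable_const _), integral_const]
      have : Continuous fun ε : ℝ => ∫ ω, h ω ∂P + P.real univ • ε := by fun_prop
      have := this.tendsto 0
      simp only [smul_zero, add_zero] at this
      exact this.mono_left nhdsWithin_le_nhds
    obtain ⟨ε, h1, h2⟩ := ((ht.eventually (gt_mem_nhds hc)).and self_mem_nhdsWithin).exists
    exact ⟨ε, h2, h1⟩
  have hhε : Integrable (fun ω => h ω + ε) P := hh.add (integrable_const ε)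
  set k := hhε.aestronglyMeasurable.mk _
  have hkm : Measurable k := hhε.aestronglyMeasurable.stronglyMeasurable_mk.measurable
  have hke : ∀ᵐ ω ∂P, h ω + ε = k ω := hhε.aestronglyMeasurable.ae_eq_mk
  have hki : Integrable k P := hhε.congr hke
  obtain ⟨-, s, hs, hsel⟩ := exists_measurable_selection P (measurableSet_sublevel hf hx hy hkm)
  have hs' : ∀ᵐ ω ∂P, f (x ω) (s ω) ω ≤ ((k ω + dotM (s ω) (y ω) : ℝ) : EReal) := by
    filter_upwards [hle, hke] with ω h1 h2
    have hlt : lagr f (x ω) (y ω) ω < (k ω : EReal) :=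
      h1.trans_lt (EReal.coe_lt_coe_iff.2 (by linarith))
    have hlt : f (x ω) (s ω) ω < ((k ω + dotM (s ω) (y ω) : ℝ) : EReal) :=
      hsel ω (lagr_lt_coe_iff.1 hlt)
    exact hlt.le
  let A : ℕ → Set Ω := fun j => {ω | ‖s ω‖ ≤ j}
  have hA : ∀ j, MeasurableSet (A j) := fun j => measurableSet_le hs.norm measurable_const
  have hlim : Tendsto (fun j => ∫ ω, (A j).piecewise k g ω ∂P) atTop (𝓝 (∫ ω, k ω ∂P)) := by
    refine tendsto_integral_of_dominated_convergence (fun ω => ‖k ω‖ + ‖g ω‖)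
      (fun j => (Integrable.piecewise (hA j) hki.integrableOn hg.integrableOn).aestronglyMeasurable)
      (hki.norm.add hg.norm) (fun j => Eventually.of_forall fun ω => ?_)
      (Eventually.of_forall fun ω => ?_)
    · by_cases hω : ω ∈ A j
      · rw [piecewise_eq_of_mem _ _ _ hω]
        exact le_add_of_nonneg_right (norm_nonneg _)
      · rw [piecewise_eq_of_notMem _ _ _ hω]
        exact le_add_of_nonneg_left (norm_nonneg _)
    · refine tendsto_const_nhds.congr' ?_
      obtain ⟨N, hN⟩ := exists_nat_ge ‖s ω‖
      filter_upwards [eventually_ge_atTop N] with j hj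
      rw [piecewise_eq_of_mem]
      exact hN.trans (Nat.cast_le.2 hj)
  rw [integral_congr_ae hke] at hεc
  obtain ⟨j, hj⟩ := (hlim.eventually (gt_mem_nhds hεc)).exists
  have hmem := h𝓤.glue (A j)ᶜ (hA j).compl u₁ hu₁ ((A j).indicator s) (hs.indicator (hA j))
    ⟨j, Eventually.of_forall fun ω => by
      by_cases hω : ω ∈ A j
      · rw [indicator_of_mem hω]; exact hω
      · rw [indicator_of_notMem hω, norm_zero]; positivity⟩
  set u := (A j)ᶜ.indicator u₁ + (A j)ᶜᶜ.indicator ((A j).indicator s) with hu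
  have hu_in : ∀ ω ∈ A j, u ω = s ω := by
    intro ω hω
    simp [hu, hω]
  have hu_out : ∀ ω ∉ A j, u ω = u₁ ω := by
    intro ω hω
    simp [hu, hω]
  refine ⟨u, hmem, ?_⟩
  have hpi : Integrable ((A j).piecewise k g) P :=
    Integrable.piecewise (hA j) hki.integrableOn hg.integrableOn
  have hb : intF P f x u ≤ ((∫ ω, ((A j).piecewise k g ω + dotM (u ω) (y ω)) ∂P : ℝ) : EReal) := by
    refine expect_le_integral (hpi.add (hintegr u hmem)) ?_
    filter_upwards [hs', hgle] with ω h1 h2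
    by_cases hω : ω ∈ A j
    · rw [piecewise_eq_of_mem _ _ _ hω, hu_in ω hω]; exact h1
    · rw [piecewise_eq_of_notMem _ _ _ hω, hu_out ω hω]; exact h2
  refine hb.trans (EReal.coe_le_coe_iff.2 ?_)
  rw [integral_add hpi (hintegr u hmem), pairing]
  linarith

end Interchange

section Duality

variable {Ω : Type*} [mΩ : MeasurableSpace Ω] {P : Measure Ω} {T : ℕ} {nt : Fin (T + 1) → ℕ}
  {m : ℕ} {f : Vec nt → (Fin m → ℝ) → Ω → EReal} {ℱ : Filtration (Fin (T + 1)) mΩ}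

theorem measurable_of_mem_strategies {x : Ω → Vec nt} (hx : x ∈ strategies nt ℱ) :
    Measurable x :=
  measurable_pi_lambda _ fun t => (hx t).mono (ℱ.le t) le_rfl

theorem coe_sub_le_neg {p : ℝ} {V I : EReal} (h : ∀ c : ℝ, V < c → I ≤ ((c - p : ℝ) : EReal)) :
    (p : EReal) - V ≤ -I := by
  induction V with
  | bot =>
    have : I = ⊥ := by
      rw [EReal.eq_bot_iff_forall_lt]
      intro K
      refine (h (K - 1 + p) (EReal.bot_lt_coe _)).trans_lt (EReal.coe_lt_coe_iff.2 (by linarith))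
    simp [this]
  | top => simp
  | coe V =>
    have hI : I ≤ ((V - p : ℝ) : EReal) := by
      rw [← EReal.le_of_forall_lt_iff_le]
      intro z hz
      have hz := EReal.coe_lt_coe_iff.1 hz
      simpa using h (z + p) (EReal.coe_lt_coe_iff.2 (by linarith))
    rw [← EReal.coe_sub, show p - V = -(V - p) by ring, EReal.coe_neg]
    exact EReal.neg_le_neg_iff.2 hI

/-- Weak duality. -/
theorem conjugate_valueBdd_le [IsFiniteMeasure P] (hf : IsConvexNormalIntegrand f)
    {𝓤 : Submodule ℝ (Ω → Fin m → ℝ)} (hmeas : ∀ u ∈ 𝓤, Measurable u) {y : Ω → Fin m → ℝ}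
    (hintegr : ∀ u ∈ 𝓤, Integrable (fun ω => dotM (u ω) (y ω)) P) :
    conjugate P 𝓤 (valueBdd P f ℱ) y ≤ - ⨅ x ∈ bddStrategies nt ℱ P, intLagrLow P f x y := by
  refine iSup₂_le fun u hu => coe_sub_le_neg fun c hc => ?_
  simp only [valueBdd, iInf_lt_iff] at hc
  obtain ⟨x, hx, hc⟩ := hc
  obtain ⟨g, hg, hgle, hgc⟩ := exists_majorant_of_intF_lt hf (measurable_of_mem_strategies hx.1)
    (hmeas u hu) (hintegr u hu) hc
  refine (iInf₂_le x hx).trans ((expect_le_integral hg ?_).trans (EReal.coe_le_coe_iff.2 hgc.le))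
  filter_upwards [hgle] with ω hω
  exact (lagrLow_le_lagr hf _ _ _).trans (lagr_le_of_le hω)

theorem combo_mem_bddStrategies {x z : Ω → Vec nt} (hx : x ∈ bddStrategies nt ℱ P)
    (hz : z ∈ bddStrategies nt ℱ P) {a b : ℝ} (hab : a • x + b • z ∈ strategies nt ℱ) :
    a • x + b • z ∈ bddStrategies nt ℱ P := by
  obtain ⟨-, M, hM⟩ := hx
  obtain ⟨-, N, hN⟩ := hz
  refine ⟨hab, |a| * M + |b| * N, ?_⟩
  filter_upwards [hM, hN] with ω h1 h2
  refine (norm_add_le _ _).trans ?_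
  simp only [Pi.smul_apply, norm_smul, Real.norm_eq_abs]
  gcongr

/-- If the Lagrangian takes the value `-∞` on a set of positive measure along a strategy of finite
cost, the primal objective is unbounded from below. -/
theorem exists_intF_le_of_lagr_eq_bot [IsFiniteMeasure P] [P.IsComplete]
    (hf : IsConvexNormalIntegrand f) {𝓤 : Submodule ℝ (Ω → Fin m → ℝ)}
    (h𝓤 : IsDecomposable P 𝓤) {x : Ω → Vec nt} (hx : Measurable x) {y : Ω → Fin m → ℝ}
    (hy : Measurable y) (hintegr : ∀ u ∈ 𝓤, Integrable (fun ω => dotM (u ω) (y ω)) P)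
    {u₁ : Ω → Fin m → ℝ} (hu₁ : u₁ ∈ 𝓤) (hfin : intF P f x u₁ < ⊤)
    (hbot : ¬ ∀ᵐ ω ∂P, lagr f (x ω) (y ω) ω ≠ ⊥) (c : ℝ) :
    ∃ u ∈ 𝓤, intF P f x u ≤ ((c + pairing P u y : ℝ) : EReal) := by
  obtain ⟨K, hK, -⟩ := EReal.lt_iff_exists_real_btwn.1 hfin
  obtain ⟨g, hg, hgle, -⟩ := exists_majorant_of_intF_lt hf hx (h𝓤.measurable u₁ hu₁)
    (hintegr u₁ hu₁) hK
  set B := {ω | lagr f (x ω) (y ω) ω = ⊥}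
  have hB : MeasurableSet B := measurable_lagr P hf hx hy (measurableSet_singleton ⊥)
  have hPB : 0 < P.real B := by
    rw [measureReal_def, ENNReal.toReal_pos_iff]
    refine ⟨pos_iff_ne_zero.2 fun h0 => hbot ?_, measure_lt_top _ _⟩
    rw [ae_iff]
    simpa using h0
  obtain ⟨n, hn⟩ := exists_nat_gt ((∫ ω, g ω ∂P - c) / P.real B)
  rw [div_lt_iff₀ hPB] at hn
  have hBi : Integrable (B.indicator fun _ => (n : ℝ)) P := (integrable_const _).indicator hB
  refine exists_intF_le_of_lagr_le hf h𝓤 hx hy hintegr hu₁ hfin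
    (h := fun ω => g ω - B.indicator (fun _ => (n : ℝ)) ω) (hg.sub hBi) ?_ ?_
  · filter_upwards [hgle] with ω hω
    by_cases hωB : ω ∈ B
    · rw [show lagr f (x ω) (y ω) ω = ⊥ from hωB]; exact bot_le
    · rw [indicator_of_notMem hωB, sub_zero]; exact lagr_le_of_le hω
  · rw [integral_sub hg hBi, integral_indicator_const _ hB, smul_eq_mul]
    linarith

end Duality

end StochDual

/-- Under the relative-interior condition on the domains,
`φ̃*(y) = −inf_{x∈𝓝^∞} El̲(x,y)` for every `y ∈ 𝓨`. -/
theorem stmt_2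
    {Ω : Type*} [mΩ : MeasurableSpace Ω] (P : Measure Ω) [IsProbabilityMeasure P]
    [P.IsComplete]
    {T : ℕ} (ℱ : Filtration (Fin (T + 1)) mΩ)
    (hℱ_complete : ∀ t, (P.trim (ℱ.le t)).IsComplete)
    (nt : Fin (T + 1) → ℕ) {m : ℕ}
    (f : Vec nt → (Fin m → ℝ) → Ω → EReal) (hf : IsConvexNormalIntegrand f)
    (𝓤 𝓨 : Submodule ℝ (Ω → Fin m → ℝ))
    (h𝓤 : IsDecomposable P 𝓤) (h𝓨 : IsDecomposable P 𝓨)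
    (hdual : InSeparatingDuality P 𝓤 𝓨)
    -- some bounded strategy satisfies the constraint `x ∈ cl dom₁f` almost surely
    (hfeas : ∃ x ∈ bddStrategies nt ℱ P, ∀ᵐ ω ∂P, x ω ∈ closure (dom₁ f ω))
    (hdom : ∀ x ∈ bddStrategies nt ℱ P, (∀ᵐ ω ∂P, x ω ∈ closure (dom₁ f ω)) →
      ∃ xbar ∈ bddStrategies nt ℱ P,
        (∀ᵐ ω ∂P, xbar ω ∈ intrinsicInterior ℝ (dom₁ f ω)) ∧
        ∀ lam : ℝ, 0 < lam → lam ≤ 1 →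
          (1 - lam) • x + lam • xbar ∈ domInt₁ P f ℱ 𝓤) :
    ∀ y ∈ 𝓨,
      conjugate P 𝓤 (valueBdd P f ℱ) y = - ⨅ x ∈ bddStrategies nt ℱ P, intLagrLow P f x y := by
  intro y hyY
  have hy : Measurable y := h𝓨.measurable y hyY
  have hintegr : ∀ u ∈ 𝓤, Integrable (fun ω => dotM (u ω) (y ω)) P :=
    fun u hu => hdual.integrable u hu y hyY
  refine le_antisymm (conjugate_valueBdd_le hf h𝓤.measurable hintegr) ?_
  suffices hkey : ∀ c : ℝ, ⨅ x ∈ bddStrategies nt ℱ P, intLagrLow P f x y < c →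
      ∃ x ∈ bddStrategies nt ℱ P, ∃ u ∈ 𝓤,
        intF P f x u ≤ ((c + pairing P u y : ℝ) : EReal) by
    rw [EReal.neg_le, ← EReal.le_of_forall_lt_iff_le]
    intro c hc
    obtain ⟨x, hx, u, hu, hle⟩ := hkey c hc
    rw [EReal.neg_le, ← EReal.coe_neg]
    refine le_trans ?_ (le_iSup₂ (f := fun u (_ : u ∈ 𝓤) =>
      ((pairing P u y : ℝ) : EReal) - valueBdd P f ℱ u) u hu)
    have hv : valueBdd P f ℱ u ≤ ((c + pairing P u y : ℝ) : EReal) := (iInf₂_le x hx).trans hle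
    refine le_trans (le_of_eq ?_) (EReal.sub_le_sub le_rfl hv)
    rw [← EReal.coe_sub]
    congr 1
    ring
  intro c hc
  simp only [iInf_lt_iff] at hc
  obtain ⟨x, hx, hxc⟩ := hc
  have hxm := measurable_of_mem_strategies hx.1
  obtain ⟨x₀, hx₀, hx₀cl⟩ := hfeas
  obtain ⟨z₀, hz₀, hz₀ri, hz₀dom⟩ := hdom x₀ hx₀ hx₀cl
  have hz₀m := measurable_of_mem_strategies hz₀.1
  obtain ⟨u₀, hu₀, hfin₀⟩ := (hz₀dom 1 one_pos le_rfl).2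
  simp only [sub_self, zero_smul, one_smul, zero_add] at hfin₀
  by_cases hbot : ∀ᵐ ω ∂P, lagr f (z₀ ω) (y ω) ω ≠ ⊥
  swap
  · exact ⟨z₀, hz₀, exists_intF_le_of_lagr_eq_bot hf h𝓤 hz₀m hy hintegr hu₀ hfin₀ hbot c⟩
  have hz₀ri' : ∀ᵐ ω ∂P, IsRelInterior (dom₁ f ω) (z₀ ω) :=
    hz₀ri.mono fun ω hω => isRelInterior_of_mem_intrinsicInterior hω
  obtain ⟨h, hh, hhle, hhc⟩ := exists_integrable_majorant
    (aemeasurable_lagrLow P hf hxm hz₀m hy hz₀ri' hbot) hxc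
  have hxcl : ∀ᵐ ω ∂P, x ω ∈ closure (dom₁ f ω) := by
    filter_upwards [hz₀ri', hbot, hhle] with ω h1 h2 h3
    by_contra hcl
    obtain ⟨v, a, hva, -⟩ := exists_fconj_le_of_isRelInterior hf h1 h2
    rw [lagrLow_eq_top_of_notMem_closure hf hva hcl] at h3
    exact absurd h3 (not_le.2 (EReal.coe_lt_top _))
  obtain ⟨z, hz, hzri, hzdom⟩ := hdom x hx hxcl
  obtain ⟨u₁, hu₁, hfin₁⟩ := (hzdom 1 one_pos le_rfl).2
  simp only [sub_self, zero_smul, one_smul, zero_add] at hfin₁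
  obtain ⟨K, hK, -⟩ := EReal.lt_iff_exists_real_btwn.1 hfin₁
  obtain ⟨g, hg, hgle, -⟩ := exists_majorant_of_intF_lt hf (measurable_of_mem_strategies hz.1)
    (h𝓤.measurable u₁ hu₁) (hintegr u₁ hu₁) hK
  obtain ⟨lam, hlam0, hlam1, hlam⟩ : ∃ lam : ℝ, 0 < lam ∧ lam ≤ 1 ∧
      (1 - lam) * ∫ ω, h ω ∂P + lam * ∫ ω, g ω ∂P < c := by
    have hcont : Continuous fun lam : ℝ => (1 - lam) * ∫ ω, h ω ∂P + lam * ∫ ω, g ω ∂P := by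
      fun_prop
    have ht := (hcont.tendsto 0).mono_left (nhdsWithin_le_nhds (s := Set.Ioi 0))
    have hev := ht.eventually_lt_const (u := c) (by simpa using hhc)
    obtain ⟨lam, h1, h2⟩ := (hev.and (Ioc_mem_nhdsGT (zero_lt_one (α := ℝ)))).exists
    exact ⟨lam, h2.1, h2.2, h1⟩
  obtain ⟨hstr, u₂, hu₂, hfin₂⟩ := hzdom lam hlam0 hlam1
  refine ⟨_, combo_mem_bddStrategies hx hz hstr, ?_⟩
  refine exists_intF_le_of_lagr_le hf h𝓤 (measurable_of_mem_strategies hstr) hy hintegr hu₂ hfin₂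
    (h := fun ω => (1 - lam) * h ω + lam * g ω) ((hh.const_mul _).add (hg.const_mul _)) ?_ ?_
  · filter_upwards [hxcl, hzri, hhle, hgle] with ω h1 h2 h3 h4
    have hri := (isRelInterior_of_mem_intrinsicInterior h2).combo_closure (convex_dom₁ hf ω) h1
      hlam0 hlam1
    simp only [Pi.add_apply, Pi.smul_apply]
    rw [← lagrLow_eq_lagr_of_isRelInterior hf (y ω) hri]
    exact lagrLow_combo_le hf (by linarith) hlam0.le (by ring) h3
      ((lagrLow_le_lagr hf _ _ _).trans (lagr_le_of_le h4))
  · rw [integral_add (hh.const_mul _) (hg.const_mul _), integral_const_mul, integral_const_mul]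
    exact hlam
end

section
/- Let $(\Omega,\mathcal F,P)$ be a complete probability space with a filtration $(\mathcal F_t)_{t=0}^T$ of complete sub-$\sigma$-algebras of $\mathcal F$, and let $s=(s_t)_{t=0}^T$ be an $\mathbb R^d$-valued adapted process, $\Delta s_{t+1}=s_{t+1}-s_t$. Let $\mathcal N$ be the space of strategies $x=(x_t)_{t=0}^{T-1}$ with $x_t\in L^0(\Omega,\mathcal F_t,P;\mathbb R^d)$ and $\mathcal N^\infty$ the set of its essentially bounded elements. Expectations of extended-real-valued measurable functions are defined as $+\infty$ unless the positive part is integrable. Let $V:\mathbb R\times\Omega\to(-\infty,+\infty]$ be a convex normal integrand such that $V(\cdot,\omega)$ is nondecreasing and nonconstant with $V(0,\omega)=0$, and let $V^*(y,\omega)=\sup_{c\in\mathbb R}\{cy-V(c,\omega)\}$. Let $\mathcal U,\mathcal Y\subset L^0(\Omega,\mathcal F,P;\mathbb R)$ be linear subspaces that are decomposable ($1_Au+1_{\Omega\setminus A}u'\in\mathcal U$ for all $A\in\mathcal F$, $u\in\mathcal U$, $u'\in L^\infty$, and likewise for $\mathcal Y$) and in separating duality under $\langle u,y\rangle=E(uy)$,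 where $uy$ is integrable for all $u\in\mathcal U$, $y\in\mathcal Y$. For $u\in\mathcal U$ let $$\varphi(u)=\inf_{x\in\mathcal N}E\,V\Big(u-\sum_{t=0}^{T-1}x_t\cdot\Delta s_{t+1}\Big).$$ Let $\mathcal Q$ be the set of all $y\in\mathcal Y$ such that either $y=0$ or $y=\lambda\,dQ/dP$ for some $\lambda>0$ and some probability measure $Q\ll P$ under which $s-s_0$ is a martingale, i.e. the increments $\Delta s_{t+1}$ are $Q$-integrable and $E_Q[\Delta s_{t+1}\mid\mathcal F_t]=0$ for $t=0,\dots,T-1$. (If $s_0$ is $Q$-integrable, e.g. if $s_0$ is deterministic, this means that $s$ is a $Q$-martingale.) Assume that for every $x\in\mathcal N^\infty$ there exists $u\in\mathcal U$ with $E\,V(u-\sum_{t=0}^{T-1}x_t\cdot\Delta s_{t+1})<+\infty$. Then for every $u\in\mathcal U$, $$(\operatorname{cl}\varphi)(u)=\sup_{y\in\mathcal Q}E[uy-V^*(y)],$$ where $\operatorname{cl}\varphi$ is the closure of $\varphi$, i.e. its greatest closed convex minorant, which equals the biconjugate $u\mapsto\sup_{y\in\mathcal Y}\{\langle u,y\rangle-\varphi^*(y)\}$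 with $\varphi^*(y)=\sup_{u\in\mathcal U}\{\langle u,y\rangle-\varphi(u)\}$. Here a convex function on $\mathcal U$ is closed if it is $\sigma(\mathcal U,\mathcal Y)$-lower semicontinuous and either constant or proper (never $-\infty$ and finite somewhere). -/
open MeasureTheory
open scoped ENNReal

noncomputable section

/-- Expectation of an extended-real-valued measurable function: `+∞` unless the positive part is
integrable. (`EReal.toENNReal` is the positive part.) -/
def EE {Ω : Type*} {mΩ : MeasurableSpace Ω} (P : Measure Ω) (f : Ω → EReal) : EReal :=
  if ∫⁻ ω, (f ω).toENNReal ∂P = ⊤ then ⊤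
  else ((∫⁻ ω, (f ω).toENNReal ∂P : ℝ≥0∞) : EReal) -
    ((∫⁻ ω, (-(f ω)).toENNReal ∂P : ℝ≥0∞) : EReal)

/-- The space `𝓝` of adapted trading strategies `x = (x_t)_{t=0}^{T-1}`. -/
def Strat {Ω : Type*} {mΩ : MeasurableSpace Ω} {T : ℕ} (d : ℕ) (ℱ : Filtration (Fin (T + 1)) mΩ) :
    Set (Fin T → Ω → (Fin d → ℝ)) :=
  {x | ∀ t : Fin T, Measurable[ℱ t.castSucc] (x t)}

/-- The essentially bounded adapted trading strategies `𝓝^∞`. -/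
def StratBdd {Ω : Type*} {mΩ : MeasurableSpace Ω} {T : ℕ} (d : ℕ)
    (ℱ : Filtration (Fin (T + 1)) mΩ) (P : Measure Ω) : Set (Fin T → Ω → (Fin d → ℝ)) :=
  {x | x ∈ Strat d ℱ ∧ ∃ M : ℝ, ∀ᵐ ω ∂P, ∀ t, ‖x t ω‖ ≤ M}

/-- The gains `Σ_{t=0}^{T-1} x_t·Δs_{t+1}` of a strategy. -/
def gains {Ω : Type*} {T d : ℕ} (s : Fin (T + 1) → Ω → (Fin d → ℝ))
    (x : Fin T → Ω → (Fin d → ℝ)) (ω : Ω) : ℝ :=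
  ∑ t : Fin T, x t ω ⬝ᵥ (s t.succ ω - s t.castSucc ω)

/-- The objective `E V(u − Σ x_t·Δs_{t+1})` of the problem (ALM). -/
def objALM {Ω : Type*} {mΩ : MeasurableSpace Ω} {T d : ℕ} (P : Measure Ω) (V : ℝ → Ω → EReal)
    (s : Fin (T + 1) → Ω → (Fin d → ℝ)) (x : Fin T → Ω → (Fin d → ℝ)) (u : Ω → ℝ) : EReal :=
  EE P fun ω => V (u ω - gains s x ω) ω

/-- The value function `φ` of (ALM). -/
def phiALM {Ω : Type*} {mΩ : MeasurableSpace Ω} {T d : ℕ} (P : Measure Ω)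
    (ℱ : Filtration (Fin (T + 1)) mΩ) (V : ℝ → Ω → EReal)
    (s : Fin (T + 1) → Ω → (Fin d → ℝ)) (u : Ω → ℝ) : EReal :=
  ⨅ x ∈ Strat d ℱ, objALM P V s x u

/-- The conjugate `V*(y,ω) = sup_c {cy − V(c,ω)}`. -/
def Vconj {Ω : Type*} (V : ℝ → Ω → EReal) (y : ℝ) (ω : Ω) : EReal :=
  ⨆ c : ℝ, (((c * y : ℝ) : EReal) - V c ω)

/-- The conjugate `g*(y) = sup_{u ∈ 𝓤} {⟨u,y⟩ − g(u)}` of a function `g` on `𝓤`. -/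
def conjU {Ω : Type*} {mΩ : MeasurableSpace Ω} (P : Measure Ω) (𝓤 : Submodule ℝ (Ω → ℝ))
    (g : 𝓤 → EReal) (y : Ω → ℝ) : EReal :=
  ⨆ u : 𝓤, (((∫ ω, u.1 ω * y ω ∂P : ℝ) : EReal) - g u)

/-- The biconjugate `g**(u) = sup_{y ∈ 𝓨} {⟨u,y⟩ − g*(y)}` of a function `g` on `𝓤`. -/
def biconjU {Ω : Type*} {mΩ : MeasurableSpace Ω} (P : Measure Ω) (𝓤 𝓨 : Submodule ℝ (Ω → ℝ))
    (g : 𝓤 → EReal) (u : 𝓤) : EReal :=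
  ⨆ y : 𝓨, (((∫ ω, u.1 ω * y.1 ω ∂P : ℝ) : EReal) - conjU P 𝓤 g y.1)

/-- The weak topology `σ(𝓤,𝓨)` on `𝓤`: the coarsest one for which every `⟨·,y⟩`, `y ∈ 𝓨`,
is continuous. -/
@[reducible] def weakTop {Ω : Type*} {mΩ : MeasurableSpace Ω} (P : Measure Ω) (𝓤 𝓨 : Submodule ℝ (Ω → ℝ)) :
    TopologicalSpace 𝓤 :=
  TopologicalSpace.induced (fun (u : 𝓤) (y : 𝓨) => ∫ ω, u.1 ω * y.1 ω ∂P) inferInstance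

/-- Closed convex functions on `𝓤`: convex (convex epigraph), `σ(𝓤,𝓨)`-lower semicontinuous, and
either proper (never `-∞`, finite somewhere) or constant. -/
def IsClosedConvexFun {Ω : Type*} {mΩ : MeasurableSpace Ω} (P : Measure Ω)
    (𝓤 𝓨 : Submodule ℝ (Ω → ℝ)) (g : 𝓤 → EReal) : Prop :=
  Convex ℝ {p : 𝓤 × ℝ | g p.1 ≤ (p.2 : EReal)} ∧
  @LowerSemicontinuous 𝓤 EReal (weakTop P 𝓤 𝓨) _ g ∧
  (((∀ u, g u ≠ ⊥) ∧ ∃ u, g u ≠ ⊤) ∨ ∃ c : EReal, ∀ u, g u = c)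

/-- The closure `cl g` of a function `g` on `𝓤`: the pointwise supremum of the closed convex
minorants of `g`. -/
def clU {Ω : Type*} {mΩ : MeasurableSpace Ω} (P : Measure Ω) (𝓤 𝓨 : Submodule ℝ (Ω → ℝ))
    (g : 𝓤 → EReal) (u : 𝓤) : EReal :=
  ⨆ h ∈ {h : 𝓤 → EReal | IsClosedConvexFun P 𝓤 𝓨 h ∧ ∀ v, h v ≤ g v}, h u

/-- `𝓠`: the multiples `λ dQ/dP ∈ 𝓨`, `λ ≥ 0`, of densities of probability measures `Q ≪ P` with
`E_Q[Δs_{t+1} | ℱ_t] = 0` for all `t`, the increments being `Q`-integrable; that is, `s - s_0` is a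
`Q`-martingale, which is the same as `s` being one as soon as `s_0` is `Q`-integrable. The multiple
`y = 0` belongs to `𝓠` also when no such `Q` exists. -/
def Qset {Ω : Type*} {mΩ : MeasurableSpace Ω} {T d : ℕ} (P : Measure Ω)
    (ℱ : Filtration (Fin (T + 1)) mΩ) (s : Fin (T + 1) → Ω → (Fin d → ℝ))
    (𝓨 : Submodule ℝ (Ω → ℝ)) : Set (Ω → ℝ) :=
  {y | y ∈ 𝓨 ∧ (y =ᵐ[P] 0 ∨ ∃ lam : ℝ, 0 < lam ∧ ∃ Q : Measure Ω, IsProbabilityMeasure Q ∧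
    Q ≪ P ∧ Martingale (fun t ω => s t ω - s 0 ω) ℱ Q ∧
    y =ᵐ[P] fun ω => lam * (Q.rnDeriv P ω).toReal)}

/-- Decomposability of a space of real-valued measurable functions. -/
def DecomposableR {Ω : Type*} {mΩ : MeasurableSpace Ω} (P : Measure Ω)
    (S : Submodule ℝ (Ω → ℝ)) : Prop :=
  ∀ A : Set Ω, MeasurableSet A → ∀ u ∈ S, ∀ u' : Ω → ℝ,
    Measurable u' → (∃ M : ℝ, ∀ᵐ ω ∂P, |u' ω| ≤ M) →
    (fun ω => A.indicator u ω + Aᶜ.indicator u' ω) ∈ S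

end

section Expectation

variable {Ω : Type*} {mΩ : MeasurableSpace Ω} {P : Measure Ω}

lemma EReal.coe_sub_le_of_coe_sub_le {a : ℝ} {x z : EReal} (h : (a : EReal) - x ≤ z) :
    (a : EReal) - z ≤ x := by
  induction x <;> induction z <;> simp_all [← EReal.coe_sub, EReal.coe_le_coe_iff]
  linarith

lemma lintegral_toENNReal_ne_top_of_EE_lt_top {f : Ω → EReal} (h : EE P f < ⊤) :
    ∫⁻ ω, (f ω).toENNReal ∂P ≠ ⊤ := by
  intro h'
  simp [EE, h'] at h

lemma EE_coe {f : Ω → ℝ} (hf : Integrable f P) : EE P (fun ω => (f ω : EReal)) = (∫ ω, f ω ∂P : ℝ) := by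
  have h1 : ∫⁻ ω, ENNReal.ofReal (f ω) ∂P ≠ ⊤ := by
    simpa using hf.lintegral_lt_top.ne
  have h2 : ∫⁻ ω, ENNReal.ofReal (-f ω) ∂P ≠ ⊤ := by
    simpa using hf.neg.lintegral_lt_top.ne
  rw [integral_eq_lintegral_pos_part_sub_lintegral_neg_part hf]
  refine (if_neg h1).trans ?_
  rw [EReal.coe_sub, EReal.coe_ennreal_toReal h1, EReal.coe_ennreal_toReal h2]
  rfl

lemma EE_congr {f g : Ω → EReal} (h : f =ᵐ[P] g) : EE P f = EE P g := by
  have h1 : ∫⁻ ω, (f ω).toENNReal ∂P = ∫⁻ ω, (g ω).toENNReal ∂P :=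
    lintegral_congr_ae (h.mono fun ω hω => by simp [hω])
  have h2 : ∫⁻ ω, (-(f ω)).toENNReal ∂P = ∫⁻ ω, (-(g ω)).toENNReal ∂P :=
    lintegral_congr_ae (h.mono fun ω hω => by simp [hω])
  simp [EE, h1, h2]

/-- A nonnegative extended-real function with finite integral is a.e. equal to an integrable
function. -/
lemma integrable_toReal_of_lintegral_toENNReal_ne_top {F : Ω → EReal} (hF : Measurable F)
    (hF0 : ∀ ω, 0 ≤ F ω) (h : ∫⁻ ω, (F ω).toENNReal ∂P ≠ ⊤) :
    Integrable (fun ω => (F ω).toReal) P ∧ (∀ᵐ ω ∂P, F ω = ((F ω).toReal : EReal)) ∧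
      ((∫⁻ ω, (F ω).toENNReal ∂P : ℝ≥0∞) : EReal) = (∫ ω, (F ω).toReal ∂P : ℝ) := by
  have hint := integrable_toReal_of_lintegral_ne_top hF.ereal_toENNReal.aemeasurable h
  have hfin : ∀ᵐ ω ∂P, (F ω).toENNReal < ⊤ := ae_lt_top hF.ereal_toENNReal h
  have heq : ∀ ω, (F ω).toENNReal.toReal = (F ω).toReal := fun ω => EReal.toReal_toENNReal (hF0 ω)
  refine ⟨by simpa only [heq] using hint, ?_, ?_⟩
  · filter_upwards [hfin] with ω hω
    rw [EReal.coe_toReal]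
    · simpa using hω.ne
    · exact ((EReal.bot_lt_zero).trans_le (hF0 ω)).ne'
  · have := integral_toReal hF.ereal_toENNReal.aemeasurable hfin
    simp only [heq] at this
    rw [this, EReal.coe_ennreal_toReal h]

lemma EE_coe_sub {a : Ω → ℝ} (ha : Integrable a P) {F : Ω → EReal} (hF : Measurable F)
    (hF0 : ∀ ω, 0 ≤ F ω) :
    EE P (fun ω => (a ω : EReal) - F ω) =
      (∫ ω, a ω ∂P : ℝ) - ((∫⁻ ω, (F ω).toENNReal ∂P : ℝ≥0∞) : EReal) := by
  by_cases h : ∫⁻ ω, (F ω).toENNReal ∂P = ⊤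
  · have hpos : ∫⁻ ω, ((a ω : EReal) - F ω).toENNReal ∂P ≠ ⊤ := by
      refine ne_top_of_le_ne_top ha.lintegral_lt_top.ne (lintegral_mono fun ω => ?_)
      rw [EReal.toENNReal_sub (hF0 ω)]
      simp
    have hneg : ∫⁻ ω, (-((a ω : EReal) - F ω)).toENNReal ∂P = ⊤ := by
      by_contra hne
      have hle : ∫⁻ ω, (F ω).toENNReal ∂P ≤
          ∫⁻ ω, ((-((a ω : EReal) - F ω)).toENNReal + (a ω : EReal).toENNReal) ∂P := by
        refine lintegral_mono fun ω => ?_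
        refine le_trans (le_of_eq ?_) EReal.toENNReal_add_le
        congr 1
        have := (EReal.bot_lt_zero).trans_le (hF0 ω)
        induction hx : F ω <;> simp_all [← EReal.coe_sub, ← EReal.coe_neg, ← EReal.coe_add]
      simp only [EReal.real_coe_toENNReal] at hle
      rw [lintegral_add_right' _ ha.aemeasurable.ennreal_ofReal] at hle
      exact (ENNReal.add_lt_top.2 ⟨lt_top_iff_ne_top.2 hne, ha.lintegral_lt_top⟩).ne
        (top_le_iff.1 (h ▸ hle))
    unfold EE
    rw [if_neg hpos, hneg, h]
    simp
  · obtain ⟨h1, h2, h3⟩ := integrable_toReal_of_lintegral_toENNReal_ne_top hF hF0 h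
    rw [h3, ← EReal.coe_sub, ← integral_sub ha h1]
    refine Eq.trans ?_ (EE_coe (ha.sub h1))
    refine EE_congr ?_
    filter_upwards [h2] with ω hω
    rw [hω]
    simp

lemma EE_of_coe_le {f : Ω → EReal} (hf : Measurable f) {l : Ω → ℝ} (hl : Integrable l P)
    (hlf : ∀ᵐ ω ∂P, (l ω : EReal) ≤ f ω) (h : EE P f < ⊤) :
    Integrable (fun ω => (f ω).toReal) P ∧ (∀ᵐ ω ∂P, f ω = ((f ω).toReal : EReal)) ∧
      EE P f = (∫ ω, (f ω).toReal ∂P : ℝ) := by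
  have hpos := lintegral_toENNReal_ne_top_of_EE_lt_top h
  have hfin : ∀ᵐ ω ∂P, f ω = ((f ω).toReal : EReal) := by
    filter_upwards [hlf, ae_lt_top hf.ereal_toENNReal hpos] with ω h1 h2
    rw [EReal.coe_toReal]
    · simpa using h2.ne
    · exact ((EReal.bot_lt_coe _).trans_le h1).ne'
  have hint : Integrable (fun ω => (f ω).toReal) P := by
    refine Integrable.mono'
      (g := fun ω => (f ω).toENNReal.toReal + |l ω|)
      ((integrable_toReal_of_lintegral_ne_top hf.ereal_toENNReal.aemeasurable hpos).add hl.abs)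
      hf.ereal_toReal.aestronglyMeasurable ?_
    filter_upwards [hlf, hfin] with ω h1 h2
    rw [h2] at h1 ⊢
    have h1' := EReal.coe_le_coe_iff.1 h1
    simp only [EReal.toReal_coe, EReal.real_coe_toENNReal, ENNReal.toReal_ofReal', Real.norm_eq_abs]
    rcases abs_cases (f ω).toReal with h | h <;> rcases abs_cases (l ω) with h' | h' <;>
      rcases max_cases (f ω).toReal 0 with h'' | h'' <;> linarith
  refine ⟨hint, hfin, ?_⟩
  rw [← EE_coe hint]
  exact EE_congr hfin

end Expectation

section Conjugate

variable {Ω : Type*} {mΩ : MeasurableSpace Ω} {V : ℝ → Ω → EReal}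

lemma Vconj_nonneg (hV_zero : ∀ ω, V 0 ω = 0) (y : ℝ) (ω : Ω) : 0 ≤ Vconj V y ω := by
  refine le_trans ?_ (le_iSup _ (0 : ℝ))
  simp [hV_zero]

lemma coe_mul_sub_Vconj_le (c y : ℝ) (ω : Ω) :
    ((c * y : ℝ) : EReal) - Vconj V y ω ≤ V c ω :=
  EReal.coe_sub_le_of_coe_sub_le (le_iSup (fun c : ℝ => ((c * y : ℝ) : EReal) - V c ω) c)

lemma Vconj_eq_iSup_rat (hV_mono : ∀ ω, ∀ c c' : ℝ, c ≤ c' → V c ω ≤ V c' ω) (y : ℝ) (ω : Ω) :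
    Vconj V y ω = ⨆ q : ℚ, ((((q : ℝ) * y : ℝ) : EReal) - V q ω) := by
  refine le_antisymm (iSup_le fun c => ?_)
    (iSup_le fun q => le_iSup (fun c : ℝ => ((c * y : ℝ) : EReal) - V c ω) (q : ℝ))
  refine le_of_forall_lt fun z hz => ?_
  have hcont : ContinuousAt (fun q : ℝ => ((q * y : ℝ) : EReal) - V c ω) c := by
    by_cases hb : V c ω = ⊥
    · have : (fun q : ℝ => ((q * y : ℝ) : EReal) - V c ω) = fun _ => ⊤ := by
        funext q; rw [hb]; exact EReal.coe_sub_bot _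
      rw [this]
      exact continuousAt_const
    by_cases ht : V c ω = ⊤
    · have : (fun q : ℝ => ((q * y : ℝ) : EReal) - V c ω) = fun _ => ⊥ := by
        funext q; simp [ht]
      rw [this]
      exact continuousAt_const
    rw [← EReal.coe_toReal ht hb]
    simp only [← EReal.coe_sub]
    exact (continuous_coe_real_ereal.comp (by fun_prop)).continuousAt
  obtain ⟨δ, hδ, hball⟩ := Metric.eventually_nhds_iff.1 (hcont.eventually (lt_mem_nhds hz))
  obtain ⟨q, hq1, hq2⟩ := exists_rat_btwn (show c - δ < c by linarith)
  have hzq : z < (((q : ℝ) * y : ℝ) : EReal) - V c ω := by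
    apply hball
    rw [Real.dist_eq, abs_lt]
    constructor <;> linarith
  refine hzq.trans_le (le_trans ?_ (le_iSup (fun q : ℚ => ((((q : ℝ) * y : ℝ) : EReal) - V q ω)) q))
  exact EReal.sub_le_sub le_rfl (hV_mono ω _ _ hq2.le)

lemma measurable_V_comp (hV_meas : Measurable (fun p : ℝ × Ω => V p.1 p.2)) {c : Ω → ℝ}
    (hc : Measurable c) : Measurable fun ω => V (c ω) ω :=
  hV_meas.comp (hc.prodMk measurable_id)

lemma measurable_Vconj (hV_meas : Measurable (fun p : ℝ × Ω => V p.1 p.2))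
    (hV_mono : ∀ ω, ∀ c c' : ℝ, c ≤ c' → V c ω ≤ V c' ω) {y : Ω → ℝ} (hy : Measurable y) :
    Measurable fun ω => Vconj V (y ω) ω := by
  simp_rw [Vconj_eq_iSup_rat hV_mono]
  refine Measurable.iSup fun q => ?_
  have h1 : Measurable fun ω => (((q : ℝ) * y ω : ℝ) : EReal) := (hy.const_mul _).coe_real_ereal
  exact h1.sub (measurable_V_comp hV_meas measurable_const)

/-- Monotone nonnegative approximation of `V*(y)` from below along bounded measurable
selections. -/
lemma exists_bounded_selections (hV_meas : Measurable (fun p : ℝ × Ω => V p.1 p.2))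
    (hV_mono : ∀ ω, ∀ c c' : ℝ, c ≤ c' → V c ω ≤ V c' ω) (hV_zero : ∀ ω, V 0 ω = 0)
    {y : Ω → ℝ} (hy : Measurable y) :
    ∃ c : ℕ → Ω → ℝ, (∀ n, Measurable (c n)) ∧ (∀ n, ∃ M : ℝ, ∀ ω, |c n ω| ≤ M) ∧
      (∀ n ω, 0 ≤ ((c n ω * y ω : ℝ) : EReal) - V (c n ω) ω) ∧
      (Monotone fun n ω => ((c n ω * y ω : ℝ) : EReal) - V (c n ω) ω) ∧
      ∀ ω, Vconj V (y ω) ω = ⨆ n, (((c n ω * y ω : ℝ) : EReal) - V (c n ω) ω) := by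
  classical
  obtain ⟨e, he⟩ := exists_surjective_nat ℚ
  let G : ℝ → Ω → EReal := fun c ω => ((c * y ω : ℝ) : EReal) - V c ω
  have hG : ∀ {c : Ω → ℝ}, Measurable c → Measurable fun ω => G (c ω) ω := fun hc =>
    (hc.mul hy).coe_real_ereal.sub (measurable_V_comp hV_meas hc)
  let step : ℕ → (Ω → ℝ) → Ω → ℝ := fun n c ω => if G (c ω) ω < G (e n) ω then (e n : ℝ) else c ω
  let c : ℕ → Ω → ℝ := fun n => Nat.rec (fun _ => 0) step n
  have hc0 : ∀ ω, c 0 ω = 0 := fun ω => rfl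
  have hcs : ∀ n ω, c (n + 1) ω = if G (c n ω) ω < G (e n) ω then (e n : ℝ) else c n ω :=
    fun n ω => rfl
  have hGs : ∀ n ω, G (c (n + 1) ω) ω = max (G (c n ω) ω) (G (e n) ω) := by
    intro n ω
    rw [hcs]
    split_ifs with h
    · rw [max_eq_right h.le]
    · rw [max_eq_left (not_lt.1 h)]
  have hm : ∀ n, Measurable (c n) := by
    intro n
    induction n with
    | zero => exact measurable_const
    | succ n ih =>
      exact Measurable.ite (measurableSet_lt (hG ih) (hG (c := fun _ => (e n : ℝ)) measurable_const))
        measurable_const ih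
  have hmono : Monotone fun n ω => G (c n ω) ω :=
    monotone_nat_of_le_succ fun n ω => by
      show G (c n ω) ω ≤ G (c (n + 1) ω) ω
      rw [hGs]
      exact le_max_left _ _
  refine ⟨c, hm, fun n => ?_, fun n ω => ?_, hmono, fun ω => ?_⟩
  · induction n with
    | zero => exact ⟨0, fun ω => by simp [hc0]⟩
    | succ n ih =>
      obtain ⟨M, hM⟩ := ih
      refine ⟨max M |(e n : ℝ)|, fun ω => ?_⟩
      rw [hcs]
      split_ifs
      · exact le_max_right _ _
      · exact (hM ω).trans (le_max_left _ _)
  · refine le_trans ?_ (hmono (Nat.zero_le n) ω)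
    simp [G, hc0, hV_zero]
  · refine le_antisymm ?_
      (iSup_le fun n => le_iSup (fun c : ℝ => ((c * y ω : ℝ) : EReal) - V c ω) (c n ω))
    rw [Vconj_eq_iSup_rat hV_mono]
    refine iSup_le fun q => ?_
    obtain ⟨n, rfl⟩ := he q
    refine le_trans ?_ (le_iSup (fun n => G (c n ω) ω) (n + 1))
    show G (e n) ω ≤ G (c (n + 1) ω) ω
    rw [hGs]
    exact le_max_right _ _

end Conjugate

section MartingaleTransform

variable {Ω : Type*} {mΩ : MeasurableSpace Ω} {Q : Measure Ω}

lemma integrable_of_lintegral_ofReal_ne_top {f : Ω → ℝ} (hf : AEStronglyMeasurable f Q)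
    (hpos : ∫⁻ ω, ENNReal.ofReal (f ω) ∂Q ≠ ⊤) (hneg : ∫⁻ ω, ENNReal.ofReal (-f ω) ∂Q ≠ ⊤) :
    Integrable f Q := by
  refine ⟨hf, ?_⟩
  rw [hasFiniteIntegral_iff_norm]
  have : ∀ ω, ENNReal.ofReal ‖f ω‖ = ENNReal.ofReal (f ω) + ENNReal.ofReal (-f ω) := by
    intro ω
    rcases le_total 0 (f ω) with h0 | h0
    · rw [Real.norm_of_nonneg h0, ENNReal.ofReal_of_nonpos (neg_nonpos.2 h0), add_zero]
    · rw [Real.norm_of_nonpos h0, ENNReal.ofReal_of_nonpos h0, zero_add]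
  simp_rw [this]
  rw [lintegral_add_left' hf.aemeasurable.ennreal_ofReal]
  exact ENNReal.add_lt_top.2 ⟨lt_top_iff_ne_top.2 hpos, lt_top_iff_ne_top.2 hneg⟩

lemma lintegral_ofReal_ne_top_of_setLIntegral_le {f : Ω → ℝ}
    {B : ℕ → Set Ω} (hB : Monotone B) (hBU : ⋃ n, B n = Set.univ)
    {K : ℝ≥0∞} (hK : K ≠ ⊤) (h : ∀ n, ∫⁻ ω in B n, ENNReal.ofReal (f ω) ∂Q ≤ K) :
    ∫⁻ ω, ENNReal.ofReal (f ω) ∂Q ≠ ⊤ := by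
  refine ne_top_of_le_ne_top hK ?_
  rw [← setLIntegral_univ, ← hBU, setLIntegral_iUnion_of_directed _ hB.directed_le]
  exact iSup_le h

/-- One step of a martingale transform: if the increment `D` has zero mean on all `m`-measurable
subsets of the sets `B n`, then the negative part of `X` is integrable whenever that of `X + D`
is. -/
lemma lintegral_neg_ne_top_of_add {Ω : Type*} {m mΩ : MeasurableSpace Ω} {Q : Measure Ω}
    (hm : m ≤ mΩ) [IsFiniteMeasure Q]
    {X D : Ω → ℝ} (hX : Measurable[m] X)
    {B : ℕ → Set Ω} (hBm : ∀ n, MeasurableSet[m] (B n)) (hB : Monotone B)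
    (hBU : ⋃ n, B n = Set.univ) (hint : ∀ n, IntegrableOn D (B n) Q)
    (hzero : ∀ n, ∀ A ⊆ B n, MeasurableSet[m] A → ∫ ω in A, D ω ∂Q = 0)
    (h : ∫⁻ ω, ENNReal.ofReal (-(X ω + D ω)) ∂Q ≠ ⊤) :
    ∫⁻ ω, ENNReal.ofReal (-X ω) ∂Q ≠ ⊤ := by
  have hX' : Measurable X := hX.mono hm le_rfl
  let C : ℕ → Set Ω := fun n => {ω | |X ω| ≤ n}
  have hCm : ∀ n, MeasurableSet[m] (C n) := fun n =>
    measurableSet_le (measurable_norm.comp hX) measurable_const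
  have hC : Monotone C := fun i j hij ω hω =>
    le_trans (show |X ω| ≤ i from hω) (by exact_mod_cast hij)
  refine lintegral_ofReal_ne_top_of_setLIntegral_le (B := fun n => B n ∩ C n) (fun i j hij => Set.inter_subset_inter (hB hij) (hC hij))
    ?_ h fun n => ?_
  · rw [Set.eq_univ_iff_forall]
    intro ω
    have : ω ∈ ⋃ n, B n := hBU ▸ Set.mem_univ ω
    obtain ⟨i, hi⟩ := Set.mem_iUnion.1 this
    obtain ⟨j, hj⟩ := exists_nat_ge |X ω|
    exact Set.mem_iUnion.2 ⟨max i j, hB (le_max_left i j) hi, hC (le_max_right i j) hj⟩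
  let A : Set Ω := (B n ∩ C n) ∩ {ω | X ω < 0}
  have hNm : MeasurableSet[m] {ω | X ω < 0} := measurableSet_lt hX measurable_const
  have hAm : MeasurableSet[m] A := ((hBm n).inter (hCm n)).inter hNm
  have hXint : IntegrableOn X A Q := by
    refine Measure.integrableOn_of_bounded (M := n) (measure_ne_top _ _)
      hX'.aestronglyMeasurable ?_
    refine (ae_restrict_iff' (hm _ hAm)).2 (ae_of_all _ fun ω hω => hω.1.2)
  have hDint : IntegrableOn D A Q := (hint n).mono_set fun ω hω => hω.1.1
  have hA0 : ∫ ω in A, D ω ∂Q = 0 := hzero n A (fun ω hω => hω.1.1) hAm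
  have h1 : ∫⁻ ω in B n ∩ C n, ENNReal.ofReal (-X ω) ∂Q = ∫⁻ ω in A, ENNReal.ofReal (-X ω) ∂Q := by
    rw [← lintegral_inter_add_sdiff _ (B n ∩ C n) (hm _ hNm)]
    have : ∫⁻ ω in (B n ∩ C n) \ {ω | X ω < 0}, ENNReal.ofReal (-X ω) ∂Q = 0 := by
      rw [setLIntegral_congr_fun (g := fun _ => 0)
        ((hm _ ((hBm n).inter (hCm n))).diff (hm _ hNm))]
      · simp
      · intro ω hω
        have : 0 ≤ X ω := not_lt.1 hω.2
        simpa using this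
    rw [this, add_zero]
  have hneg : IntegrableOn (fun ω => -X ω) A Q := hXint.neg
  rw [h1, ← ofReal_integral_eq_lintegral_ofReal hneg
    ((ae_restrict_iff' (hm _ hAm)).2 (ae_of_all _ fun ω hω => by
      have : X ω < 0 := hω.2
      simpa using this.le))]
  have h2 : ∫ ω in A, -X ω ∂Q = ∫ ω in A, -(X ω + D ω) ∂Q := by
    rw [integral_neg, integral_neg, integral_add hXint hDint, hA0, add_zero]
  rw [h2]
  have h3 : ENNReal.ofReal (∫ ω in A, -(X ω + D ω) ∂Q) ≤
      ∫⁻ ω in A, ENNReal.ofReal (-(X ω + D ω)) ∂Q := by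
    have hI : IntegrableOn (fun ω => -(X ω + D ω)) A Q := (hXint.add hDint).neg
    rw [integral_eq_lintegral_pos_part_sub_lintegral_neg_part hI]
    refine (ENNReal.ofReal_le_ofReal (sub_le_self _ ENNReal.toReal_nonneg)).trans ?_
    exact ENNReal.ofReal_toReal_le
  exact h3.trans (setLIntegral_le_lintegral _ _)

/-- One step of a martingale transform: integrability and the mean pass from `X` to `X + D` as soon
as the negative part of `X + D` is integrable. -/
lemma integrable_add_of_lintegral_neg_ne_top
    {X D : Ω → ℝ} (hX : Integrable X Q) (hXm : Measurable X) (hD : Measurable D)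
    {B : ℕ → Set Ω} (hBm : ∀ n, MeasurableSet (B n)) (hB : Monotone B)
    (hBU : ⋃ n, B n = Set.univ) (hint : ∀ n, IntegrableOn D (B n) Q)
    (hzero : ∀ n, ∫ ω in B n, D ω ∂Q = 0)
    (h : ∫⁻ ω, ENNReal.ofReal (-(X ω + D ω)) ∂Q ≠ ⊤) :
    Integrable (fun ω => X ω + D ω) Q ∧ ∫ ω, (X ω + D ω) ∂Q = ∫ ω, X ω ∂Q := by
  have hM : Measurable fun ω => X ω + D ω := hXm.add hD
  have hpos : ∫⁻ ω, ENNReal.ofReal (X ω + D ω) ∂Q ≠ ⊤ := by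
    refine lintegral_ofReal_ne_top_of_setLIntegral_le (Q := Q) hB hBU
      (K := ENNReal.ofReal (∫ ω, |X ω| ∂Q) + ∫⁻ ω, ENNReal.ofReal (-(X ω + D ω)) ∂Q)
      (ENNReal.add_ne_top.2 ⟨ENNReal.ofReal_ne_top, h⟩) fun n => ?_
    have hI : IntegrableOn (fun ω => X ω + D ω) (B n) Q := hX.integrableOn.add (hint n)
    have e1 := integral_eq_lintegral_pos_part_sub_lintegral_neg_part hI
    rw [integral_add hX.integrableOn (hint n), hzero n, add_zero] at e1
    have p1 : ∫⁻ ω in B n, ENNReal.ofReal (X ω + D ω) ∂Q ≠ ⊤ := Integrable.lintegral_lt_top hI |>.ne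
    have p2 : ∫⁻ ω in B n, ENNReal.ofReal (-(X ω + D ω)) ∂Q ≤
      ∫⁻ ω, ENNReal.ofReal (-(X ω + D ω)) ∂Q := setLIntegral_le_lintegral _ _
    have p3 : ∫ ω in B n, X ω ∂Q ≤ ∫ ω, |X ω| ∂Q :=
      (integral_mono hX.integrableOn hX.integrableOn.abs fun ω => le_abs_self _).trans
        (setIntegral_le_integral hX.abs (ae_of_all _ fun ω => abs_nonneg _))
    rw [← ENNReal.ofReal_toReal p1]
    have : (∫⁻ ω in B n, ENNReal.ofReal (X ω + D ω) ∂Q).toReal ≤ ∫ ω, |X ω| ∂Q +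
        (∫⁻ ω in B n, ENNReal.ofReal (-(X ω + D ω)) ∂Q).toReal := by linarith
    refine (ENNReal.ofReal_le_ofReal this).trans (ENNReal.ofReal_add_le.trans ?_)
    gcongr
    exact ENNReal.ofReal_toReal_le.trans p2
  have hI : Integrable (fun ω => X ω + D ω) Q := integrable_of_lintegral_ofReal_ne_top
    hM.aestronglyMeasurable hpos h
  refine ⟨hI, ?_⟩
  have hDI : Integrable D Q := by
    refine (hI.sub hX).congr (ae_of_all _ fun ω => ?_)
    simp
  rw [integral_add hX hDI]
  have hlim := tendsto_setIntegral_of_monotone hBm hB (f := D) (μ := Q) hDI.integrableOn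
  simp only [hzero, hBU, setIntegral_univ] at hlim
  rw [← tendsto_nhds_unique tendsto_const_nhds hlim, add_zero]

/-- A finite sum of martingale-transform increments whose negative part is integrable is integrable
with zero mean. -/
lemma integrable_sum_range_of_lintegral_neg_ne_top [IsFiniteMeasure Q]
    (𝒢 : ℕ → MeasurableSpace Ω) (hle : ∀ k, 𝒢 k ≤ mΩ) (hmono : Monotone 𝒢)
    (D : ℕ → Ω → ℝ) (hD : ∀ k, Measurable[𝒢 (k + 1)] (D k))
    (B : ℕ → ℕ → Set Ω) (hBm : ∀ k n, MeasurableSet[𝒢 k] (B k n)) (hB : ∀ k, Monotone (B k))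
    (hBU : ∀ k, ⋃ n, B k n = Set.univ) (hint : ∀ k n, IntegrableOn (D k) (B k n) Q)
    (hzero : ∀ k n, ∀ A ⊆ B k n, MeasurableSet[𝒢 k] A → ∫ ω in A, D k ω ∂Q = 0)
    (N : ℕ) (h : ∫⁻ ω, ENNReal.ofReal (-∑ k ∈ Finset.range N, D k ω) ∂Q ≠ ⊤) :
    Integrable (fun ω => ∑ k ∈ Finset.range N, D k ω) Q ∧
      ∫ ω, ∑ k ∈ Finset.range N, D k ω ∂Q = 0 := by
  have hM : ∀ k, Measurable[𝒢 k] fun ω => ∑ i ∈ Finset.range k, D i ω := fun k =>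
    Finset.measurable_fun_sum _ fun i hi =>
      (hD i).mono (hmono (Finset.mem_range.1 hi)) le_rfl
  induction N with
  | zero => simp
  | succ N ih =>
    simp only [Finset.sum_range_succ] at h ⊢
    have hDN : Measurable (D N) := (hD N).mono (hle _) le_rfl
    have hneg := lintegral_neg_ne_top_of_add (hle N) (hM N) (hBm N) (hB N) (hBU N) (hint N)
      (hzero N) h
    obtain ⟨h1, h2⟩ := ih hneg
    rw [← h2]
    exact integrable_add_of_lintegral_neg_ne_top h1 ((hM N).mono (hle N) le_rfl) hDN
      (fun n => hle N _ (hBm N n)) (hB N) (hBU N) (hint N)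
      (fun n => hzero N n _ subset_rfl (hBm N n)) h

end MartingaleTransform

section FenchelMoreau

variable {E : Type*} [AddCommGroup E] [Module ℝ E] [TopologicalSpace E] [IsTopologicalAddGroup E]
  [ContinuousSMul ℝ E] [LocallyConvexSpace ℝ E]

lemma exists_separating_epigraph {h : E → EReal}
    (hconv : Convex ℝ {p : E × ℝ | h p.1 ≤ (p.2 : EReal)}) (hlsc : LowerSemicontinuous h)
    (hdom : ∃ v, h v ≠ ⊤) {u : E} {r : ℝ} (hr : (r : EReal) < h u) :
    ∃ (f : StrongDual ℝ E) (κ α : ℝ), 0 ≤ κ ∧ f u + κ * r < α ∧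
      ∀ v (t : ℝ), h v ≤ t → α < f v + κ * t := by
  have hclosed : IsClosed {p : E × ℝ | h p.1 ≤ (p.2 : EReal)} :=
    hlsc.isClosed_epigraph.preimage
      (continuous_fst.prodMk (continuous_coe_real_ereal.comp continuous_snd))
  obtain ⟨F, α, h1, h2⟩ := geometric_hahn_banach_point_closed hconv hclosed (x := (u, r))
    (by simpa using hr)
  have hF : ∀ v t, F (v, t) = F (v, 0) + F (0, 1) * t := by
    intro v t
    have : ((v, t) : E × ℝ) = (v, 0) + t • (0, 1) := by simp
    rw [this, map_add, map_smul, smul_eq_mul, mul_comm]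
  refine ⟨F.comp (ContinuousLinearMap.inl ℝ E ℝ), F (0, 1), α, ?_, ?_, ?_⟩
  · obtain ⟨v, hv⟩ := hdom
    by_contra hneg
    push Not at hneg
    have hle : h v ≤ ((h v).toReal : EReal) := EReal.le_coe_toReal hv
    have key : ∀ n : ℕ, α < F (v, 0) + F (0, 1) * ((h v).toReal + n) := fun n => by
      rw [← hF]
      refine h2 _ (hle.trans ?_)
      exact EReal.coe_le_coe_iff.2 (by simp)
    obtain ⟨n, hn⟩ := exists_nat_gt ((F (v, 0) + F (0, 1) * (h v).toReal - α) / (-F (0, 1)))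
    rw [div_lt_iff₀ (by linarith)] at hn
    have := key n
    linarith
  · simpa [← hF] using h1
  · intro v t hvt
    simpa [← hF] using h2 (v, t) hvt

/-- A proper lower semicontinuous convex function is the supremum of its continuous affine
minorants. -/
lemma exists_affine_minorant {h : E → EReal}
    (hconv : Convex ℝ {p : E × ℝ | h p.1 ≤ (p.2 : EReal)}) (hlsc : LowerSemicontinuous h)
    (hbot : ∀ v, h v ≠ ⊥) (hdom : ∃ v, h v ≠ ⊤) {u : E} {r : ℝ} (hr : (r : EReal) < h u) :
    ∃ (f : StrongDual ℝ E) (β : ℝ), (∀ v, ((f v - β : ℝ) : EReal) ≤ h v) ∧ r < f u - β := by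
  have nonvert : ∀ (f : StrongDual ℝ E) (κ α : ℝ) (u : E) (r : ℝ), 0 < κ → f u + κ * r < α →
      (∀ v (t : ℝ), h v ≤ t → α < f v + κ * t) →
      ∃ (f : StrongDual ℝ E) (β : ℝ), (∀ v, ((f v - β : ℝ) : EReal) ≤ h v) ∧ r < f u - β := by
    intro f κ α u r hκ h1 h2
    refine ⟨(-κ⁻¹) • f, -(κ⁻¹ * α), fun v => ?_, ?_⟩
    · by_cases hv : h v = ⊤
      · simp [hv]
      have := h2 v (h v).toReal (EReal.le_coe_toReal hv)
      rw [← EReal.coe_toReal hv (hbot v)]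
      refine EReal.coe_le_coe_iff.2 ?_
      have h3 : κ⁻¹ * α ≤ κ⁻¹ * (f v + κ * (h v).toReal) :=
        mul_le_mul_of_nonneg_left this.le (by positivity)
      rw [mul_add, inv_mul_cancel_left₀ hκ.ne'] at h3
      simp only [FunLike.coe_smul, Pi.smul_apply, smul_eq_mul]
      linarith
    · have h3 : κ⁻¹ * (f u + κ * r) < κ⁻¹ * α := mul_lt_mul_of_pos_left h1 (by positivity)
      rw [mul_add, inv_mul_cancel_left₀ hκ.ne'] at h3
      simp only [FunLike.coe_smul, Pi.smul_apply, smul_eq_mul]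
      linarith
  obtain ⟨f, κ, α, hκ, h1, h2⟩ := exists_separating_epigraph hconv hlsc hdom hr
  rcases hκ.lt_or_eq with hκ | rfl
  · exact nonvert f κ α u r hκ h1 h2
  obtain ⟨w, hw⟩ := hdom
  have hw' : (((h w).toReal - 1 : ℝ) : EReal) < h w := by
    conv_rhs => rw [← EReal.coe_toReal hw (hbot w)]
    exact EReal.coe_lt_coe_iff.2 (by linarith)
  obtain ⟨g, β, hg⟩ : ∃ (f : StrongDual ℝ E) (β : ℝ), ∀ v, ((f v - β : ℝ) : EReal) ≤ h v := by
    obtain ⟨f', κ', α', hκ', h1', h2'⟩ := exists_separating_epigraph hconv hlsc ⟨w, hw⟩ hw'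
    rcases hκ'.lt_or_eq with hκ' | rfl
    · obtain ⟨f, β, h, -⟩ := nonvert f' κ' α' w _ hκ' h1' h2'
      exact ⟨f, β, h⟩
    · have := h2' w _ (EReal.le_coe_toReal hw)
      linarith
  simp only [zero_mul, add_zero] at h1 h2
  obtain ⟨N, hN⟩ := exists_nat_gt ((r - (g u - β)) / (α - f u))
  rw [div_lt_iff₀ (by linarith)] at hN
  refine ⟨g - (N : ℝ) • f, β - N * α, fun v => ?_, ?_⟩
  · by_cases hv : h v = ⊤
    · simp [hv]
    refine le_trans (EReal.coe_le_coe_iff.2 ?_) (hg v)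
    have := h2 v _ (EReal.le_coe_toReal hv)
    have h3 : (N : ℝ) * α ≤ N * f v := mul_le_mul_of_nonneg_left this.le (by positivity)
    simp only [FunLike.coe_sub, FunLike.coe_smul, Pi.sub_apply, Pi.smul_apply,
      smul_eq_mul]
    linarith
  · simp only [FunLike.coe_sub, FunLike.coe_smul, Pi.sub_apply, Pi.smul_apply,
      smul_eq_mul]
    linarith

end FenchelMoreau

/-- In the weak topology of a bilinear form, the affine minorants are those given by the form. -/
lemma LinearMap.exists_affine_minorant {E F : Type*} [AddCommGroup E] [Module ℝ E] [AddCommGroup F]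
    [Module ℝ F] (B : E →ₗ[ℝ] F →ₗ[ℝ] ℝ) {h : E → EReal}
    (hconv : Convex ℝ {p : E × ℝ | h p.1 ≤ (p.2 : EReal)})
    (hlsc : @LowerSemicontinuous E EReal
      (TopologicalSpace.induced (fun x y => B x y) Pi.topologicalSpace) _ h)
    (hbot : ∀ v, h v ≠ ⊥) (hdom : ∃ v, h v ≠ ⊤) {u : E} {r : ℝ} (hr : (r : EReal) < h u) :
    ∃ (y : F) (β : ℝ), (∀ v, ((B v y - β : ℝ) : EReal) ≤ h v) ∧ r < B u y - β := by
  let τ : TopologicalSpace E := TopologicalSpace.induced (fun x y => B x y) Pi.topologicalSpace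
  have i1 : IsTopologicalAddGroup E := WeakBilin.instIsTopologicalAddGroup B
  have i2 : ContinuousSMul ℝ E := WeakBilin.instContinuousSMul B
  have i3 : LocallyConvexSpace ℝ E := WeakBilin.locallyConvexSpace (B := B)
  obtain ⟨f, β, h1, h2⟩ := _root_.exists_affine_minorant hconv hlsc hbot hdom hr
  obtain ⟨y, hy⟩ := LinearMap.dualEmbedding_surjective B f
  have hf : ∀ v, f v = B v y := fun v => (DFunLike.congr_fun hy v).symm
  exact ⟨y, β, fun v => hf v ▸ h1 v, hf u ▸ h2⟩

section Closure

variable {Ω : Type*} {mΩ : MeasurableSpace Ω} {P : Measure Ω} {𝓤 𝓨 : Submodule ℝ (Ω → ℝ)}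

/-- The bilinear form `⟨u,y⟩ = E(uy)` on `𝓤 × 𝓨`. -/
noncomputable def pairingForm
    (hpair : ∀ u ∈ 𝓤, ∀ y ∈ 𝓨, Integrable (fun ω => u ω * y ω) P) : 𝓤 →ₗ[ℝ] 𝓨 →ₗ[ℝ] ℝ :=
  LinearMap.mk₂ ℝ (fun u y => ∫ ω, u.1 ω * y.1 ω ∂P)
    (fun u v y => by
      rw [← integral_add (hpair u u.2 y y.2) (hpair v v.2 y y.2)]
      simp [add_mul])
    (fun a u y => by
      rw [smul_eq_mul, ← integral_const_mul]
      simp [mul_assoc])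
    (fun u y z => by
      rw [← integral_add (hpair u u.2 y y.2) (hpair u u.2 z z.2)]
      simp [mul_add])
    (fun a u y => by
      rw [smul_eq_mul, ← integral_const_mul]
      simp [mul_left_comm])

lemma biconjU_le (g : 𝓤 → EReal) (u : 𝓤) : biconjU P 𝓤 𝓨 g u ≤ g u :=
  iSup_le fun y => EReal.coe_sub_le_of_coe_sub_le
    (le_iSup (fun u : 𝓤 => (((∫ ω, u.1 ω * y.1 ω ∂P : ℝ) : EReal) - g u)) u)

lemma convex_epigraph_biconjU
    (hpair : ∀ u ∈ 𝓤, ∀ y ∈ 𝓨, Integrable (fun ω => u ω * y ω) P) (g : 𝓤 → EReal) :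
    Convex ℝ {p : 𝓤 × ℝ | biconjU P 𝓤 𝓨 g p.1 ≤ (p.2 : EReal)} := by
  have : {p : 𝓤 × ℝ | biconjU P 𝓤 𝓨 g p.1 ≤ (p.2 : EReal)} =
      ⋂ y : 𝓨, {p : 𝓤 × ℝ | ((pairingForm hpair p.1 y : ℝ) : EReal) - conjU P 𝓤 g y.1 ≤ p.2} := by
    ext p
    simp [biconjU, iSup_le_iff, pairingForm]
  rw [this]
  refine convex_iInter fun y => ?_
  induction conjU P 𝓤 g y.1 with
  | bot =>
    simp only [EReal.coe_sub_bot, top_le_iff, EReal.coe_ne_top, Set.ofPred_false]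
    exact convex_empty
  | top =>
    simp only [EReal.sub_top, bot_le, Set.ofPred_true]
    exact convex_univ
  | coe c =>
    intro p hp q hq a b ha hb hab
    simp only [Set.mem_ofPred_eq, ← EReal.coe_sub, EReal.coe_le_coe_iff] at hp hq ⊢
    simp only [Prod.fst_add, Prod.smul_fst, Prod.snd_add, Prod.smul_snd, map_add, map_smul,
      LinearMap.add_apply, LinearMap.smul_apply, smul_eq_mul]
    have h1 := mul_le_mul_of_nonneg_left hp ha
    have h2 := mul_le_mul_of_nonneg_left hq hb
    have h3 : c = a * c + b * c := by rw [← add_mul, hab, one_mul]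
    rw [h3]
    linarith

lemma lowerSemicontinuous_biconjU (g : 𝓤 → EReal) :
    @LowerSemicontinuous 𝓤 EReal (weakTop P 𝓤 𝓨) _ (biconjU P 𝓤 𝓨 g) := by
  let _ : TopologicalSpace 𝓤 := weakTop P 𝓤 𝓨
  refine lowerSemicontinuous_iSup fun y => ?_
  have hcont : Continuous fun u : 𝓤 => ∫ ω, u.1 ω * y.1 ω ∂P :=
    (continuous_apply y).comp
      (continuous_induced_dom (f := fun (u : 𝓤) (y : 𝓨) => ∫ ω, u.1 ω * y.1 ω ∂P))
  induction conjU P 𝓤 g y.1 with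
  | bot =>
    simp only [EReal.coe_sub_bot]
    exact lowerSemicontinuous_const
  | top =>
    simp only [EReal.sub_top]
    exact lowerSemicontinuous_const
  | coe c =>
    simp only [← EReal.coe_sub]
    exact (continuous_coe_real_ereal.comp (hcont.sub continuous_const)).lowerSemicontinuous

lemma isClosedConvexFun_biconjU
    (hpair : ∀ u ∈ 𝓤, ∀ y ∈ 𝓨, Integrable (fun ω => u ω * y ω) P) (g : 𝓤 → EReal) :
    IsClosedConvexFun P 𝓤 𝓨 (biconjU P 𝓤 𝓨 g) := by
  refine ⟨convex_epigraph_biconjU hpair g, lowerSemicontinuous_biconjU g, ?_⟩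
  by_cases htop : ∀ u, biconjU P 𝓤 𝓨 g u = ⊤
  · exact Or.inr ⟨⊤, htop⟩
  push Not at htop
  by_cases hconj : ∀ y : 𝓨, conjU P 𝓤 g y.1 = ⊤
  · exact Or.inr ⟨⊥, fun u => by simp [biconjU, hconj]⟩
  push Not at hconj
  refine Or.inl ⟨fun u hu => ?_, htop⟩
  obtain ⟨y, hy⟩ := hconj
  have h1 : ((∫ ω, u.1 ω * y.1 ω ∂P : ℝ) : EReal) - conjU P 𝓤 g y.1 ≤ ⊥ :=
    hu ▸ le_iSup (fun y : 𝓨 => (((∫ ω, u.1 ω * y.1 ω ∂P : ℝ) : EReal) - conjU P 𝓤 g y.1)) y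
  induction hc : conjU P 𝓤 g y.1 <;> simp_all [← EReal.coe_sub]

lemma le_biconjU_of_isClosedConvexFun
    (hpair : ∀ u ∈ 𝓤, ∀ y ∈ 𝓨, Integrable (fun ω => u ω * y ω) P) {g h : 𝓤 → EReal}
    (hh : IsClosedConvexFun P 𝓤 𝓨 h) (hle : ∀ v, h v ≤ g v) (u : 𝓤) :
    h u ≤ biconjU P 𝓤 𝓨 g u := by
  have key : ∀ (y : 𝓨) (β : ℝ), (∀ v : 𝓤, ((∫ ω, v.1 ω * y.1 ω ∂P - β : ℝ) : EReal) ≤ h v) →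
      ((∫ ω, u.1 ω * y.1 ω ∂P - β : ℝ) : EReal) ≤ biconjU P 𝓤 𝓨 g u := by
    intro y β hβ
    have hc : conjU P 𝓤 g y.1 ≤ β := iSup_le fun v =>
      EReal.coe_sub_le_of_coe_sub_le (by rw [← EReal.coe_sub]; exact (hβ v).trans (hle v))
    rw [EReal.coe_sub]
    exact (EReal.sub_le_sub le_rfl hc).trans
      (le_iSup (fun y : 𝓨 => (((∫ ω, u.1 ω * y.1 ω ∂P : ℝ) : EReal) - conjU P 𝓤 g y.1)) y)
  obtain ⟨hconv, hlsc, ⟨hbot, hdom⟩ | ⟨c, hc⟩⟩ := hh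
  · refine EReal.ge_of_forall_gt_iff_ge.1 fun r hr => ?_
    obtain ⟨y, β, h1, h2⟩ := (pairingForm hpair).exists_affine_minorant hconv hlsc hbot hdom hr
    exact (EReal.coe_le_coe_iff.2 h2.le).trans (key y β h1)
  · rw [hc u]
    refine EReal.ge_of_forall_gt_iff_ge.1 fun r hr => ?_
    simpa using key 0 (-r) fun v => by simpa [hc v] using hr.le

lemma clU_eq_biconjU
    (hpair : ∀ u ∈ 𝓤, ∀ y ∈ 𝓨, Integrable (fun ω => u ω * y ω) P) (g : 𝓤 → EReal) (u : 𝓤) :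
    clU P 𝓤 𝓨 g u = biconjU P 𝓤 𝓨 g u :=
  le_antisymm (iSup₂_le fun _ hh => le_biconjU_of_isClosedConvexFun hpair hh.1 hh.2 u)
    (le_iSup₂_of_le (biconjU P 𝓤 𝓨 g) ⟨isClosedConvexFun_biconjU hpair g, biconjU_le g⟩ le_rfl)

end Closure

section Gains

variable {Ω : Type*} {mΩ : MeasurableSpace Ω} {P : Measure Ω} {T d : ℕ}
  {ℱ : Filtration (Fin (T + 1)) mΩ} {s : Fin (T + 1) → Ω → (Fin d → ℝ)}

lemma measurable_gains (hs : ∀ t, Measurable[ℱ t] (s t)) {x : Fin T → Ω → (Fin d → ℝ)}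
    (hx : x ∈ Strat d ℱ) : Measurable (gains s x) := by
  have hs' : ∀ t, Measurable (s t) := fun t => (hs t).mono (ℱ.le t) le_rfl
  have hx' : ∀ t, Measurable (x t) := fun t => (hx t).mono (ℱ.le _) le_rfl
  unfold gains dotProduct
  refine Finset.measurable_fun_sum _ fun t _ => Finset.measurable_fun_sum _ fun i _ => ?_
  exact ((measurable_pi_apply i).comp (hx' t)).mul
    ((measurable_pi_apply i).comp ((hs' _).sub (hs' _)))

lemma gains_smul (r : ℝ) (x : Fin T → Ω → (Fin d → ℝ)) (ω : Ω) :
    gains s (r • x) ω = r * gains s x ω := by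
  simp only [gains, Finset.mul_sum, Pi.smul_apply, smul_dotProduct, smul_eq_mul]

lemma zero_mem_Strat : (0 : Fin T → Ω → (Fin d → ℝ)) ∈ Strat d ℱ := fun _ =>
  @measurable_const _ _ _ (ℱ _) _

lemma smul_mem_StratBdd (r : ℝ) {x : Fin T → Ω → (Fin d → ℝ)} (hx : x ∈ StratBdd d ℱ P) :
    r • x ∈ StratBdd d ℱ P := by
  obtain ⟨hm, M, hM⟩ := hx
  refine ⟨fun t => (measurable_const_smul r).comp (hm t), |r| * M, ?_⟩
  filter_upwards [hM] with ω hω t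
  simp only [Pi.smul_apply, norm_smul, Real.norm_eq_abs]
  exact mul_le_mul_of_nonneg_left (hω t) (abs_nonneg r)

/-- The increments of `f` between times `i` and `j` telescope. -/
lemma sum_increments_between (f : Fin (T + 1) → ℝ) {i j : Fin (T + 1)} (hij : i ≤ j) :
    ∑ t : Fin T, (if i ≤ t.castSucc ∧ t.castSucc < j then f t.succ - f t.castSucc else 0) =
      f j - f i := by
  let F : ℕ → ℝ := fun n => f ⟨min (max n i) j, by omega⟩
  have hF : ∀ t : Fin T,
      (if i ≤ t.castSucc ∧ t.castSucc < j then f t.succ - f t.castSucc else 0) =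
        F (t + 1) - F t := by
    intro t
    have e : ∀ (n : ℕ) (k : Fin (T + 1)), min (max n i) j = k → F n = f k :=
      fun n k h => congrArg f (Fin.ext h)
    rw [Fin.le_def] at hij
    simp only [Fin.le_def, Fin.lt_def, Fin.val_castSucc]
    split_ifs with h
    · rw [e (t + 1) t.succ (by simp; omega), e t t.castSucc (by simp; omega)]
    · by_cases h' : (i : ℕ) ≤ t
      · rw [e (t + 1) j (by omega), e t j (by omega), sub_self]
      · rw [e (t + 1) i (by omega), e t i (by omega), sub_self]
  simp_rw [hF]
  rw [Fin.sum_univ_eq_sum_range (fun n => F (n + 1) - F n), Finset.sum_range_sub]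
  have hij' : (i : ℕ) ≤ j := hij
  have h1 : F T = f j := congrArg f (Fin.ext (by simp; omega))
  have h0 : F 0 = f i := congrArg f (Fin.ext (by simp; omega))
  rw [h1, h0]

/-- Buying one unit of the asset `k` on the event `A` at time `i` and selling it at time `j`. -/
lemma exists_buyAndHold {i j : Fin (T + 1)} (hij : i ≤ j) {A : Set Ω} (hA : MeasurableSet[ℱ i] A)
    (k : Fin d) : ∃ x ∈ StratBdd d ℱ P, ∀ ω, gains s x ω = A.indicator
      (fun ω => s j ω k - s i ω k) ω := by
  classical
  refine ⟨fun t ω => if i ≤ t.castSucc ∧ t.castSucc < j then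
    A.indicator (fun _ => Pi.single k (1 : ℝ)) ω else 0, ⟨fun t => ?_, 1, ae_of_all _ fun ω t => ?_⟩,
    fun ω => ?_⟩
  · by_cases h : i ≤ t.castSucc ∧ t.castSucc < j
    · simp only [if_pos h]
      exact (@measurable_const _ _ _ (ℱ t.castSucc) _).indicator (ℱ.mono h.1 _ hA)
    · simp only [if_neg h]
      exact @measurable_const _ _ _ (ℱ t.castSucc) _
  · by_cases h : i ≤ t.castSucc ∧ t.castSucc < j
    · simp only [if_pos h]
      refine (norm_indicator_le_norm_self _ _).trans
        ((pi_norm_le_iff_of_nonneg zero_le_one).2 fun l => ?_)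
      by_cases hl : l = k
      · subst hl; simp
      · simp [Pi.single_eq_of_ne hl]
    · simp [h]
  · by_cases hω : ω ∈ A
    · simp only [gains, hω, Set.indicator_of_mem]
      rw [← sum_increments_between (fun t => s t ω k) hij]
      refine Finset.sum_congr rfl fun t _ => ?_
      split_ifs <;> simp
    · simp [gains, hω]

end Gains

section LowerBound

variable {Ω : Type*} {mΩ : MeasurableSpace Ω} {P : Measure Ω} {V : ℝ → Ω → EReal} {T d : ℕ}
  {ℱ : Filtration (Fin (T + 1)) mΩ} {s : Fin (T + 1) → Ω → (Fin d → ℝ)}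
  {𝓤 : Submodule ℝ (Ω → ℝ)} {y : Ω → ℝ}

lemma mem_of_bounded (h𝓤dec : DecomposableR P 𝓤) {u : Ω → ℝ} (hu : Measurable u) {M : ℝ}
    (hM : ∀ ω, |u ω| ≤ M) : u ∈ 𝓤 := by
  have := h𝓤dec ∅ MeasurableSet.empty 0 𝓤.zero_mem u hu ⟨M, ae_of_all _ hM⟩
  simpa using this

lemma sub_objALM_le_conjU {x : Fin T → Ω → (Fin d → ℝ)} (hx : x ∈ Strat d ℱ) (u : 𝓤) :
    ((∫ ω, u.1 ω * y ω ∂P : ℝ) : EReal) - objALM P V s x u.1 ≤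
      conjU P 𝓤 (fun v => phiALM P ℱ V s v.1) y :=
  (EReal.sub_le_sub le_rfl (iInf₂_le x hx)).trans
    (le_iSup (fun u : 𝓤 => ((∫ ω, u.1 ω * y ω ∂P : ℝ) : EReal) - phiALM P ℱ V s u.1) u)

lemma lintegral_Vconj_le_conjU (hV_meas : Measurable (fun p : ℝ × Ω => V p.1 p.2))
    (hV_bot : ∀ ω, ∀ c, V c ω ≠ ⊥)
    (hV_mono : ∀ ω, ∀ c c' : ℝ, c ≤ c' → V c ω ≤ V c' ω) (hV_zero : ∀ ω, V 0 ω = 0)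
    (h𝓤dec : DecomposableR P 𝓤) (hy : Measurable y)
    (hpair : ∀ u ∈ 𝓤, Integrable (fun ω => u ω * y ω) P) :
    ((∫⁻ ω, (Vconj V (y ω) ω).toENNReal ∂P : ℝ≥0∞) : EReal) ≤
      conjU P 𝓤 (fun v => phiALM P ℱ V s v.1) y := by
  obtain ⟨c, hcm, hcb, hc0, hcmono, hcsup⟩ := exists_bounded_selections hV_meas hV_mono hV_zero hy
  let F : ℕ → Ω → EReal := fun n ω => ((c n ω * y ω : ℝ) : EReal) - V (c n ω) ω
  have hFm : ∀ n, Measurable (F n) := fun n =>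
    ((hcm n).mul hy).coe_real_ereal.sub (measurable_V_comp hV_meas (hcm n))
  have hsup : ∀ ω, (Vconj V (y ω) ω).toENNReal = ⨆ n, (F n ω).toENNReal := by
    intro ω
    refine le_antisymm ?_ (iSup_le fun n => EReal.toENNReal_le_toENNReal
      (le_iSup (fun c : ℝ => ((c * y ω : ℝ) : EReal) - V c ω) (c n ω)))
    rw [← EReal.coe_ennreal_le_coe_ennreal_iff, EReal.coe_toENNReal (Vconj_nonneg hV_zero _ _), hcsup]
    refine iSup_le fun n => ?_
    rw [← EReal.coe_toENNReal (hc0 n ω)]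
    exact EReal.coe_ennreal_le_coe_ennreal_iff.2 (le_iSup (fun n => (F n ω).toENNReal) n)
  simp_rw [hsup]
  rw [lintegral_iSup (fun n => (hFm n).ereal_toENNReal)
    fun i j hij ω => EReal.toENNReal_le_toENNReal (hcmono hij ω)]
  have hstep : ∀ n, ((∫⁻ ω, (F n ω).toENNReal ∂P : ℝ≥0∞) : EReal) ≤
      conjU P 𝓤 (fun v => phiALM P ℱ V s v.1) y := by
    intro n
    obtain ⟨M, hM⟩ := hcb n
    have hmem : c n ∈ 𝓤 := mem_of_bounded h𝓤dec (hcm n) hM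
    refine le_trans ?_ (sub_objALM_le_conjU (V := V) (s := s) zero_mem_Strat ⟨c n, hmem⟩)
    have hobj : objALM P V s 0 (c n) = EE P fun ω => ((c n ω * y ω : ℝ) : EReal) - F n ω := by
      unfold objALM
      congr 1
      funext ω
      have h1 := hV_bot ω (c n ω)
      have h2 := hc0 n ω
      simp only [gains, Pi.zero_apply, zero_dotProduct, Finset.sum_const_zero, sub_zero, F]
      induction hv : V (c n ω) ω with
      | bot => exact absurd hv h1
      | top => rw [hv, EReal.sub_top] at h2; simp at h2
      | coe v => rw [← EReal.coe_sub, ← EReal.coe_sub, sub_sub_cancel]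
    simp only
    rw [hobj, EE_coe_sub (hpair _ hmem) (hFm n) (hc0 n)]
    generalize ∫⁻ ω, (F n ω).toENNReal ∂P = K
    generalize ∫ ω, c n ω * y ω ∂P = a
    induction K with
    | top => simp
    | coe K =>
      have : ((K : ℝ≥0∞) : EReal) = ((K : ℝ) : EReal) := rfl
      rw [this, ← EReal.coe_sub, ← EReal.coe_sub, sub_sub_cancel]
  refine (EReal.coe_toENNReal (x := conjU P 𝓤 (fun v => phiALM P ℱ V s v.1) y)
    ((EReal.coe_ennreal_nonneg _).trans (hstep 0))) ▸ EReal.coe_ennreal_le_coe_ennreal_iff.2 ?_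
  refine iSup_le fun n => ?_
  rw [← EReal.coe_ennreal_le_coe_ennreal_iff,
    EReal.coe_toENNReal ((EReal.coe_ennreal_nonneg _).trans (hstep 0))]
  exact hstep n

lemma lintegral_neg_gains_mul_ne_top (hs : ∀ t, Measurable[ℱ t] (s t))
    (hV_meas : Measurable (fun p : ℝ × Ω => V p.1 p.2))
    (hV_mono : ∀ ω, ∀ c c' : ℝ, c ≤ c' → V c ω ≤ V c' ω) (hV_zero : ∀ ω, V 0 ω = 0)
    (hy : Measurable y) (hW : ∫⁻ ω, (Vconj V (y ω) ω).toENNReal ∂P ≠ ⊤)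
    {x : Fin T → Ω → (Fin d → ℝ)} (hx : x ∈ Strat d ℱ) {u : Ω → ℝ} (hum : Measurable u)
    (hu : Integrable (fun ω => u ω * y ω) P) (hobj : objALM P V s x u < ⊤) :
    ∫⁻ ω, ENNReal.ofReal (-(gains s x ω * y ω)) ∂P ≠ ⊤ := by
  have hVpos := lintegral_toENNReal_ne_top_of_EE_lt_top hobj
  have hg := measurable_gains hs hx
  have hle : ∀ ω, ENNReal.ofReal (-(gains s x ω * y ω)) ≤ (V (u ω - gains s x ω) ω).toENNReal +
      ((Vconj V (y ω) ω).toENNReal + ENNReal.ofReal (-(u ω * y ω))) := by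
    intro ω
    have h0 := Vconj_nonneg hV_zero (y ω) ω
    have h1 := coe_mul_sub_Vconj_le (V := V) (u ω - gains s x ω) (y ω) ω
    induction hw : Vconj V (y ω) ω with
    | bot => simp [hw] at h0
    | top => simp
    | coe w =>
      rw [hw, ← EReal.coe_sub] at h1
      induction hv : V (u ω - gains s x ω) ω with
      | bot => exact absurd (hv ▸ h1) (by simp [-EReal.coe_sub, -EReal.coe_mul])
      | top => simp
      | coe v =>
        rw [hv, EReal.coe_le_coe_iff] at h1
        simp only [EReal.real_coe_toENNReal]
        have h2 : -(gains s x ω * y ω) ≤ v + (w + -(u ω * y ω)) := by linarith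
        refine (ENNReal.ofReal_le_ofReal h2).trans (ENNReal.ofReal_add_le.trans ?_)
        gcongr
        exact ENNReal.ofReal_add_le
  refine ne_top_of_le_ne_top ?_ (lintegral_mono hle)
  have hVm : Measurable fun ω => V (u ω - gains s x ω) ω := measurable_V_comp hV_meas (hum.sub hg)
  rw [lintegral_add_left hVm.ereal_toENNReal,
    lintegral_add_left (measurable_Vconj hV_meas hV_mono hy).ereal_toENNReal]
  have h3 : ∫⁻ ω, ENNReal.ofReal (-(u ω * y ω)) ∂P ≠ ⊤ := hu.neg.lintegral_lt_top.ne
  exact ENNReal.add_ne_top.2 ⟨hVpos, ENNReal.add_ne_top.2 ⟨hW, h3⟩⟩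

lemma integrable_gains_mul (hs : ∀ t, Measurable[ℱ t] (s t))
    (hV_meas : Measurable (fun p : ℝ × Ω => V p.1 p.2))
    (hV_mono : ∀ ω, ∀ c c' : ℝ, c ≤ c' → V c ω ≤ V c' ω) (hV_zero : ∀ ω, V 0 ω = 0)
    (h𝓤meas : ∀ u ∈ 𝓤, Measurable u)
    (hfin : ∀ x ∈ StratBdd d ℱ P, ∃ u ∈ 𝓤, objALM P V s x u < ⊤)
    (hy : Measurable y) (hpair : ∀ u ∈ 𝓤, Integrable (fun ω => u ω * y ω) P)
    (hW : ∫⁻ ω, (Vconj V (y ω) ω).toENNReal ∂P ≠ ⊤)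
    {x : Fin T → Ω → (Fin d → ℝ)} (hx : x ∈ StratBdd d ℱ P) :
    Integrable (fun ω => gains s x ω * y ω) P := by
  have key : ∀ x ∈ StratBdd d ℱ P, ∫⁻ ω, ENNReal.ofReal (-(gains s x ω * y ω)) ∂P ≠ ⊤ := by
    intro x hx
    obtain ⟨u, hu, hobj⟩ := hfin x hx
    exact lintegral_neg_gains_mul_ne_top hs hV_meas hV_mono hV_zero hy hW hx.1 (h𝓤meas u hu)
      (hpair u hu) hobj
  refine integrable_of_lintegral_ofReal_ne_top
    ((measurable_gains hs hx.1).mul hy).aestronglyMeasurable ?_ (key x hx)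
  have := key _ (smul_mem_StratBdd (-1) hx)
  simp_rw [gains_smul] at this
  simpa using this

/-- The integrand `V(u - g)` is bounded below by an integrable function, so that its expectation is
an ordinary integral when it is not `+∞`. -/
lemma objALM_eq_integral (hs : ∀ t, Measurable[ℱ t] (s t))
    (hV_meas : Measurable (fun p : ℝ × Ω => V p.1 p.2))
    (hV_mono : ∀ ω, ∀ c c' : ℝ, c ≤ c' → V c ω ≤ V c' ω) (hV_zero : ∀ ω, V 0 ω = 0)
    (hy : Measurable y) (hW : ∫⁻ ω, (Vconj V (y ω) ω).toENNReal ∂P ≠ ⊤)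
    {x : Fin T → Ω → (Fin d → ℝ)} (hx : x ∈ Strat d ℱ) {u : Ω → ℝ} (hum : Measurable u)
    (hu : Integrable (fun ω => u ω * y ω) P)
    (hg : Integrable (fun ω => gains s x ω * y ω) P) (hobj : objALM P V s x u < ⊤) :
    Integrable (fun ω => (V (u ω - gains s x ω) ω).toReal) P ∧
      (∀ᵐ ω ∂P, V (u ω - gains s x ω) ω = ((V (u ω - gains s x ω) ω).toReal : EReal)) ∧
      objALM P V s x u = (∫ ω, (V (u ω - gains s x ω) ω).toReal ∂P : ℝ) ∧
      ∫ ω, u ω * y ω ∂P - ∫ ω, gains s x ω * y ω ∂P - ∫ ω, (Vconj V (y ω) ω).toReal ∂P ≤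
        ∫ ω, (V (u ω - gains s x ω) ω).toReal ∂P := by
  obtain ⟨w1, w2, -⟩ := integrable_toReal_of_lintegral_toENNReal_ne_top
    (measurable_Vconj hV_meas hV_mono hy) (fun ω => Vconj_nonneg hV_zero (y ω) ω) hW
  have hug : Integrable (fun ω => u ω * y ω - gains s x ω * y ω) P := hu.sub hg
  have hl : Integrable (fun ω => u ω * y ω - gains s x ω * y ω - (Vconj V (y ω) ω).toReal) P :=
    hug.sub w1
  have hle : ∀ᵐ ω ∂P, ((u ω * y ω - gains s x ω * y ω - (Vconj V (y ω) ω).toReal : ℝ) : EReal) ≤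
      V (u ω - gains s x ω) ω := by
    filter_upwards [w2] with ω hω
    have h1 := coe_mul_sub_Vconj_le (V := V) (u ω - gains s x ω) (y ω) ω
    rwa [hω, ← EReal.coe_sub, sub_mul] at h1
  have hVm : Measurable fun ω => V (u ω - gains s x ω) ω :=
    measurable_V_comp hV_meas (hum.sub (measurable_gains hs hx))
  obtain ⟨v1, v2, v3⟩ := EE_of_coe_le hVm hl hle hobj
  refine ⟨v1, v2, v3, ?_⟩
  rw [← integral_sub hu hg, ← integral_sub hug w1]
  refine integral_mono_ae hl v1 ?_
  filter_upwards [hle, v2] with ω h1 h2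
  rw [h2, EReal.coe_le_coe_iff] at h1
  exact h1

lemma integral_gains_mul_le_conjU (hs : ∀ t, Measurable[ℱ t] (s t))
    (hV_meas : Measurable (fun p : ℝ × Ω => V p.1 p.2))
    (hV_mono : ∀ ω, ∀ c c' : ℝ, c ≤ c' → V c ω ≤ V c' ω) (hV_zero : ∀ ω, V 0 ω = 0)
    (h𝓤meas : ∀ u ∈ 𝓤, Measurable u) (h𝓤dec : DecomposableR P 𝓤)
    (hfin : ∀ x ∈ StratBdd d ℱ P, ∃ u ∈ 𝓤, objALM P V s x u < ⊤)
    (hy : Measurable y) (hpair : ∀ u ∈ 𝓤, Integrable (fun ω => u ω * y ω) P)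
    (hW : ∫⁻ ω, (Vconj V (y ω) ω).toENNReal ∂P ≠ ⊤)
    {x : Fin T → Ω → (Fin d → ℝ)} (hx : x ∈ StratBdd d ℱ P) :
    ((∫ ω, gains s x ω * y ω ∂P : ℝ) : EReal) ≤ conjU P 𝓤 (fun v => phiALM P ℱ V s v.1) y := by
  have hgm := measurable_gains hs hx.1
  have hgy := integrable_gains_mul hs hV_meas hV_mono hV_zero h𝓤meas hfin hy hpair hW hx
  obtain ⟨u, hu, hobj⟩ := hfin x hx
  obtain ⟨v1, v2, -, -⟩ := objALM_eq_integral hs hV_meas hV_mono hV_zero hy hW hx.1 (h𝓤meas u hu)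
    (hpair u hu) hgy hobj
  set g := gains s x with hg
  set v : Ω → ℝ := fun ω => (V (u ω - g ω) ω).toReal with hv
  let A : ℕ → Set Ω := fun n => {ω | (n : ℝ) < |g ω|}
  have hA : ∀ n, MeasurableSet (A n) := fun n => measurableSet_lt measurable_const hgm.abs
  let w : ℕ → Ω → ℝ := fun n ω => (A n).indicator u ω + (A n)ᶜ.indicator ((A n)ᶜ.indicator g) ω
  have hw : ∀ n, w n ∈ 𝓤 := by
    intro n
    refine h𝓤dec (A n) (hA n) u hu _ (hgm.indicator (hA n).compl) ⟨n, ae_of_all _ fun ω => ?_⟩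
    by_cases hω : ω ∈ A n
    · simp [hω]
    · have : |g ω| ≤ n := not_lt.1 hω
      simpa [hω] using this
  have hVw : ∀ n, (fun ω => V (w n ω - g ω) ω) =ᵐ[P] fun ω => (((A n).indicator v ω : ℝ) : EReal) := by
    intro n
    filter_upwards [v2] with ω hω
    by_cases h : ω ∈ A n
    · simp only [w, h, Set.indicator_of_mem, Set.mem_compl_iff, not_true_eq_false,
        not_false_eq_true, Set.indicator_of_notMem, add_zero]
      exact hω
    · simp [w, h, hV_zero]
  have hbound : ∀ n, ((∫ ω, (w n ω * y ω - (A n).indicator v ω) ∂P : ℝ) : EReal) ≤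
      conjU P 𝓤 (fun v => phiALM P ℱ V s v.1) y := by
    intro n
    refine le_trans (le_of_eq ?_) (sub_objALM_le_conjU (V := V) (s := s) hx.1 ⟨w n, hw n⟩)
    have : objALM P V s x (w n) = (∫ ω, (A n).indicator v ω ∂P : ℝ) := by
      rw [← EE_coe (v1.indicator (hA n))]
      exact EE_congr (hVw n)
    simp only
    rw [this, ← EReal.coe_sub, integral_sub (hpair _ (hw n)) (v1.indicator (hA n))]
  have hlim : Filter.Tendsto (fun n => ∫ ω, (w n ω * y ω - (A n).indicator v ω) ∂P) Filter.atTop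
      (nhds (∫ ω, g ω * y ω ∂P)) := by
    refine tendsto_integral_of_dominated_convergence
      (fun ω => |g ω * y ω| + |u ω * y ω| + |v ω|)
      (fun n => ((hpair _ (hw n)).sub (v1.indicator (hA n))).aestronglyMeasurable)
      ((hgy.abs.add (hpair u hu).abs).add v1.abs) (fun n => ae_of_all _ fun ω => ?_)
      (ae_of_all _ fun ω => ?_)
    · have h1 := abs_nonneg (g ω * y ω)
      have h2 := abs_nonneg (u ω * y ω)
      have h3 := abs_nonneg (v ω)
      by_cases h : ω ∈ A n
      · have := abs_sub (u ω * y ω) (v ω)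
        simp only [w, h, Set.indicator_of_mem, Set.mem_compl_iff, not_true_eq_false,
          not_false_eq_true, Set.indicator_of_notMem, add_zero, Real.norm_eq_abs]
        linarith
      · simp only [w, h, Set.indicator_of_mem, Set.mem_compl_iff, not_false_eq_true,
          Set.indicator_of_notMem, zero_add, sub_zero, Real.norm_eq_abs]
        linarith
    · obtain ⟨N, hN⟩ := exists_nat_ge |g ω|
      refine tendsto_const_nhds.congr' ?_
      filter_upwards [Filter.eventually_ge_atTop N] with n hn
      have h : ω ∉ A n := not_lt.2 (hN.trans (by exact_mod_cast hn))
      simp [w, h]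
  exact le_of_tendsto ((continuous_coe_real_ereal.tendsto _).comp hlim)
    (Filter.Eventually.of_forall hbound)

lemma integral_gains_mul_eq_zero (hs : ∀ t, Measurable[ℱ t] (s t))
    (hV_meas : Measurable (fun p : ℝ × Ω => V p.1 p.2))
    (hV_mono : ∀ ω, ∀ c c' : ℝ, c ≤ c' → V c ω ≤ V c' ω) (hV_zero : ∀ ω, V 0 ω = 0)
    (h𝓤meas : ∀ u ∈ 𝓤, Measurable u) (h𝓤dec : DecomposableR P 𝓤)
    (hfin : ∀ x ∈ StratBdd d ℱ P, ∃ u ∈ 𝓤, objALM P V s x u < ⊤)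
    (hy : Measurable y) (hpair : ∀ u ∈ 𝓤, Integrable (fun ω => u ω * y ω) P)
    (hW : ∫⁻ ω, (Vconj V (y ω) ω).toENNReal ∂P ≠ ⊤)
    (hconj : conjU P 𝓤 (fun v => phiALM P ℱ V s v.1) y ≠ ⊤)
    {x : Fin T → Ω → (Fin d → ℝ)} (hx : x ∈ StratBdd d ℱ P) :
    ∫ ω, gains s x ω * y ω ∂P = 0 := by
  have key : ∀ r : ℝ, r * ∫ ω, gains s x ω * y ω ∂P ≤
      (conjU P 𝓤 (fun v => phiALM P ℱ V s v.1) y).toReal := by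
    intro r
    have h := integral_gains_mul_le_conjU hs hV_meas hV_mono hV_zero h𝓤meas h𝓤dec hfin hy hpair hW
      (smul_mem_StratBdd r hx)
    simp_rw [gains_smul, mul_assoc] at h
    rw [integral_const_mul] at h
    exact EReal.coe_le_coe_iff.1 (h.trans (EReal.le_coe_toReal hconj))
  by_contra hne
  have := key (((conjU P 𝓤 (fun v => phiALM P ℱ V s v.1) y).toReal + 1) /
    ∫ ω, gains s x ω * y ω ∂P)
  rw [div_mul_cancel₀ _ hne] at this
  linarith

end LowerBound

section MartingaleDensities

variable {Ω : Type*} {mΩ : MeasurableSpace Ω} {P : Measure Ω} {V : ℝ → Ω → EReal} {T d : ℕ}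
  {ℱ : Filtration (Fin (T + 1)) mΩ} {s : Fin (T + 1) → Ω → (Fin d → ℝ)}
  {𝓤 𝓨 : Submodule ℝ (Ω → ℝ)} {y : Ω → ℝ}

lemma nonneg_of_Vconj_ne_top (hV_mono : ∀ ω, ∀ c c' : ℝ, c ≤ c' → V c ω ≤ V c' ω)
    (hV_zero : ∀ ω, V 0 ω = 0) {y : ℝ} {ω : Ω} (h : Vconj V y ω ≠ ⊤) : 0 ≤ y := by
  by_contra hy
  push Not at hy
  have h0 := Vconj_nonneg hV_zero y ω
  have hbound : ∀ c ≤ (0 : ℝ), c * y ≤ (Vconj V y ω).toReal := by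
    intro c hc
    have h1 : ((c * y : ℝ) : EReal) - 0 ≤ Vconj V y ω :=
      (EReal.sub_le_sub le_rfl (hV_zero ω ▸ hV_mono ω c 0 hc)).trans
        (le_iSup (fun c : ℝ => ((c * y : ℝ) : EReal) - V c ω) c)
    rw [sub_zero] at h1
    exact EReal.coe_le_coe_iff.1 (h1.trans (EReal.le_coe_toReal h))
  have hw : 0 ≤ (Vconj V y ω).toReal := EReal.toReal_nonneg h0
  have := hbound (((Vconj V y ω).toReal + 1) / y) (div_nonpos_of_nonneg_of_nonpos (by linarith) hy.le)
  rw [div_mul_cancel₀ _ hy.ne] at this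
  linarith

/-- A nonnegative `y` under which all bounded gains have zero mean is a multiple of a martingale
density. -/
lemma mem_Qset_of_integral_gains_mul_eq_zero [IsProbabilityMeasure P]
    (hs : ∀ t, Measurable[ℱ t] (s t)) (hyY : y ∈ 𝓨) (hym : Measurable y) (hyint : Integrable y P)
    (hy0 : ∀ᵐ ω ∂P, 0 ≤ y ω)
    (hg : ∀ x ∈ StratBdd d ℱ P, Integrable (fun ω => gains s x ω * y ω) P)
    (hzero : ∀ x ∈ StratBdd d ℱ P, ∫ ω, gains s x ω * y ω ∂P = 0) :
    y ∈ Qset P ℱ s 𝓨 := by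
  refine ⟨hyY, ?_⟩
  rcases (integral_nonneg_of_ae hy0).eq_or_lt with h0 | hpos
  · exact Or.inl ((integral_eq_zero_iff_of_nonneg_ae hy0 hyint).1 h0.symm)
  refine Or.inr ⟨∫ ω, y ω ∂P, hpos, ?_⟩
  set lam := ∫ ω, y ω ∂P with hlam
  let ρ : Ω → ℝ≥0∞ := fun ω => ENNReal.ofReal (lam⁻¹ * y ω)
  have hρm : Measurable ρ := (hym.const_mul _).ennreal_ofReal
  have hρlt : ∀ᵐ ω ∂P, ρ ω < ⊤ := ae_of_all _ fun ω => ENNReal.ofReal_lt_top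
  have hρ : ∀ᵐ ω ∂P, (ρ ω).toReal = lam⁻¹ * y ω := by
    filter_upwards [hy0] with ω hω
    exact ENNReal.toReal_ofReal (mul_nonneg (inv_nonneg.2 hpos.le) hω)
  let Q := P.withDensity ρ
  have hQP : Q ≪ P := withDensity_absolutelyContinuous P ρ
  have hQ : IsProbabilityMeasure Q := by
    refine ⟨?_⟩
    rw [withDensity_apply _ MeasurableSet.univ, setLIntegral_univ,
      ← ofReal_integral_eq_lintegral_ofReal (hyint.const_mul _)
        (hy0.mono fun ω hω => mul_nonneg (inv_nonneg.2 hpos.le) hω),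
      integral_const_mul, inv_mul_cancel₀ hpos.ne', ENNReal.ofReal_one]
  have hintQ : ∀ {f : Ω → ℝ}, Integrable (fun ω => f ω * y ω) P → Integrable f Q := by
    intro f hf
    refine (integrable_withDensity_iff_integrable_smul' hρm hρlt).2
      ((hf.const_mul lam⁻¹).congr ?_)
    filter_upwards [hρ] with ω hω
    rw [hω, smul_eq_mul]
    ring
  have hIQ : ∀ f : Ω → ℝ, ∫ ω, f ω ∂Q = lam⁻¹ * ∫ ω, f ω * y ω ∂P := by
    intro f
    rw [integral_withDensity_eq_integral_toReal_smul hρm hρlt, ← integral_const_mul]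
    refine integral_congr_ae ?_
    filter_upwards [hρ] with ω hω
    rw [hω, smul_eq_mul]
    ring
  have hincr : ∀ i j : Fin (T + 1), i ≤ j → ∀ A, MeasurableSet[ℱ i] A → ∀ k : Fin d,
      Integrable (A.indicator fun ω => s j ω k - s i ω k) Q ∧
        ∫ ω in A, (s j ω k - s i ω k) ∂Q = 0 := by
    intro i j hij A hA k
    obtain ⟨x, hx, hgx⟩ := exists_buyAndHold (P := P) (s := s) hij hA k
    have e : gains s x = A.indicator fun ω => s j ω k - s i ω k := funext hgx
    refine ⟨e ▸ hintQ (hg x hx), ?_⟩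
    rw [← integral_indicator (ℱ.le i _ hA), ← e, hIQ, hzero x hx, mul_zero]
  have hsm : ∀ t, Measurable[ℱ t] fun ω => s t ω - s 0 ω := fun t =>
    (hs t).sub ((hs 0).mono (ℱ.mono (Fin.zero_le t)) le_rfl)
  have hsint : ∀ t, ∀ k, Integrable (fun ω => (s t ω - s 0 ω) k) Q := fun t k => by
    simpa using (hincr 0 t (Fin.zero_le t) Set.univ MeasurableSet.univ k).1
  have hvint : ∀ t, Integrable (fun ω => s t ω - s 0 ω) Q := fun t =>
    Integrable.of_eval fun k => hsint t k
  refine ⟨Q, hQ, hQP, ⟨fun t => (hsm t).stronglyMeasurable, fun i j hij => ?_⟩, ?_⟩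
  · refine (ae_eq_condExp_of_forall_setIntegral_eq (ℱ.le i) (hvint j)
      (fun A _ _ => (hvint i).integrableOn) (fun A hA _ => ?_)
      (hsm i).stronglyMeasurable.aestronglyMeasurable).symm
    funext k
    rw [eval_integral (fun k => (hsint i k).integrableOn),
      eval_integral (fun k => (hsint j k).integrableOn)]
    have h1 := (hincr i j hij A hA k).2
    have h2 : ∀ ω, s j ω k - s i ω k = (s j ω - s 0 ω) k - (s i ω - s 0 ω) k := by
      intro ω; simp
    simp_rw [h2] at h1
    rw [integral_sub (hsint j k).integrableOn (hsint i k).integrableOn] at h1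
    linarith
  · filter_upwards [Measure.rnDeriv_withDensity P hρm, hρ] with ω h1 h2
    rw [h1, h2, mul_inv_cancel_left₀ hpos.ne']

lemma integrable_mul_and_integral_eq_zero_of_condExp {Ω : Type*} {m mΩ : MeasurableSpace Ω}
    (hm : m ≤ mΩ) {Q : Measure Ω} [IsFiniteMeasure Q] {ξ D : Ω → ℝ} (hξ : StronglyMeasurable[m] ξ) {M : ℝ}
    (hM : ∀ ω, |ξ ω| ≤ M) (hD : Integrable D Q) (h0 : Q[D | m] =ᵐ[Q] 0) :
    Integrable (fun ω => ξ ω * D ω) Q ∧ ∫ ω, ξ ω * D ω ∂Q = 0 := by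
  have hI : Integrable (ξ * D) Q :=
    hD.bdd_mul (hξ.mono hm).aestronglyMeasurable (ae_of_all _ hM)
  refine ⟨hI, ?_⟩
  have h1 := condExp_mul_of_stronglyMeasurable_left hξ hI hD
  have h2 : ∫ ω, (ξ * D) ω ∂Q = 0 := by
    rw [← integral_condExp hm, integral_congr_ae (g := fun _ => 0), integral_zero]
    filter_upwards [h1, h0] with ω e1 e2
    rw [e1, Pi.mul_apply, e2, Pi.zero_apply, mul_zero]
  exact h2

/-- Gains with integrable negative part under a martingale measure are integrable with zero mean. -/
lemma integrable_gains_of_martingale {Q : Measure Ω} [IsProbabilityMeasure Q]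
    (hs : ∀ t, Measurable[ℱ t] (s t)) (hQ : Martingale (fun t ω => s t ω - s 0 ω) ℱ Q)
    {x : Fin T → Ω → (Fin d → ℝ)} (hx : x ∈ Strat d ℱ)
    (hneg : ∫⁻ ω, ENNReal.ofReal (-gains s x ω) ∂Q ≠ ⊤) :
    Integrable (gains s x) Q ∧ ∫ ω, gains s x ω ∂Q = 0 := by
  classical
  have hincr : ∀ (t : Fin T) (k : Fin d), Integrable (fun ω => (s t.succ ω - s t.castSucc ω) k) Q ∧
      Q[fun ω => (s t.succ ω - s t.castSucc ω) k | ℱ t.castSucc] =ᵐ[Q] 0 := by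
    intro t k
    have hint : ∀ t, Integrable (fun ω => (s t ω - s 0 ω) k) Q := fun t => (hQ.integrable t).eval k
    have e : (fun ω => (s t.succ ω - s t.castSucc ω) k) =
        fun ω => (s t.succ ω - s 0 ω) k - (s t.castSucc ω - s 0 ω) k := by
      funext ω; simp
    have hI : Integrable (fun ω => (s t.succ ω - s t.castSucc ω) k) Q :=
      e ▸ (hint t.succ).sub (hint t.castSucc)
    refine ⟨hI, (ae_eq_condExp_of_forall_setIntegral_eq (ℱ.le _) hI
      (fun _ _ _ => integrableOn_zero) (fun A hA _ => ?_)
      aestronglyMeasurable_zero).symm⟩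
    have h1 := hQ.setIntegral_eq (Fin.castSucc_le_succ t) hA
    have h2 := congrFun h1 k
    rw [eval_integral (fun k => ((hQ.integrable _).eval k).integrableOn),
      eval_integral (fun k => ((hQ.integrable _).eval k).integrableOn)] at h2
    rw [e, integral_sub (hint _).integrableOn (hint _).integrableOn, h2]
    simp
  let 𝒢 : ℕ → MeasurableSpace Ω := fun k => ℱ ⟨min k T, by omega⟩
  let D : ℕ → Ω → ℝ := fun k ω => if h : k < T then
    x ⟨k, h⟩ ω ⬝ᵥ (s (Fin.succ ⟨k, h⟩) ω - s (Fin.castSucc ⟨k, h⟩) ω) else 0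
  let B : ℕ → ℕ → Set Ω := fun k n => {ω | ∀ h : k < T, ‖x ⟨k, h⟩ ω‖ ≤ n}
  have h𝒢 : ∀ t : Fin T, 𝒢 t = ℱ t.castSucc := fun t =>
    congrArg (fun k => (ℱ k : MeasurableSpace Ω)) (Fin.ext (by simp))
  have h𝒢' : ∀ t : Fin T, 𝒢 (t + 1) = ℱ t.succ := fun t =>
    congrArg (fun k => (ℱ k : MeasurableSpace Ω)) (Fin.ext (by simp))
  have hDt : ∀ t : Fin T, D t = fun ω => x t ω ⬝ᵥ (s t.succ ω - s t.castSucc ω) := by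
    intro t; funext ω; exact dif_pos t.2
  have hsum : ∀ ω, gains s x ω = ∑ k ∈ Finset.range T, D k ω := by
    intro ω
    rw [← Fin.sum_univ_eq_sum_range (fun k => D k ω)]
    simp only [hDt, gains]
  have hBt : ∀ (t : Fin T) n, B t n = {ω | ‖x t ω‖ ≤ n} := by
    intro t n; ext ω; simp [B]
  have hDT : ∀ k, ¬ k < T → D k = 0 := by
    intro k hk; funext ω; simp [D, hk]
  have hBT : ∀ k n, ¬ k < T → B k n = Set.univ := by
    intro k n hk; ext ω; simp [B, hk]
  have hbdd : ∀ (t : Fin T) (n : ℕ) (A : Set Ω), A ⊆ B t n → MeasurableSet[𝒢 t] A →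
      IntegrableOn (D t) A Q ∧ ∫ ω in A, D t ω ∂Q = 0 := by
    intro t n A hAB hA
    rw [h𝒢] at hA
    rw [hBt] at hAB
    have hAm : MeasurableSet A := ℱ.le _ _ hA
    have e : A.indicator (D t) =
        fun ω => ∑ k, A.indicator (fun ω => x t ω k) ω * (s t.succ ω - s t.castSucc ω) k := by
      funext ω
      by_cases hω : ω ∈ A
      · simp [hω, hDt, dotProduct]
      · simp [hω]
    have hk : ∀ k, _ := fun k => integrable_mul_and_integral_eq_zero_of_condExp (ℱ.le t.castSucc)
      (Q := Q) (ξ := A.indicator (fun ω => x t ω k)) (M := n)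
      ((((measurable_pi_apply k).comp (hx t)).indicator hA).stronglyMeasurable)
      (fun ω => by
        by_cases hω : ω ∈ A
        · simp only [hω, Set.indicator_of_mem]
          exact (norm_le_pi_norm (x t ω) k).trans (hAB hω)
        · simp [hω])
      (hincr t k).1 (hincr t k).2
    rw [← integrable_indicator_iff hAm, ← integral_indicator hAm, e]
    refine ⟨integrable_finsetSum _ fun k _ => (hk k).1, ?_⟩
    rw [integral_finsetSum _ fun k _ => (hk k).1]
    exact Finset.sum_eq_zero fun k _ => (hk k).2
  have hBm : ∀ k n, MeasurableSet[𝒢 k] (B k n) := by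
    intro k n
    by_cases hk : k < T
    · rw [hBt ⟨k, hk⟩ n, h𝒢 ⟨k, hk⟩]
      exact measurableSet_le (measurable_norm.comp (hx _)) measurable_const
    · rw [hBT k n hk]
      exact MeasurableSet.univ
  have hDm : ∀ k, Measurable[𝒢 (k + 1)] (D k) := by
    intro k
    by_cases hk : k < T
    · rw [hDt ⟨k, hk⟩, h𝒢' ⟨k, hk⟩]
      unfold dotProduct
      refine Finset.measurable_fun_sum _ fun i _ => Measurable.mul ?_ ?_
      · exact (measurable_pi_apply i).comp ((hx _).mono (ℱ.mono (Fin.castSucc_le_succ _)) le_rfl)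
      · exact (measurable_pi_apply i).comp
          ((hs _).sub ((hs _).mono (ℱ.mono (Fin.castSucc_le_succ _)) le_rfl))
    · rw [hDT k hk]
      exact measurable_const
  have hstep : ∀ k n (A : Set Ω), A ⊆ B k n → MeasurableSet[𝒢 k] A →
      IntegrableOn (D k) A Q ∧ ∫ ω in A, D k ω ∂Q = 0 := by
    intro k n A hAB hA
    by_cases hk : k < T
    · exact hbdd ⟨k, hk⟩ n A hAB hA
    · rw [hDT k hk]
      exact ⟨integrableOn_zero, by simp⟩
  simp_rw [hsum] at hneg
  have := integrable_sum_range_of_lintegral_neg_ne_top 𝒢 (fun k => ℱ.le _)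
    (fun i j hij => ℱ.mono (Fin.mk_le_mk.2 (min_le_min_right T hij))) D hDm B hBm
    (fun k i j hij ω hω h => (hω h).trans (by exact_mod_cast hij))
    (fun k => Set.eq_univ_iff_forall.2 fun ω => by
      by_cases hk : k < T
      · obtain ⟨n, hn⟩ := exists_nat_ge ‖x ⟨k, hk⟩ ω‖
        exact Set.mem_iUnion.2 ⟨n, fun _ => hn⟩
      · exact Set.mem_iUnion.2 ⟨0, fun h => absurd h hk⟩)
    (fun k n => (hstep k n _ subset_rfl (hBm k n)).1)
    (fun k n A hAB hA => (hstep k n A hAB hA).2) T hneg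
  rwa [show gains s x = fun ω => ∑ k ∈ Finset.range T, D k ω from funext hsum]

lemma integrable_gains_mul_of_mem_Qset [IsProbabilityMeasure P]
    (hs : ∀ t, Measurable[ℱ t] (s t)) (hy : y ∈ Qset P ℱ s 𝓨)
    {x : Fin T → Ω → (Fin d → ℝ)} (hx : x ∈ Strat d ℱ)
    (hneg : ∫⁻ ω, ENNReal.ofReal (-(gains s x ω * y ω)) ∂P ≠ ⊤) :
    Integrable (fun ω => gains s x ω * y ω) P ∧ ∫ ω, gains s x ω * y ω ∂P = 0 := by
  obtain ⟨-, h0 | ⟨lam, hlam, Q, hQ, hQP, hmart, hyQ⟩⟩ := hy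
  · have e : (fun ω => gains s x ω * y ω) =ᵐ[P] fun _ => 0 := by
      filter_upwards [h0] with ω hω
      simp [hω]
    exact ⟨(integrable_zero _ _ _).congr e.symm, by rw [integral_congr_ae e, integral_zero]⟩
  have e : (fun ω => gains s x ω * y ω) =ᵐ[P]
      fun ω => lam * ((Q.rnDeriv P ω).toReal • gains s x ω) := by
    filter_upwards [hyQ] with ω hω
    rw [hω, smul_eq_mul]
    ring
  have hgm := measurable_gains hs hx
  have hgneg : Measurable fun ω => ENNReal.ofReal (-gains s x ω) := hgm.neg.ennreal_ofReal
  have hnegQ : ∫⁻ ω, ENNReal.ofReal (-gains s x ω) ∂Q ≠ ⊤ := by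
    rw [← lintegral_rnDeriv_mul hQP hgneg.aemeasurable]
    have e' : ∀ᵐ ω ∂P, ENNReal.ofReal (-(gains s x ω * y ω)) =
        ENNReal.ofReal lam * (Q.rnDeriv P ω * ENNReal.ofReal (-gains s x ω)) := by
      filter_upwards [hyQ, Q.rnDeriv_lt_top P] with ω h1 h2
      rw [h1, show -(gains s x ω * (lam * (Q.rnDeriv P ω).toReal)) =
        lam * ((Q.rnDeriv P ω).toReal * -gains s x ω) by ring, ENNReal.ofReal_mul hlam.le,
        ENNReal.ofReal_mul ENNReal.toReal_nonneg, ENNReal.ofReal_toReal h2.ne]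
    rw [lintegral_congr_ae e', lintegral_const_mul' _ _ ENNReal.ofReal_ne_top] at hneg
    intro htop
    apply hneg
    exact (congrArg _ htop).trans (ENNReal.mul_top (by simpa using hlam))
  obtain ⟨h1, h2⟩ := integrable_gains_of_martingale hs hmart hx hnegQ
  refine ⟨(((integrable_rnDeriv_smul_iff hQP).2 h1).const_mul lam).congr e.symm, ?_⟩
  rw [integral_congr_ae e, integral_const_mul, integral_rnDeriv_smul hQP, h2, mul_zero]

lemma conjU_le_of_mem_Qset [IsProbabilityMeasure P] (hs : ∀ t, Measurable[ℱ t] (s t))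
    (hV_meas : Measurable (fun p : ℝ × Ω => V p.1 p.2))
    (hV_mono : ∀ ω, ∀ c c' : ℝ, c ≤ c' → V c ω ≤ V c' ω) (hV_zero : ∀ ω, V 0 ω = 0)
    (h𝓤meas : ∀ u ∈ 𝓤, Measurable u) (hym : Measurable y)
    (hpair : ∀ u ∈ 𝓤, Integrable (fun ω => u ω * y ω) P) (hy : y ∈ Qset P ℱ s 𝓨)
    (hW : ∫⁻ ω, (Vconj V (y ω) ω).toENNReal ∂P ≠ ⊤) :
    conjU P 𝓤 (fun v => phiALM P ℱ V s v.1) y ≤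
      ((∫⁻ ω, (Vconj V (y ω) ω).toENNReal ∂P : ℝ≥0∞) : EReal) := by
  obtain ⟨-, -, w3⟩ := integrable_toReal_of_lintegral_toENNReal_ne_top
    (measurable_Vconj hV_meas hV_mono hym) (fun ω => Vconj_nonneg hV_zero (y ω) ω) hW
  refine iSup_le fun u => EReal.coe_sub_le_of_coe_sub_le (le_iInf₂ fun x hx => ?_)
  by_cases hobj : objALM P V s x u.1 = ⊤
  · rw [hobj]
    exact le_top
  have hobj := lt_top_iff_ne_top.2 hobj
  obtain ⟨g1, g2⟩ := integrable_gains_mul_of_mem_Qset hs hy hx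
    (lintegral_neg_gains_mul_ne_top hs hV_meas hV_mono hV_zero hym hW hx (h𝓤meas u u.2)
      (hpair u u.2) hobj)
  obtain ⟨-, -, v3, v4⟩ := objALM_eq_integral hs hV_meas hV_mono hV_zero hym hW hx (h𝓤meas u u.2)
    (hpair u u.2) g1 hobj
  rw [v3, w3, ← EReal.coe_sub, EReal.coe_le_coe_iff]
  rwa [g2, sub_zero] at v4

end MartingaleDensities

theorem stmt_8
    {Ω : Type*} {mΩ : MeasurableSpace Ω} (P : Measure Ω) [IsProbabilityMeasure P]
    {T d : ℕ} (ℱ : Filtration (Fin (T + 1)) mΩ)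
    -- the adapted price process `s`
    (s : Fin (T + 1) → Ω → (Fin d → ℝ)) (hs_adapted : ∀ t, Measurable[ℱ t] (s t))
    -- `V` is a convex normal integrand, nondecreasing, nonconstant, with `V(0,ω) = 0`
    (V : ℝ → Ω → EReal)
    (hV_meas : Measurable (fun p : ℝ × Ω => V p.1 p.2))
    (hV_bot : ∀ ω, ∀ c, V c ω ≠ ⊥)
    (hV_lsc : ∀ ω, LowerSemicontinuous (fun c => V c ω))
    (hV_convex : ∀ (ω : Ω) (a b : ℝ) (c₁ c₂ : ℝ), 0 < a → 0 < b → a + b = 1 →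
      V (a * c₁ + b * c₂) ω ≤ (a : EReal) * V c₁ ω + (b : EReal) * V c₂ ω)
    (hV_mono : ∀ ω, ∀ c c' : ℝ, c ≤ c' → V c ω ≤ V c' ω)
    (hV_noncst : ∀ ω, ∃ c c' : ℝ, V c ω ≠ V c' ω)
    (hV_zero : ∀ ω, V 0 ω = 0)
    -- `𝓤` and `𝓨` are decomposable spaces of random variables in separating duality
    (𝓤 𝓨 : Submodule ℝ (Ω → ℝ))
    (h𝓤meas : ∀ u ∈ 𝓤, Measurable u) (h𝓨meas : ∀ y ∈ 𝓨, Measurable y)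
    (h𝓤dec : DecomposableR P 𝓤) (h𝓨dec : DecomposableR P 𝓨)
    (hpair : ∀ u ∈ 𝓤, ∀ y ∈ 𝓨, Integrable (fun ω => u ω * y ω) P)
    (hsep𝓤 : ∀ u ∈ 𝓤, (∀ y ∈ 𝓨, ∫ ω, u ω * y ω ∂P = 0) → u =ᵐ[P] 0)
    (hsep𝓨 : ∀ y ∈ 𝓨, (∀ u ∈ 𝓤, ∫ ω, u ω * y ω ∂P = 0) → y =ᵐ[P] 0)
    -- for every `x ∈ 𝓝^∞` there is `u ∈ 𝓤` with `E V(u − Σ x_t·Δs_{t+1}) < ∞`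
    (hfin : ∀ x ∈ StratBdd d ℱ P, ∃ u ∈ 𝓤, objALM P V s x u < ⊤) :
    -- `(cl φ)(u) = φ**(u) = sup_{y∈𝓠} E[uy − V*(y)]` for every `u ∈ 𝓤`
    ∀ u : 𝓤,
      clU P 𝓤 𝓨 (fun v => phiALM P ℱ V s v.1) u =
        (⨆ y ∈ Qset P ℱ s 𝓨,
          EE P (fun ω => ((u.1 ω * y ω : ℝ) : EReal) - Vconj V (y ω) ω)) ∧
      biconjU P 𝓤 𝓨 (fun v => phiALM P ℱ V s v.1) u =
        (⨆ y ∈ Qset P ℱ s 𝓨,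
          EE P (fun ω => ((u.1 ω * y ω : ℝ) : EReal) - Vconj V (y ω) ω)) := by
  have hbi : ∀ u : 𝓤, biconjU P 𝓤 𝓨 (fun v => phiALM P ℱ V s v.1) u =
      (⨆ y ∈ Qset P ℱ s 𝓨,
        EE P (fun ω => ((u.1 ω * y ω : ℝ) : EReal) - Vconj V (y ω) ω)) := by
    intro u
    have hEE : ∀ y ∈ 𝓨, EE P (fun ω => ((u.1 ω * y ω : ℝ) : EReal) - Vconj V (y ω) ω) =
        (∫ ω, u.1 ω * y ω ∂P : ℝ) -
          ((∫⁻ ω, (Vconj V (y ω) ω).toENNReal ∂P : ℝ≥0∞) : EReal) := fun y hy =>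
      EE_coe_sub (hpair u u.2 y hy) (measurable_Vconj hV_meas hV_mono (h𝓨meas y hy))
        fun ω => Vconj_nonneg hV_zero (y ω) ω
    refine le_antisymm (iSup_le fun y => ?_) (iSup₂_le fun y hy => ?_)
    · by_cases hconj : conjU P 𝓤 (fun v => phiALM P ℱ V s v.1) y.1 = ⊤
      · simp [hconj]
      have hym := h𝓨meas y.1 y.2
      have hp : ∀ u ∈ 𝓤, Integrable (fun ω => u ω * y.1 ω) P := fun u hu => hpair u hu y.1 y.2
      have hK := lintegral_Vconj_le_conjU (ℱ := ℱ) (s := s) hV_meas hV_bot hV_mono hV_zero h𝓤dec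
        hym hp
      have hW : ∫⁻ ω, (Vconj V (y.1 ω) ω).toENNReal ∂P ≠ ⊤ := by
        intro htop
        rw [htop] at hK
        exact hconj (top_le_iff.1 hK)
      have hy1 : Integrable y.1 P := by
        simpa using hp (fun _ => 1) (mem_of_bounded h𝓤dec measurable_const (M := 1) (by simp))
      have hy0 : ∀ᵐ ω ∂P, 0 ≤ y.1 ω := by
        filter_upwards [ae_lt_top (measurable_Vconj hV_meas hV_mono hym).ereal_toENNReal hW]
          with ω hω
        exact nonneg_of_Vconj_ne_top hV_mono hV_zero (EReal.toENNReal_ne_top_iff.1 hω.ne)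
      have hQ : y.1 ∈ Qset P ℱ s 𝓨 := mem_Qset_of_integral_gains_mul_eq_zero hs_adapted y.2 hym
        hy1 hy0
        (fun x hx => integrable_gains_mul hs_adapted hV_meas hV_mono hV_zero h𝓤meas hfin hym hp
          hW hx)
        (fun x hx => integral_gains_mul_eq_zero hs_adapted hV_meas hV_mono hV_zero h𝓤meas h𝓤dec
          hfin hym hp hW hconj hx)
      refine le_iSup₂_of_le y.1 hQ ?_
      rw [hEE y.1 y.2]
      exact EReal.sub_le_sub le_rfl hK
    · rw [hEE y hy.1]
      by_cases hW : ∫⁻ ω, (Vconj V (y ω) ω).toENNReal ∂P = ⊤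
      · simp [hW]
      refine le_iSup_of_le ⟨y, hy.1⟩ (EReal.sub_le_sub le_rfl ?_)
      exact conjU_le_of_mem_Qset hs_adapted hV_meas hV_mono hV_zero h𝓤meas (h𝓨meas y hy.1)
        (fun u hu => hpair u hu y hy.1) hy hW
  exact fun u => ⟨(clU_eq_biconjU hpair _ u).trans (hbi u), hbi u⟩
end
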